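/- Let d ≥ 2 and let B be a collision kernel satisfying the standing assumptions (1.1) and the Lipschitz assumption (1.2). Let ε ∈ (0,1], λ ∈ [1,∞), p ∈ (2,∞) and T ∈ [0,∞). Then there exist constants α = α(d,p) > 0 and C = C(B,d,ε,λ,p,T) < ∞ with the following property: for all N, N′ ∈ ℕ with N ≤ N′ and any Kac processes (μ_t^N)_{t≥0} in 𝒮_N and (μ_t^{N′})_{t≥0} in 𝒮_{N′} with collision kernel B such that ∫|v|^p μ_0^N(dv) ≤ λ and ∫|v|^p μ_0^{N′}(dv) ≤ λ, with probability exceeding 1 − ε one has W(μ_t^N, μ_t^{N′}) ≤ C (W(μ_0^N, μ_0^{N′}) + N^{−α}) for all t ∈ [0,T]. -/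

import Mathlib

open MeasureTheory ProbabilityTheory Filter
open scoped ENNReal NNReal RealInnerProductSpace

noncomputable section

abbrev Vd (d : ℕ) := EuclideanSpace ℝ (Fin d)

namespace KacModel

variable {d : ℕ}

/-- Post-collision velocity `v' = (v+v*)/2 + |v-v*|σ/2`. -/
def postV (v vs σ : Vd d) : Vd d := (2:ℝ)⁻¹ • (v + vs) + ((2:ℝ)⁻¹ * ‖v - vs‖) • σ

/-- Post-collision velocity `v'_* = (v+v*)/2 - |v-v*|σ/2`. -/
def postVs (v vs σ : Vd d) : Vd d := (2:ℝ)⁻¹ • (v + vs) - ((2:ℝ)⁻¹ * ‖v - vs‖) • σ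

/-- The unit sphere `S^{d-1}` regarded as a subset of `ℝ^d`. -/
def unitSphere (d : ℕ) : Set (Vd d) := {σ | ‖σ‖ = 1}

/-- Standing assumptions (1.1) on a collision kernel, regarded as a family of
measures on `ℝ^d` carried by the unit sphere. -/
structure IsCollisionKernel (B : Vd d → Measure (Vd d)) : Prop where
  measurable : ∀ s : Set (Vd d), MeasurableSet s → Measurable fun v => B v s
  prob : ∀ u : Vd d, ‖u‖ = 1 → IsProbabilityMeasure (B u)
  support : ∀ u : Vd d, ‖u‖ = 1 → B u ((unitSphere d \ {u, -u})ᶜ) = 0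
  scaling : ∀ (c : ℝ), 0 ≤ c → ∀ u : Vd d, ‖u‖ = 1 →
    B (c • u) = ENNReal.ofReal c • B u
  symm : ∀ (R : Vd d ≃ₗᵢ[ℝ] Vd d) (u : Vd d), ‖u‖ = 1 → B (R u) = (B u).map R

/-- Total variation distance between two finite measures (dual formulation). -/
def tvDist {E : Type*} [MeasurableSpace E] (μ ν : Measure E) : ℝ :=
  ⨆ f : {f : E → ℝ // Measurable f ∧ ∀ x, |f x| ≤ 1},
    ((∫ x, f.1 x ∂μ) - ∫ x, f.1 x ∂ν)

/-- The Lipschitz assumption (1.2). -/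
def IsLipschitzKernel (B : Vd d → Measure (Vd d)) (κ : ℝ) : Prop :=
  1 ≤ κ ∧ ∀ v v' : Vd d, tvDist (B v) (B v') ≤ κ * ‖v - v'‖

/-- The Boltzmann sphere 𝒮. -/
def boltzmannSphere (d : ℕ) : Set (Measure (Vd d)) :=
  {μ | IsProbabilityMeasure μ ∧ (∫ v, v ∂μ) = 0 ∧ (∫ v, ‖v‖ ^ 2 ∂μ) = 1}

/-- 𝒮_N : normalized empirical measures in the Boltzmann sphere. -/
def empiricalSphere (d N : ℕ) : Set (Measure (Vd d)) :=
  {μ | μ ∈ boltzmannSphere d ∧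
    ∃ x : Fin N → Vd d, μ = (N : ℝ≥0∞)⁻¹ • ∑ i, Measure.dirac (x i)}

/-- The class ℱ of test functions. -/
def testF (d : ℕ) : Set (Vd d → ℝ) :=
  {f | (∀ v, |f v / (1 + ‖v‖ ^ 2)| ≤ 1) ∧
    ∀ v v', |f v / (1 + ‖v‖ ^ 2) - f v' / (1 + ‖v'‖ ^ 2)| ≤ ‖v - v'‖}

/-- The weighted Wasserstein distance W. -/
def Wdist (μ ν : Measure (Vd d)) : ℝ :=
  ⨆ f : testF d, ((∫ v, (f : Vd d → ℝ) v ∂μ) - ∫ v, (f : Vd d → ℝ) v ∂ν)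

/-- The p-th moment `∫ |v|^p dμ`, as a lower integral. -/
def momentL (p : ℝ) (μ : Measure (Vd d)) : ℝ≥0∞ :=
  ∫⁻ v, (‖v‖₊ : ℝ≥0∞) ^ p ∂μ

/-- Total variation measure |μ - ν| of the difference of two finite measures. -/
def tvMeasure {E : Type*} [MeasurableSpace E] (μ ν : Measure E) : Measure E :=
  (μ - ν) + (ν - μ)

/-- The post-collision update `μ^{v,v_*,σ}` of an empirical measure. -/
def collUpdate (N : ℕ) (μ : Measure (Vd d)) (v vs σ : Vd d) : Measure (Vd d) :=
  μ + (N : ℝ≥0∞)⁻¹ • (Measure.dirac (postV v vs σ) + Measure.dirac (postVs v vs σ))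
    - (N : ℝ≥0∞)⁻¹ • (Measure.dirac v + Measure.dirac vs)

/-- The generator 𝒢 of the Kac process. -/
def kacGen (B : Vd d → Measure (Vd d)) (N : ℕ) (F : Measure (Vd d) → ℝ)
    (μ : Measure (Vd d)) : ℝ :=
  N * ∫ v, (∫ vs, (∫ σ, (F (collUpdate N μ v vs σ) - F μ) ∂(B (v - vs))) ∂μ) ∂μ

/-- A Kac process with collision kernel `B` and particle number `N`:
a càdlàg adapted 𝒮_N-valued process solving the martingale problem for 𝒢. -/
structure IsKacProcess {Ω : Type*} [m : MeasurableSpace Ω]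
    (B : Vd d → Measure (Vd d)) (N : ℕ) (P : Measure Ω)
    (𝓕 : Filtration ℝ m) (μp : ℝ → Ω → Measure (Vd d)) : Prop where
  mem : ∀ t ω, μp t ω ∈ empiricalSphere d N
  adapted : ∀ f ∈ testF d, Adapted 𝓕 fun t ω => ∫ v, f v ∂(μp t ω)
  rightCont : ∀ ω, ∀ f ∈ testF d, ∀ t : ℝ,
    ContinuousWithinAt (fun s => ∫ v, f v ∂(μp s ω)) (Set.Ici t) t
  leftLim : ∀ ω, ∀ f ∈ testF d, ∀ t : ℝ, 0 < t →
    ∃ L : ℝ, Tendsto (fun s => ∫ v, f v ∂(μp s ω)) (nhdsWithin t (Set.Iio t)) (nhds L)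
  martingale : ∀ G : Measure (Vd d) → ℝ, Measurable G → (∃ M : ℝ, ∀ ν, |G ν| ≤ M) →
    Martingale (fun t ω => G (μp t ω) - ∫ s in Set.Ioc (0:ℝ) t, kacGen B N G (μp s ω)) 𝓕 P

/-- `⟨f, Q(μ,ν)⟩`, the Boltzmann collision integral. -/
def QInt (B : Vd d → Measure (Vd d)) (f : Vd d → ℝ) (μ ν : Measure (Vd d)) : ℝ :=
  ∫ v, (∫ vs, (∫ σ, (f (postV v vs σ) + f (postVs v vs σ) - f v - f vs) ∂(B (v - vs))) ∂ν) ∂μ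

/-- Measure solution of the spatially homogeneous Boltzmann equation, started at time τ. -/
def IsBoltzmannSolutionFrom (B : Vd d → Measure (Vd d)) (τ : ℝ)
    (μt : ℝ → Measure (Vd d)) : Prop :=
  (∀ t, τ ≤ t → μt t ∈ boltzmannSphere d) ∧
  ∀ f : Vd d → ℝ, Measurable f → (∃ M, ∀ v, |f v| ≤ M) → HasCompactSupport f →
    ∀ t, τ ≤ t →
      (∫ v, f v ∂(μt t)) = (∫ v, f v ∂(μt τ)) + ∫ s in Set.Ioc τ t, QInt B f (μt s) (μt s)

/-- Measure solution of the spatially homogeneous Boltzmann equation (start time 0). -/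
def IsBoltzmannSolution (B : Vd d → Measure (Vd d)) (μt : ℝ → Measure (Vd d)) : Prop :=
  IsBoltzmannSolutionFrom B 0 μt

/-- Local boundedness in 𝒮(p) from time τ on. -/
def LocBddMomentFrom (p τ : ℝ) (μt : ℝ → Measure (Vd d)) : Prop :=
  ∀ T, τ ≤ T → ∃ M : ℝ≥0∞, M ≠ ⊤ ∧ ∀ t ∈ Set.Icc τ T, momentL p (μt t) ≤ M

/-- Sample mean. -/
def sampleMean {Ω : Type*} {N : ℕ} (Vs : Fin N → Ω → Vd d) (ω : Ω) : Vd d :=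
  (N : ℝ)⁻¹ • ∑ i, Vs i ω

/-- Sample mean square. -/
def sampleQ {Ω : Type*} {N : ℕ} (Vs : Fin N → Ω → Vd d) (ω : Ω) : ℝ :=
  (N : ℝ)⁻¹ * ∑ i, ‖Vs i ω‖ ^ 2

/-- Sample variance. -/
def sampleS {Ω : Type*} {N : ℕ} (Vs : Fin N → Ω → Vd d) (ω : Ω) : ℝ :=
  sampleQ Vs ω - ‖sampleMean Vs ω‖ ^ 2

/-- The rescaled empirical distribution μ̃^N. -/
def rescaledEmpirical {Ω : Type*} {N : ℕ} (Vs : Fin N → Ω → Vd d)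
    (μdef : Measure (Vd d)) (ω : Ω) : Measure (Vd d) :=
  if 0 < sampleS Vs ω then
    (N : ℝ≥0∞)⁻¹ • ∑ i, Measure.dirac
      ((Real.sqrt (sampleS Vs ω))⁻¹ • (Vs i ω - sampleMean Vs ω))
  else μdef

/-- The N-sample empirical distribution. -/
def empMeasure {Ω : Type*} {N : ℕ} (Vs : Fin N → Ω → Vd d) (ω : Ω) : Measure (Vd d) :=
  (N : ℝ≥0∞)⁻¹ • ∑ i, Measure.dirac (Vs i ω)

end KacModel

open KacModel
namespace KacAux

variable {d : ℕ}

/-- Normalised form of the collision kernel and the facts used about it. -/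
structure GoodKer (B : Vd d → Measure (Vd d)) (κ : ℝ) (Bn : Kernel (Vd d) (Vd d)) : Prop where
  markov : IsMarkovKernel Bn
  eqB : ∀ w, B w = ENNReal.ofReal ‖w‖ • Bn w
  unit : ∀ w, ∀ᵐ σ ∂(Bn w), ‖σ‖ = 1
  lip : ∀ g : Vd d → ℝ, Measurable g → ∀ b : ℝ, (∀ σ, ‖σ‖ = 1 → |g σ| ≤ b) →
    ∀ w w', |‖w‖ * (∫ σ, g σ ∂(Bn w)) - ‖w'‖ * ∫ σ, g σ ∂(Bn w')| ≤ κ * b * ‖w - w'‖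
  neg : ∀ w, w ≠ 0 → ∀ g : Vd d → ℝ, Measurable g →
    ∫ σ, g σ ∂(Bn (-w)) = ∫ σ, g (-σ) ∂(Bn w)
  one_le : 1 ≤ κ
  pov : ∀ p : ℝ, 2 < p → ∃ c : ℝ, c < 1 ∧ 0 ≤ c ∧ ∀ w, 
    ∫ σ, (‖(2:ℝ)⁻¹ • (w + ‖w‖ • σ)‖ ^ p + ‖(2:ℝ)⁻¹ • (w - ‖w‖ • σ)‖ ^ p) ∂(Bn w) ≤ c * ‖w‖ ^ p

lemma half_sq (u σ : Vd d) (hu : ‖u‖ = 1) (hσ : ‖σ‖ = 1) :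
    ‖(2:ℝ)⁻¹ • (u + σ)‖ ^ 2 + ‖(2:ℝ)⁻¹ • (u - σ)‖ ^ 2 = 1 := by
  have h := parallelogram_law_with_norm ℝ u σ
  rw [norm_smul, norm_smul, hu, hσ] at *
  rw [Real.norm_of_nonneg (by norm_num)]
  nlinarith

lemma pov_strict (u σ : Vd d) (hu : ‖u‖ = 1) (hσ : ‖σ‖ = 1) (h1 : σ ≠ u) (h2 : σ ≠ -u)
    (p : ℝ) (hp : 2 < p) :
    ‖(2:ℝ)⁻¹ • (u + σ)‖ ^ p + ‖(2:ℝ)⁻¹ • (u - σ)‖ ^ p < 1 := by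
  have h := half_sq u σ hu hσ
  have hx : 0 < ‖(2:ℝ)⁻¹ • (u + σ)‖ := by
    rw [norm_pos_iff]; intro h0
    rw [smul_eq_zero] at h0
    rcases h0 with h0 | h0
    · norm_num at h0
    · exact h2 (eq_neg_of_add_eq_zero_right h0)
  have hy : 0 < ‖(2:ℝ)⁻¹ • (u - σ)‖ := by
    rw [norm_pos_iff]; intro h0
    rw [smul_eq_zero] at h0
    rcases h0 with h0 | h0
    · norm_num at h0
    · exact h1 (sub_eq_zero.1 h0).symm
  set x := ‖(2:ℝ)⁻¹ • (u + σ)‖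
  set y := ‖(2:ℝ)⁻¹ • (u - σ)‖
  have hx1 : x < 1 := by nlinarith
  have hy1 : y < 1 := by nlinarith
  have e1 : x ^ p < x ^ 2 := by
    rw [← Real.rpow_natCast]
    exact Real.rpow_lt_rpow_of_exponent_gt hx hx1 (by simpa using hp)
  have e2 : y ^ p < y ^ 2 := by
    rw [← Real.rpow_natCast]
    exact Real.rpow_lt_rpow_of_exponent_gt hy hy1 (by simpa using hp)
  linarith

lemma exists_goodKer (hd : 2 ≤ d) (B : Vd d → Measure (Vd d)) (κ : ℝ)
    (hB : IsCollisionKernel B) (hBL : IsLipschitzKernel B κ) :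
    ∃ Bn : Kernel (Vd d) (Vd d), GoodKer B κ Bn := by
  classical
  obtain ⟨e, he⟩ : ∃ e : Vd d, ‖e‖ = 1 :=
    ⟨EuclideanSpace.single ⟨0, by omega⟩ 1, by simp⟩
  let nrm : Vd d → Vd d := fun w => if w = 0 then e else ‖w‖⁻¹ • w
  have hn : ∀ w, ‖nrm w‖ = 1 := by
    intro w
    by_cases hw : w = 0
    · simp [nrm, hw, he]
    · simp only [nrm, hw, if_false]
      rw [norm_smul, norm_inv, norm_norm, inv_mul_cancel₀ (norm_ne_zero_iff.2 hw)]
  have hnw : ∀ w, ‖w‖ • nrm w = w := by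
    intro w
    by_cases hw : w = 0
    · simp [hw]
    · simp only [nrm, hw, if_false]
      rw [smul_smul, mul_inv_cancel₀ (norm_ne_zero_iff.2 hw), one_smul]
  have hnm : Measurable nrm :=
    Measurable.ite (measurableSet_singleton 0) measurable_const (by fun_prop)
  let Bn : Kernel (Vd d) (Vd d) := ⟨fun w => B (nrm w),
    Measure.measurable_of_measurable_coe _ (fun s hs => (hB.measurable s hs).comp hnm)⟩
  have hBn : ∀ w, Bn w = B (nrm w) := fun w => rfl
  have hmk : IsMarkovKernel Bn := ⟨fun w => hB.prob _ (hn w)⟩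
  have eqB : ∀ w, B w = ENNReal.ofReal ‖w‖ • Bn w := by
    intro w
    rw [hBn, ← hB.scaling ‖w‖ (norm_nonneg _) _ (hn w), hnw]
  have supp : ∀ u, ‖u‖ = 1 → ∀ᵐ σ ∂(B u), ‖σ‖ = 1 ∧ σ ≠ u ∧ σ ≠ -u := by
    intro u hu
    have := hB.support u hu
    rw [ae_iff]
    refine measure_mono_null ?_ this
    intro σ hσ
    simp only [Set.mem_setOf_eq] at hσ
    simp only [Set.mem_compl_iff, Set.mem_diff, unitSphere, Set.mem_setOf_eq, Set.mem_insert_iff,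
      Set.mem_singleton_iff]
    tauto
  have unit : ∀ w, ∀ᵐ σ ∂(Bn w), ‖σ‖ = 1 := by
    intro w
    filter_upwards [supp _ (hn w)] with σ hσ using hσ.1
  have hint : ∀ w (g : Vd d → ℝ), ∫ σ, g σ ∂(B w) = ‖w‖ * ∫ σ, g σ ∂(Bn w) := by
    intro w g
    rw [eqB w, integral_smul_measure, ENNReal.toReal_ofReal (norm_nonneg _), smul_eq_mul]
  have ubd : ∀ w (g : Vd d → ℝ) (b : ℝ), (∀ σ, |g σ| ≤ b) → |∫ σ, g σ ∂(Bn w)| ≤ b := by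
    intro w g b hg
    have := norm_integral_le_of_norm_le_const (μ := Bn w) (f := g) (C := b)
      (Eventually.of_forall hg)
    simpa using this
  have tv : ∀ w w' (g : Vd d → ℝ), Measurable g → (∀ σ, |g σ| ≤ 1) →
      (∫ σ, g σ ∂(B w)) - ∫ σ, g σ ∂(B w') ≤ κ * ‖w - w'‖ := by
    intro w w' g hg hg1
    refine le_trans ?_ (hBL.2 w w')
    unfold tvDist
    refine le_ciSup (f := fun f : {f : Vd d → ℝ // Measurable f ∧ ∀ x, |f x| ≤ 1} =>
      ((∫ x, f.1 x ∂(B w)) - ∫ x, f.1 x ∂(B w'))) ?_ ⟨g, hg, hg1⟩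
    refine ⟨‖w‖ + ‖w'‖, ?_⟩
    rintro _ ⟨f, rfl⟩
    simp only [hint]
    have h1 := abs_le.1 (ubd w f.1 1 f.2.2)
    have h2 := abs_le.1 (ubd w' f.1 1 f.2.2)
    nlinarith [norm_nonneg w, norm_nonneg w']
  have lip1 : ∀ w w' (g : Vd d → ℝ), Measurable g → ∀ b : ℝ, (∀ σ, |g σ| ≤ b) →
      (∫ σ, g σ ∂(B w)) - ∫ σ, g σ ∂(B w') ≤ κ * b * ‖w - w'‖ := by
    intro w w' g hg b hb
    have hb0 : 0 ≤ b := (abs_nonneg _).trans (hb 0)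
    rcases hb0.eq_or_lt with rfl | hb0
    · have : g = fun _ => 0 := by
        funext σ; exact abs_eq_zero.1 (le_antisymm (hb σ) (abs_nonneg _))
      simp [this]
    · have := tv w w' (fun σ => b⁻¹ * g σ) (hg.const_mul _) (fun σ => by
        rw [abs_mul, abs_of_pos (inv_pos.2 hb0), inv_mul_le_iff₀ hb0]; simpa using hb σ)
      rw [integral_const_mul, integral_const_mul, ← mul_sub, inv_mul_le_iff₀ hb0] at this
      linarith
  refine ⟨Bn, hmk, eqB, unit, ?_, ?_, hBL.1, ?_⟩
  · intro g hg b hb w w'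
    let g' : Vd d → ℝ := fun σ => if ‖σ‖ = 1 then g σ else 0
    have hb0 : 0 ≤ b := (abs_nonneg _).trans (hb e he)
    have hg' : Measurable g' :=
      Measurable.ite (measurable_norm (measurableSet_singleton 1)) hg measurable_const
    have hb' : ∀ σ, |g' σ| ≤ b := by
      intro σ
      by_cases h : ‖σ‖ = 1
      · simp [g', h, hb σ h]
      · simp [g', h, hb0]
    have hgg : ∀ w, ∫ σ, g σ ∂(Bn w) = ∫ σ, g' σ ∂(Bn w) := by
      intro w
      refine integral_congr_ae ?_
      filter_upwards [unit w] with σ hσ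
      simp [g', hσ]
    rw [hgg, hgg, ← hint, ← hint, abs_le]
    have h1 := lip1 w w' g' hg' b hb'
    have h2 := lip1 w' w g' hg' b hb'
    rw [norm_sub_rev] at h2
    constructor <;> linarith
  · intro w hw g hg
    have h1 : nrm (-w) = LinearIsometryEquiv.neg ℝ (nrm w) := by
      simp [nrm, hw]
    rw [hBn, h1, hB.symm _ _ (hn w), hBn]
    rw [integral_map (LinearIsometryEquiv.continuous _).measurable.aemeasurable
      hg.aestronglyMeasurable]
    simp
  · intro p hp
    let q : Vd d → Vd d → ℝ := fun u σ =>
      ‖(2:ℝ)⁻¹ • (u + σ)‖ ^ p + ‖(2:ℝ)⁻¹ • (u - σ)‖ ^ p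
    have hqc : ∀ u, Continuous (q u) := by
      intro u
      have : 0 ≤ p := by linarith
      exact ((continuous_norm.comp (by fun_prop)).rpow_const (fun _ => Or.inr this)).add
        ((continuous_norm.comp (by fun_prop)).rpow_const (fun _ => Or.inr this))
    have hq0 : ∀ u σ, 0 ≤ q u σ := fun u σ => by positivity
    have hlt : ∀ᵐ σ ∂(B e), q e σ < 1 := by
      filter_upwards [supp e he] with σ hσ
      exact pov_strict e σ he hσ.1 hσ.2.1 hσ.2.2 p hp
    haveI := hB.prob e he
    have hqi : Integrable (q e) (B e) := by
      refine Integrable.of_bound (C := 1) (hqc e).aestronglyMeasurable ?_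
      filter_upwards [hlt] with σ hσ
      rw [Real.norm_of_nonneg (hq0 _ _)]; exact hσ.le
    refine ⟨∫ σ, q e σ ∂(B e), ?_, integral_nonneg (hq0 e), ?_⟩
    · by_contra hcon
      push Not at hcon
      have h3 : 0 < ∫ σ, (1 - q e σ) ∂(B e) := by
        rw [integral_pos_iff_support_of_nonneg_ae]
        · have : Function.support (fun σ => 1 - q e σ) =ᵐ[B e] Set.univ := by
            rw [eventuallyEq_univ]
            filter_upwards [hlt] with σ hσ
            exact (sub_pos.2 hσ).ne'
          rw [measure_congr this]; simp
        · filter_upwards [hlt] with σ hσ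
          exact (sub_pos.2 hσ).le
        · exact (integrable_const 1).sub hqi
      rw [integral_sub (integrable_const 1) hqi] at h3
      simp at h3
      linarith
    · intro w
      have hrot : ∫ σ, q (nrm w) σ ∂(B (nrm w)) = ∫ σ, q e σ ∂(B e) := by
        let R : Vd d ≃ₗᵢ[ℝ] Vd d := (ℝ ∙ (e - nrm w))ᗮ.reflection
        have hR : R e = nrm w := Submodule.reflection_sub (by rw [he, hn])
        rw [← hR, hB.symm R e he, integral_map R.continuous.measurable.aemeasurable
          (hqc _).aestronglyMeasurable]
        refine integral_congr_ae (Eventually.of_forall fun σ => ?_)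
        simp only [q]
        rw [← map_add, ← map_sub, ← map_smul, ← map_smul, R.norm_map, R.norm_map]
      rw [← hrot, ← hBn, mul_comm, ← integral_const_mul]
      refine le_of_eq (integral_congr_ae (Eventually.of_forall fun σ => ?_))
      simp only [q]
      have h1 : (2:ℝ)⁻¹ • (w + ‖w‖ • σ) = ‖w‖ • ((2:ℝ)⁻¹ • (nrm w + σ)) := by
        rw [smul_comm, smul_add ‖w‖, hnw]
      have h2 : (2:ℝ)⁻¹ • (w - ‖w‖ • σ) = ‖w‖ • ((2:ℝ)⁻¹ • (nrm w - σ)) := by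
        rw [smul_comm, smul_sub ‖w‖, hnw]
      rw [h1, h2, norm_smul ‖w‖, norm_smul ‖w‖, norm_norm,
        Real.mul_rpow (norm_nonneg _) (norm_nonneg _),
        Real.mul_rpow (norm_nonneg _) (norm_nonneg _), mul_add]

end KacAux

namespace KacAux

variable {d : ℕ}

/-- The weight `1 + |v|²`. -/
def wt (v : Vd d) : ℝ := 1 + ‖v‖ ^ 2

/-- Weighted Lipschitz class with constant `Z`. -/
def Cls (Z : ℝ) (f : Vd d → ℝ) : Prop :=
  (∀ v, |f v| ≤ Z * wt v) ∧ ∀ v v', |f v - f v'| ≤ Z * (wt v + wt v') * ‖v - v'‖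

/-- Collision integrand. -/
def colJ (Bn : Kernel (Vd d) (Vd d)) (f : Vd d → ℝ) (v vs : Vd d) : ℝ :=
  ‖v - vs‖ * ∫ σ, (f (postV v vs σ) + f (postVs v vs σ) - f v - f vs) ∂(Bn (v - vs))

/-- Gain part of the collision integrand. -/
def colG (Bn : Kernel (Vd d) (Vd d)) (f : Vd d → ℝ) (v vs : Vd d) : ℝ :=
  ‖v - vs‖ * ∫ σ, (f (postV v vs σ) + f (postVs v vs σ) - f vs) ∂(Bn (v - vs))

/-- Cutoff. -/
def psi (R : ℝ) (v : Vd d) : ℝ := R / (R + ‖v‖)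

lemma wt_pos (v : Vd d) : 1 ≤ wt v := by unfold wt; nlinarith [norm_nonneg v]
lemma wt_le (v : Vd d) : wt v ≤ (1 + ‖v‖) ^ 2 := by unfold wt; nlinarith [norm_nonneg v]
lemma one_add_le_wt (v : Vd d) : 1 + ‖v‖ ≤ 2 * wt v := by
  unfold wt; nlinarith [norm_nonneg v, sq_nonneg (‖v‖ - 1)]
lemma continuous_wt : Continuous (wt : Vd d → ℝ) := by unfold wt; fun_prop

lemma norm_sub_le_one (v vs : Vd d) : ‖v - vs‖ ≤ (1 + ‖v‖) * (1 + ‖vs‖) := by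
  have := norm_sub_le v vs
  nlinarith [norm_nonneg v, norm_nonneg vs, mul_nonneg (norm_nonneg v) (norm_nonneg vs)]

lemma post_energy (v vs σ : Vd d) (hσ : ‖σ‖ = 1) :
    ‖postV v vs σ‖ ^ 2 + ‖postVs v vs σ‖ ^ 2 = ‖v‖ ^ 2 + ‖vs‖ ^ 2 := by
  have h1 := parallelogram_law_with_norm ℝ ((2:ℝ)⁻¹ • (v + vs)) (((2:ℝ)⁻¹ * ‖v - vs‖) • σ)
  have h2 := parallelogram_law_with_norm ℝ v vs
  simp only [norm_smul, hσ, Real.norm_eq_abs, abs_mul, abs_norm] at h1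
  rw [abs_of_pos (by norm_num : (0:ℝ) < 2⁻¹)] at h1
  unfold postV postVs
  nlinarith

lemma wt_post (v vs σ : Vd d) (hσ : ‖σ‖ = 1) :
    wt (postV v vs σ) + wt (postVs v vs σ) = wt v + wt vs := by
  have := post_energy v vs σ hσ
  unfold wt; linarith

lemma postV_diff (v v' vs σ : Vd d) (hσ : ‖σ‖ = 1) :
    ‖postV v vs σ - postV v' vs σ‖ ≤ ‖v - v'‖ := by
  have : postV v vs σ - postV v' vs σ
      = (2:ℝ)⁻¹ • (v - v') + ((2:ℝ)⁻¹ * (‖v - vs‖ - ‖v' - vs‖)) • σ := by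
    unfold postV; module
  rw [this]
  refine (norm_add_le _ _).trans ?_
  rw [norm_smul, norm_smul, hσ, Real.norm_eq_abs, Real.norm_eq_abs, abs_mul,
    abs_of_pos (by norm_num : (0:ℝ) < 2⁻¹)]
  have := abs_norm_sub_norm_le (v - vs) (v' - vs)
  rw [sub_sub_sub_cancel_right] at this
  linarith

lemma postVs_eq (v vs σ : Vd d) : postVs v vs σ = postV v vs (-σ) := by
  unfold postV postVs; module

lemma postV_swap (v vs σ : Vd d) : postV vs v σ = postV v vs σ := by
  unfold postV; rw [norm_sub_rev, add_comm vs v]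

lemma postVs_swap (v vs σ : Vd d) : postVs vs v σ = postVs v vs σ := by
  rw [postVs_eq, postVs_eq, postV_swap]

lemma postVs_diff (v v' vs σ : Vd d) (hσ : ‖σ‖ = 1) :
    ‖postVs v vs σ - postVs v' vs σ‖ ≤ ‖v - v'‖ := by
  rw [postVs_eq, postVs_eq]; exact postV_diff v v' vs _ (by rwa [norm_neg])

lemma continuous_postV : Continuous (fun x : (Vd d × Vd d) × Vd d => postV x.1.1 x.1.2 x.2) := by
  unfold postV; fun_prop
lemma continuous_postVs : Continuous (fun x : (Vd d × Vd d) × Vd d => postVs x.1.1 x.1.2 x.2) := by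
  unfold postVs; fun_prop
lemma continuous_postV' (v vs : Vd d) : Continuous (fun σ => postV v vs σ) := by
  unfold postV; fun_prop
lemma continuous_postVs' (v vs : Vd d) : Continuous (fun σ => postVs v vs σ) := by
  unfold postVs; fun_prop

lemma Cls.nonneg {Z : ℝ} {f : Vd d → ℝ} (hf : Cls Z f) : 0 ≤ Z := by
  have := (abs_nonneg _).trans (hf.1 0)
  nlinarith [wt_pos (0 : Vd d)]

lemma Cls.continuous {Z : ℝ} {f : Vd d → ℝ} (hf : Cls Z f) : Continuous f := by
  rw [continuous_iff_continuousAt]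
  intro v0
  rw [ContinuousAt, tendsto_iff_norm_sub_tendsto_zero]
  refine squeeze_zero (fun _ => norm_nonneg _) (fun v => hf.2 v v0) ?_
  have : Continuous fun v : Vd d => Z * (wt v + wt v0) * ‖v - v0‖ := by
    have := continuous_wt (d := d); fun_prop
  have h := this.tendsto v0
  simpa using h

lemma Cls.mono {Z Z' : ℝ} {f : Vd d → ℝ} (hf : Cls Z f) (h : Z ≤ Z') : Cls Z' f := by
  refine ⟨fun v => (hf.1 v).trans ?_, fun v v' => (hf.2 v v').trans ?_⟩
  · have := wt_pos v; gcongr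
  · have := wt_pos v; have := wt_pos v'; gcongr

lemma Cls.smul {Z : ℝ} {f : Vd d → ℝ} (hf : Cls Z f) (c : ℝ) (hc : 0 ≤ c) :
    Cls (c * Z) (fun v => c * f v) := by
  refine ⟨fun v => ?_, fun v v' => ?_⟩
  · rw [abs_mul, abs_of_nonneg hc, mul_assoc]
    exact mul_le_mul_of_nonneg_left (hf.1 v) hc
  · rw [← mul_sub, abs_mul, abs_of_nonneg hc, mul_assoc, mul_assoc, ← mul_assoc Z]
    exact mul_le_mul_of_nonneg_left (hf.2 v v') hc

lemma Cls.sub {Z Z' : ℝ} {f g : Vd d → ℝ} (hf : Cls Z f) (hg : Cls Z' g) :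
    Cls (Z + Z') (fun v => f v - g v) := by
  refine ⟨fun v => ?_, fun v v' => ?_⟩
  · have h1 := hf.1 v; have h2 := hg.1 v
    rw [abs_le] at *; constructor <;> linarith
  · have h1 := hf.2 v v'; have h2 := hg.2 v v'
    rw [abs_le] at *; constructor <;> linarith

section ker
variable {B : Vd d → Measure (Vd d)} {κ : ℝ} {Bn : Kernel (Vd d) (Vd d)}

lemma GoodKer.integrable (hK : GoodKer B κ Bn) (w : Vd d) (g : Vd d → ℝ) (hg : Measurable g) (b : ℝ)
    (hb : ∀ σ, ‖σ‖ = 1 → |g σ| ≤ b) : Integrable g (Bn w) := by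
  haveI := hK.markov
  refine Integrable.of_bound (C := b) hg.aestronglyMeasurable ?_
  filter_upwards [hK.unit w] with σ hσ using hb σ hσ

lemma GoodKer.bound (hK : GoodKer B κ Bn) (w : Vd d) (g : Vd d → ℝ) (b : ℝ)
    (hb : ∀ σ, ‖σ‖ = 1 → |g σ| ≤ b) : |∫ σ, g σ ∂(Bn w)| ≤ b := by
  haveI := hK.markov
  have := norm_integral_le_of_norm_le_const (μ := Bn w) (f := g) (C := b)
    (by filter_upwards [hK.unit w] with σ hσ using hb σ hσ)
  simpa using this

lemma GoodKer.integral (hK : GoodKer B κ Bn) (w : Vd d) (g : Vd d → ℝ) :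
    ∫ σ, g σ ∂(B w) = ‖w‖ * ∫ σ, g σ ∂(Bn w) := by
  rw [hK.eqB w, integral_smul_measure, ENNReal.toReal_ofReal (norm_nonneg _), smul_eq_mul]

lemma QInt_eq (hK : GoodKer B κ Bn) (f : Vd d → ℝ) (μ ν : Measure (Vd d)) :
    QInt B f μ ν = ∫ v, (∫ vs, colJ Bn f v vs ∂ν) ∂μ := by
  unfold QInt colJ
  simp only [hK.integral]

lemma colJ_symm (hK : GoodKer B κ Bn) {f : Vd d → ℝ} (hf : Measurable f) (v vs : Vd d) :
    colJ Bn f v vs = colJ Bn f vs v := by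
  unfold colJ
  by_cases h : v - vs = 0
  · have h' : vs - v = 0 := by rw [← neg_sub, h, neg_zero]
    simp [h, h']
  · rw [norm_sub_rev vs v, ← neg_sub v vs, hK.neg _ h]
    · congr 1
      refine integral_congr_ae (Eventually.of_forall fun σ => ?_)
      simp only [postV_swap v vs, postVs_swap v vs]
      rw [postVs_eq v vs (-σ), neg_neg, ← postVs_eq]
      ring
    · have h1 := (continuous_postV' vs v).measurable
      have h2 := (continuous_postVs' vs v).measurable
      fun_prop

lemma measurable_colJ (hK : GoodKer B κ Bn) {f : Vd d → ℝ} (hf : Measurable f) :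
    Measurable (fun x : Vd d × Vd d => colJ Bn f x.1 x.2) := by
  haveI := hK.markov
  unfold colJ
  refine Measurable.mul (by fun_prop) ?_
  let η : Kernel (Vd d × Vd d) (Vd d) := Bn.comap (fun x => x.1 - x.2) (by fun_prop)
  have hm : StronglyMeasurable (fun y : (Vd d × Vd d) × Vd d =>
      f (postV y.1.1 y.1.2 y.2) + f (postVs y.1.1 y.1.2 y.2) - f y.1.1 - f y.1.2) := by
    have h1 := (continuous_postV (d := d)).measurable
    have h2 := (continuous_postVs (d := d)).measurable
    refine Measurable.stronglyMeasurable ?_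
    fun_prop
  have := (hm.integral_kernel_prod_right' (κ := η)).measurable
  exact this

lemma colJ_eq (hK : GoodKer B κ Bn) {Z : ℝ} {f : Vd d → ℝ} (hf : Cls Z f) (v vs : Vd d) :
    colJ Bn f v vs = colG Bn f v vs - ‖v - vs‖ * f v := by
  haveI := hK.markov
  unfold colJ colG
  have h1 := (continuous_postV' v vs)
  have h2 := (continuous_postVs' v vs)
  have hc := hf.continuous
  have hi : Integrable (fun σ => f (postV v vs σ) + f (postVs v vs σ) - f vs) (Bn (v - vs)) := by
    refine hK.integrable _ _ (by fun_prop) (Z * (wt v + 2 * wt vs)) fun σ hσ => ?_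
    have e1 := abs_le.1 (hf.1 (postV v vs σ))
    have e2 := abs_le.1 (hf.1 (postVs v vs σ))
    have e3 := abs_le.1 (hf.1 vs)
    have e4 := wt_post v vs σ hσ
    have : Z * wt (postV v vs σ) + Z * wt (postVs v vs σ) = Z * (wt v + wt vs) := by
      rw [← mul_add, e4]
    rw [abs_le]; constructor <;> linarith
  have : ∀ σ, f (postV v vs σ) + f (postVs v vs σ) - f v - f vs
    = (f (postV v vs σ) + f (postVs v vs σ) - f vs) - f v := fun σ => by ring
  simp only [this]
  rw [integral_sub hi (integrable_const _)]
  simp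
  ring

lemma colG_bound (hK : GoodKer B κ Bn) {Z : ℝ} {f : Vd d → ℝ} (hf : Cls Z f) (v vs : Vd d) :
    |colG Bn f v vs| ≤ Z * (‖v - vs‖ * (wt v + 2 * wt vs)) := by
  unfold colG
  rw [abs_mul, abs_norm]
  have : |∫ σ, (f (postV v vs σ) + f (postVs v vs σ) - f vs) ∂(Bn (v - vs))|
      ≤ Z * (wt v + 2 * wt vs) := by
    refine hK.bound _ _ _ fun σ hσ => ?_
    have e1 := abs_le.1 (hf.1 (postV v vs σ))
    have e2 := abs_le.1 (hf.1 (postVs v vs σ))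
    have e3 := abs_le.1 (hf.1 vs)
    have e4 := wt_post v vs σ hσ
    have : Z * wt (postV v vs σ) + Z * wt (postVs v vs σ) = Z * (wt v + wt vs) := by
      rw [← mul_add, e4]
    rw [abs_le]; constructor <;> linarith
  calc _ ≤ ‖v - vs‖ * (Z * (wt v + 2 * wt vs)) := by gcongr
    _ = _ := by ring

lemma colJ_bound (hK : GoodKer B κ Bn) {Z : ℝ} {f : Vd d → ℝ} (hf : Cls Z f) (v vs : Vd d) :
    |colJ Bn f v vs| ≤ 2 * Z * (‖v - vs‖ * (wt v + wt vs)) := by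
  rw [colJ_eq hK hf]
  have h1 := colG_bound hK hf v vs
  have h2 : |‖v - vs‖ * f v| ≤ ‖v - vs‖ * (Z * wt v) := by
    rw [abs_mul, abs_norm]; exact mul_le_mul_of_nonneg_left (hf.1 v) (norm_nonneg _)
  have := abs_sub (colG Bn f v vs) (‖v - vs‖ * f v)
  calc _ ≤ _ := this
    _ ≤ Z * (‖v - vs‖ * (wt v + 2 * wt vs)) + ‖v - vs‖ * (Z * wt v) := add_le_add h1 h2
    _ = _ := by ring

lemma colG_diff (hK : GoodKer B κ Bn) {Z : ℝ} {f : Vd d → ℝ} (hf : Cls Z f) (v v' vs : Vd d) :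
    |colG Bn f v vs - colG Bn f v' vs| ≤
      Z * ‖v - v'‖ * (‖v - vs‖ * (wt v + wt v' + 2 * wt vs) + κ * (wt v' + 2 * wt vs)) := by
  haveI := hK.markov
  have hc := hf.continuous
  have hbd : ∀ u σ, ‖σ‖ = 1 → |f (postV u vs σ) + f (postVs u vs σ) - f vs|
      ≤ Z * (wt u + 2 * wt vs) := by
    intro u σ hσ
    have e1 := abs_le.1 (hf.1 (postV u vs σ))
    have e2 := abs_le.1 (hf.1 (postVs u vs σ))
    have e3 := abs_le.1 (hf.1 vs)
    have e4 := wt_post u vs σ hσ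
    have : Z * wt (postV u vs σ) + Z * wt (postVs u vs σ) = Z * (wt u + wt vs) := by
      rw [← mul_add, e4]
    rw [abs_le]; constructor <;> linarith
  have hm : ∀ u, Measurable fun σ => f (postV u vs σ) + f (postVs u vs σ) - f vs := by
    intro u
    have h1 := (continuous_postV' u vs)
    have h2 := (continuous_postVs' u vs)
    fun_prop
  have hA := hK.lip _ (hm v') _ (hbd v') (v - vs) (v' - vs)
  rw [sub_sub_sub_cancel_right] at hA
  have hB : |(∫ σ, (f (postV v vs σ) + f (postVs v vs σ) - f vs) ∂(Bn (v - vs)))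
      - ∫ σ, (f (postV v' vs σ) + f (postVs v' vs σ) - f vs) ∂(Bn (v - vs))|
      ≤ Z * ‖v - v'‖ * (wt v + wt v' + 2 * wt vs) := by
    rw [← integral_sub (hK.integrable _ _ (hm v) _ (hbd v)) (hK.integrable _ _ (hm v') _ (hbd v'))]
    refine hK.bound _ _ _ fun σ hσ => ?_
    have hZ := hf.nonneg
    have e1 := hf.2 (postV v vs σ) (postV v' vs σ)
    have e2 := hf.2 (postVs v vs σ) (postVs v' vs σ)
    have e3 : |f (postV v vs σ) - f (postV v' vs σ)| ≤
        Z * (wt (postV v vs σ) + wt (postV v' vs σ)) * ‖v - v'‖ := by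
      refine e1.trans (mul_le_mul_of_nonneg_left (postV_diff _ _ _ _ hσ) ?_)
      have := wt_pos (postV v vs σ); have := wt_pos (postV v' vs σ); positivity
    have e4 : |f (postVs v vs σ) - f (postVs v' vs σ)| ≤
        Z * (wt (postVs v vs σ) + wt (postVs v' vs σ)) * ‖v - v'‖ := by
      refine e2.trans (mul_le_mul_of_nonneg_left (postVs_diff _ _ _ _ hσ) ?_)
      have := wt_pos (postVs v vs σ); have := wt_pos (postVs v' vs σ); positivity
    have e5 := wt_post v vs σ hσ
    have e6 := wt_post v' vs σ hσ
    have e7 : Z * ‖v - v'‖ * (wt v + wt v' + 2 * wt vs) =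
        Z * (wt (postV v vs σ) + wt (postV v' vs σ)) * ‖v - v'‖ +
        Z * (wt (postVs v vs σ) + wt (postVs v' vs σ)) * ‖v - v'‖ := by
      have : wt v + wt v' + 2 * wt vs = (wt (postV v vs σ) + wt (postV v' vs σ)) +
        (wt (postVs v vs σ) + wt (postVs v' vs σ)) := by linarith
      rw [this]; ring
    rw [e7]
    rw [abs_le] at *
    constructor <;> linarith
  unfold colG
  have hC : |‖v - vs‖ * ((∫ σ, (f (postV v vs σ) + f (postVs v vs σ) - f vs) ∂(Bn (v - vs)))
      - ∫ σ, (f (postV v' vs σ) + f (postVs v' vs σ) - f vs) ∂(Bn (v - vs)))|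
      ≤ ‖v - vs‖ * (Z * ‖v - v'‖ * (wt v + wt v' + 2 * wt vs)) := by
    rw [abs_mul, abs_norm]; exact mul_le_mul_of_nonneg_left hB (norm_nonneg _)
  rw [abs_le] at *
  constructor <;> linarith

end ker

end KacAux

namespace KacAux

variable {d : ℕ}

lemma psi_nonneg {R : ℝ} (hR : 1 ≤ R) (v : Vd d) : 0 ≤ psi R v := by
  unfold psi; positivity

lemma psi_le_one {R : ℝ} (hR : 1 ≤ R) (v : Vd d) : psi R v ≤ 1 := by
  unfold psi
  rw [div_le_one (by positivity)]
  linarith [norm_nonneg v]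

lemma psi_diff {R : ℝ} (hR : 1 ≤ R) (v v' : Vd d) :
    |psi R v - psi R v'| * (1 + ‖v'‖) ≤ ‖v - v'‖ := by
  unfold psi
  have h1 : 0 < R + ‖v‖ := by positivity
  have h2 : 0 < R + ‖v'‖ := by positivity
  have h3 : R / (R + ‖v‖) - R / (R + ‖v'‖) = R / (R + ‖v‖) * ((‖v'‖ - ‖v‖) / (R + ‖v'‖)) := by
    field_simp; ring
  have h4 : |‖v'‖ - ‖v‖| ≤ ‖v - v'‖ := by
    rw [abs_sub_comm]; exact abs_norm_sub_norm_le v v'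
  have h5 : R / (R + ‖v‖) ≤ 1 := psi_le_one hR v
  have h6 : 0 ≤ R / (R + ‖v‖) := by positivity
  rw [h3, abs_mul, abs_of_nonneg h6, abs_div, abs_of_pos h2]
  calc R / (R + ‖v‖) * (|‖v'‖ - ‖v‖| / (R + ‖v'‖)) * (1 + ‖v'‖)
      ≤ 1 * (‖v - v'‖ / (R + ‖v'‖)) * (R + ‖v'‖) := by gcongr
    _ = ‖v - v'‖ := by field_simp

lemma continuous_psi {R : ℝ} (hR : 1 ≤ R) : Continuous (psi R : Vd d → ℝ) := by
  unfold psi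
  refine Continuous.div (by fun_prop) (by fun_prop) fun v => ?_
  positivity

lemma abs5 {a b c e g A B C E G : ℝ} (h1 : |a| ≤ A) (h2 : |b| ≤ B) (h3 : |c| ≤ C)
    (h4 : |e| ≤ E) (h5 : |g| ≤ G) : |a - b - c + e + g| ≤ A + B + C + E + G := by
  rw [abs_le] at *
  constructor <;> linarith

section ker
variable {B : Vd d → Measure (Vd d)} {κ : ℝ} {Bn : Kernel (Vd d) (Vd d)}

lemma measurable_colG (hK : GoodKer B κ Bn) {Z : ℝ} {f : Vd d → ℝ} (hf : Cls Z f) :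
    Measurable (fun x : Vd d × Vd d => colG Bn f x.1 x.2) := by
  have h1 := measurable_colJ hK hf.continuous.measurable
  have h2 := hf.continuous.measurable
  have : (fun x : Vd d × Vd d => colG Bn f x.1 x.2)
      = fun x => colJ Bn f x.1 x.2 + ‖x.1 - x.2‖ * f x.1 := by
    ext x; rw [colJ_eq hK hf]; ring
  rw [this]; fun_prop

/-- third-moment weight -/
def w3 (v : Vd d) : ℝ := (1 + ‖v‖) ^ 3

lemma w3_nonneg (v : Vd d) : 0 ≤ w3 v := by unfold w3; positivity
lemma continuous_w3 : Continuous (w3 : Vd d → ℝ) := by unfold w3; fun_prop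

lemma one_le_w3 (v : Vd d) : 1 ≤ w3 v := one_le_pow₀ (by linarith [norm_nonneg v])
lemma lin_le_w3 (v : Vd d) : 1 + ‖v‖ ≤ w3 v :=
  le_self_pow₀ (by linarith [norm_nonneg v]) (by norm_num)
lemma wt_le_w3 (v : Vd d) : wt v ≤ w3 v := (wt_le v).trans
  (pow_le_pow_right₀ (by linarith [norm_nonneg v]) (by norm_num))
lemma lin_wt_le_w3 (v : Vd d) : (1 + ‖v‖) * wt v ≤ w3 v := by
  have := wt_le v
  unfold w3
  have h := norm_nonneg v
  calc (1 + ‖v‖) * wt v ≤ (1 + ‖v‖) * (1 + ‖v‖) ^ 2 := by gcongr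
    _ = _ := by ring

/-- A constant times a dominated function. -/
lemma integrable_of_le_w3 {Pm : Measure (Vd d)} (hi : Integrable w3 Pm)
    {g : Vd d → ℝ} (hg : Measurable g) (c : ℝ) (h : ∀ v, |g v| ≤ c * w3 v) : Integrable g Pm :=
  (hi.const_mul c).mono' hg.aestronglyMeasurable (Eventually.of_forall fun v => h v)

lemma colG_int (hK : GoodKer B κ Bn) {Z : ℝ} {f : Vd d → ℝ} (hf : Cls Z f)
    {Pm : Measure (Vd d)} (hi : Integrable w3 Pm) (v : Vd d) :
    Integrable (fun vs => colG Bn f v vs) Pm := by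
  have hm := measurable_colG hK hf
  refine integrable_of_le_w3 hi (by fun_prop) (Z * (1 + ‖v‖) * (wt v + 2)) fun vs => ?_
  have hZ := hf.nonneg
  refine (colG_bound hK hf v vs).trans ?_
  have h1 := norm_sub_le_one v vs
  have h2 := lin_le_w3 vs
  have h3 := lin_wt_le_w3 vs
  have h4 := wt_pos v
  have h5 := wt_pos vs
  calc Z * (‖v - vs‖ * (wt v + 2 * wt vs))
      ≤ Z * (((1 + ‖v‖) * (1 + ‖vs‖)) * (wt v + 2 * wt vs)) := by gcongr
    _ = Z * (1 + ‖v‖) * (wt v * (1 + ‖vs‖) + 2 * ((1 + ‖vs‖) * wt vs)) := by ring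
    _ ≤ Z * (1 + ‖v‖) * (wt v * w3 vs + 2 * w3 vs) := by gcongr
    _ = _ := by ring

lemma dist_int {Pm : Measure (Vd d)} (hi : Integrable w3 Pm) (v : Vd d) :
    Integrable (fun vs => ‖v - vs‖) Pm := by
  refine integrable_of_le_w3 hi (by fun_prop) (1 + ‖v‖) fun vs => ?_
  rw [abs_norm]
  refine (norm_sub_le_one v vs).trans ?_
  have := lin_le_w3 vs
  gcongr

lemma colJ_int (hK : GoodKer B κ Bn) {Z : ℝ} {f : Vd d → ℝ} (hf : Cls Z f)
    {Pm : Measure (Vd d)} (hi : Integrable w3 Pm) (v : Vd d) :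
    Integrable (fun vs => colJ Bn f v vs) Pm := by
  simp only [colJ_eq hK hf]
  exact (colG_int hK hf hi v).sub ((dist_int hi v).mul_const _)

lemma colJ_integral (hK : GoodKer B κ Bn) {Z : ℝ} {f : Vd d → ℝ} (hf : Cls Z f)
    {Pm : Measure (Vd d)} (hi : Integrable w3 Pm) (v : Vd d) :
    ∫ vs, colJ Bn f v vs ∂Pm = (∫ vs, colG Bn f v vs ∂Pm) - (∫ vs, ‖v - vs‖ ∂Pm) * f v := by
  simp only [colJ_eq hK hf]
  rw [integral_sub (colG_int hK hf hi v) ((dist_int hi v).mul_const _), integral_mul_const]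

set_option maxHeartbeats 800000 in
lemma one_step (hK : GoodKer B κ Bn) {Z R : ℝ} {f : Vd d → ℝ} (hf : Cls Z f) (hR : 1 ≤ R)
    {Pm : Measure (Vd d)} (hi : Integrable w3 Pm) (hR2 : R * ∫ v, (1 + ‖v‖) ∂Pm ≤ 1) :
    Cls (Z * (1 + (9 + 3 * κ) * ∫ v, w3 v ∂Pm))
      (fun v => f v + psi R v * ∫ vs, colJ Bn f v vs ∂Pm) := by
  have hZ := hf.nonneg
  have hκ := hK.one_le
  set S := ∫ v, w3 v ∂Pm with hS
  set a : Vd d → ℝ := fun v => ∫ vs, ‖v - vs‖ ∂Pm with ha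
  set G : Vd d → ℝ := fun v => ∫ vs, colG Bn f v vs ∂Pm with hG
  have hS0 : 0 ≤ S := integral_nonneg w3_nonneg
  have ilin : Integrable (fun v : Vd d => 1 + ‖v‖) Pm :=
    integrable_of_le_w3 hi (by fun_prop) 1 fun v => by
      rw [abs_of_nonneg (by positivity), one_mul]; exact lin_le_w3 v
  have hlinS : ∫ v, (1 + ‖v‖) ∂Pm ≤ S := integral_mono ilin hi lin_le_w3
  have ha0 : ∀ v, 0 ≤ a v := fun v => integral_nonneg fun vs => norm_nonneg _
  have ha1 : ∀ v, a v ≤ (1 + ‖v‖) * ∫ v, (1 + ‖v‖) ∂Pm := fun v => by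
    rw [← integral_const_mul]
    exact integral_mono (dist_int hi v) (ilin.const_mul _) fun vs => norm_sub_le_one v vs
  have ha2 : ∀ v, a v ≤ (1 + ‖v‖) * S := fun v => (ha1 v).trans (by gcongr)
  have hpa : ∀ v, psi R v * a v ≤ 1 := fun v => by
    unfold psi
    rw [div_mul_eq_mul_div, div_le_one (by positivity)]
    have := ha1 v
    have hn := norm_nonneg v
    calc R * a v ≤ R * ((1 + ‖v‖) * ∫ v, (1 + ‖v‖) ∂Pm) := by gcongr
      _ = (1 + ‖v‖) * (R * ∫ v, (1 + ‖v‖) ∂Pm) := by ring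
      _ ≤ (1 + ‖v‖) * 1 := by gcongr
      _ ≤ _ := by linarith
  have had : ∀ v v', |a v - a v'| ≤ S * ‖v - v'‖ := fun v v' => by
    simp only [ha]
    rw [← integral_sub (dist_int hi v) (dist_int hi v'), hS, ← integral_mul_const]
    refine (abs_integral_le_integral_abs).trans ?_
    refine integral_mono ((dist_int hi v).sub (dist_int hi v')).abs (hi.mul_const _) fun vs => ?_
    have h1 := abs_norm_sub_norm_le (v - vs) (v' - vs)
    rw [sub_sub_sub_cancel_right] at h1
    have h2 := one_le_w3 vs
    calc _ ≤ 1 * ‖v - v'‖ := by simpa using h1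
      _ ≤ _ := by gcongr
  have hGb : ∀ v, |G v| ≤ Z * (a v * wt v + 4 * wt v * S) := fun v => by
    have i1 : Integrable (fun vs => Z * (‖v - vs‖ * wt v + 4 * wt v * w3 vs)) Pm :=
      (((dist_int hi v).mul_const _).add (hi.const_mul _)).const_mul _
    have : Z * (a v * wt v + 4 * wt v * S) = ∫ vs, Z * (‖v - vs‖ * wt v + 4 * wt v * w3 vs) ∂Pm := by
      rw [integral_const_mul, integral_add ((dist_int hi v).mul_const _) (hi.const_mul _),
        integral_mul_const, integral_const_mul]
    rw [this]
    refine (abs_integral_le_integral_abs).trans ?_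
    refine integral_mono (colG_int hK hf hi v).abs i1 fun vs => ?_
    refine (colG_bound hK hf v vs).trans ?_
    refine mul_le_mul_of_nonneg_left ?_ hZ
    have h1 := norm_sub_le_one v vs
    have h2 := one_add_le_wt v
    have h3 := lin_wt_le_w3 vs
    have h5 := wt_pos vs
    have h6 := wt_pos v
    have : ‖v - vs‖ * (2 * wt vs) ≤ 4 * wt v * w3 vs := by
      calc ‖v - vs‖ * (2 * wt vs) ≤ ((1 + ‖v‖) * (1 + ‖vs‖)) * (2 * wt vs) := by gcongr
        _ = 2 * (1 + ‖v‖) * ((1 + ‖vs‖) * wt vs) := by ring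
        _ ≤ 2 * (2 * wt v) * w3 vs := by gcongr
        _ = _ := by ring
    linarith
  have hGb' : ∀ v, |G v| ≤ Z * (3 * (1 + ‖v‖) * wt v * S) := fun v => by
    rw [hS, ← integral_const_mul, ← integral_const_mul]
    refine (abs_integral_le_integral_abs).trans ?_
    refine integral_mono (colG_int hK hf hi v).abs ((hi.const_mul _).const_mul _) fun vs => ?_
    refine (colG_bound hK hf v vs).trans ?_
    refine mul_le_mul_of_nonneg_left ?_ hZ
    have h1 := norm_sub_le_one v vs
    have h2 := lin_le_w3 vs
    have h3 := lin_wt_le_w3 vs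
    have h5 := wt_pos vs
    have h6 := wt_pos v
    have h7 := w3_nonneg vs
    calc ‖v - vs‖ * (wt v + 2 * wt vs) ≤ ((1 + ‖v‖) * (1 + ‖vs‖)) * (wt v + 2 * wt vs) := by gcongr
      _ = (1 + ‖v‖) * (wt v * (1 + ‖vs‖) + 2 * ((1 + ‖vs‖) * wt vs)) := by ring
      _ ≤ (1 + ‖v‖) * (wt v * w3 vs + 2 * (wt v * w3 vs)) := by
        refine mul_le_mul_of_nonneg_left (add_le_add ?_ ?_) (by positivity)
        · gcongr
        · nlinarith
      _ = _ := by ring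
  have hGd : ∀ v v', |G v - G v'| ≤ Z * ‖v - v'‖ *
      (a v * (wt v + wt v') + 4 * wt v * S + 3 * κ * wt v' * S) := fun v v' => by
    have j1 := (dist_int hi v).mul_const (wt v + wt v')
    have j2 := hi.const_mul (4 * wt v)
    have j3 := hi.const_mul (3 * κ * wt v')
    have j12 : Integrable (fun vs => ‖v - vs‖ * (wt v + wt v') + 4 * wt v * w3 vs) Pm := j1.add j2
    have : Z * ‖v - v'‖ * (a v * (wt v + wt v') + 4 * wt v * S + 3 * κ * wt v' * S)
        = ∫ vs, Z * ‖v - v'‖ * (‖v - vs‖ * (wt v + wt v') + 4 * wt v * w3 vs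
          + 3 * κ * wt v' * w3 vs) ∂Pm := by
      rw [integral_const_mul, integral_add j12 j3, integral_add j1 j2,
        integral_mul_const, integral_const_mul, integral_const_mul]
    rw [this]
    simp only [hG]
    rw [← integral_sub (colG_int hK hf hi v) (colG_int hK hf hi v')]
    refine (abs_integral_le_integral_abs).trans ?_
    refine integral_mono ((colG_int hK hf hi v).sub (colG_int hK hf hi v')).abs
      ((j12.add j3).const_mul _) fun vs => ?_
    refine (colG_diff hK hf v v' vs).trans ?_
    refine mul_le_mul_of_nonneg_left ?_ (by positivity)
    have h1 := norm_sub_le_one v vs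
    have h2 := one_add_le_wt v
    have h3 := lin_wt_le_w3 vs
    have h4 := wt_le_w3 vs
    have h5 := wt_pos vs
    have h6 := wt_pos v
    have h7 := wt_pos v'
    have h8 := one_le_w3 vs
    have e1 : ‖v - vs‖ * (2 * wt vs) ≤ 4 * wt v * w3 vs := by
      calc ‖v - vs‖ * (2 * wt vs) ≤ ((1 + ‖v‖) * (1 + ‖vs‖)) * (2 * wt vs) := by gcongr
        _ = 2 * (1 + ‖v‖) * ((1 + ‖vs‖) * wt vs) := by ring
        _ ≤ 2 * (2 * wt v) * w3 vs := by gcongr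
        _ = _ := by ring
    have e2 : κ * (wt v' + 2 * wt vs) ≤ 3 * κ * wt v' * w3 vs := by
      have : wt v' + 2 * wt vs ≤ 3 * (wt v' * w3 vs) := by nlinarith
      calc _ ≤ κ * (3 * (wt v' * w3 vs)) := by gcongr
        _ = _ := by ring
    linarith
  have hF : ∀ v, f v + psi R v * ∫ vs, colJ Bn f v vs ∂Pm
      = f v * (1 - psi R v * a v) + psi R v * G v := fun v => by
    rw [colJ_integral hK hf hi]; simp only [ha, hG]; ring
  simp only [hF]
  clear_value S a G
  clear hF hS ha hG hi
  refine ⟨fun v => ?_, fun v v' => ?_⟩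
  · have p0 := psi_nonneg hR v
    have p1 := psi_le_one hR v
    have p2 := hpa v
    have q1 := hf.1 v
    have q2 := hGb v
    have w1 := wt_pos v
    have a0 := ha0 v
    have r1 : |f v * (1 - psi R v * a v)| ≤ Z * wt v * (1 - psi R v * a v) := by
      rw [abs_mul, abs_of_nonneg (by linarith : 0 ≤ 1 - psi R v * a v)]
      exact mul_le_mul_of_nonneg_right q1 (by linarith)
    have r2 : |psi R v * G v| ≤ psi R v * (Z * (a v * wt v)) + Z * (4 * wt v * S) := by
      rw [abs_mul, abs_of_nonneg p0]
      calc _ ≤ psi R v * (Z * (a v * wt v + 4 * wt v * S)) := by gcongr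
        _ = psi R v * (Z * (a v * wt v)) + psi R v * (Z * (4 * wt v * S)) := by ring
        _ ≤ _ + 1 * (Z * (4 * wt v * S)) := by gcongr
        _ = _ := by ring
    refine (abs_add_le _ _).trans ((add_le_add r1 r2).trans ?_)
    have : 0 ≤ Z * wt v * S * (5 + 3 * κ) := by positivity
    linarith
  · have p0 := psi_nonneg hR v
    have p0' := psi_nonneg hR v'
    have p1 := psi_le_one hR v
    have p2 := hpa v
    have w1 := wt_pos v
    have w1' := wt_pos v'
    have a0 := ha0 v
    have hdec : f v * (1 - psi R v * a v) + psi R v * G v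
        - (f v' * (1 - psi R v' * a v') + psi R v' * G v')
        = (f v - f v') * (1 - psi R v * a v) - f v' * (psi R v * (a v - a v'))
          - f v' * ((psi R v - psi R v') * a v') + psi R v * (G v - G v')
          + (psi R v - psi R v') * G v' := by ring
    have hpd := psi_diff hR v v'
    have t1 : |(f v - f v') * (1 - psi R v * a v)| ≤
        Z * (wt v + wt v') * ‖v - v'‖ * (1 - psi R v * a v) := by
      rw [abs_mul, abs_of_nonneg (by linarith : 0 ≤ 1 - psi R v * a v)]
      exact mul_le_mul_of_nonneg_right (hf.2 v v') (by linarith)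
    have t2 : |f v' * (psi R v * (a v - a v'))| ≤ Z * wt v' * (1 * (S * ‖v - v'‖)) := by
      rw [abs_mul, abs_mul, abs_of_nonneg p0]
      have := hf.1 v'
      have := had v v'
      gcongr
    have t3 : |f v' * ((psi R v - psi R v') * a v')| ≤ Z * wt v' * (S * ‖v - v'‖) := by
      rw [abs_mul, abs_mul, abs_of_nonneg (ha0 v')]
      have := hf.1 v'
      have e := ha2 v'
      have : |psi R v - psi R v'| * a v' ≤ S * ‖v - v'‖ := by
        calc _ ≤ |psi R v - psi R v'| * ((1 + ‖v'‖) * S) := by gcongr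
          _ = S * (|psi R v - psi R v'| * (1 + ‖v'‖)) := by ring
          _ ≤ _ := by gcongr
      exact mul_le_mul (hf.1 v') this (mul_nonneg (abs_nonneg _) (ha0 v')) (by positivity)
    have t4 : |psi R v * (G v - G v')| ≤ Z * ‖v - v'‖ * (psi R v * a v * (wt v + wt v'))
        + Z * ‖v - v'‖ * (4 * wt v * S + 3 * κ * wt v' * S) := by
      rw [abs_mul, abs_of_nonneg p0]
      have := hGd v v'
      calc _ ≤ psi R v * (Z * ‖v - v'‖ *
            (a v * (wt v + wt v') + 4 * wt v * S + 3 * κ * wt v' * S)) := by gcongr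
        _ = Z * ‖v - v'‖ * (psi R v * a v * (wt v + wt v'))
            + psi R v * (Z * ‖v - v'‖ * (4 * wt v * S + 3 * κ * wt v' * S)) := by ring
        _ ≤ Z * ‖v - v'‖ * (psi R v * a v * (wt v + wt v'))
            + 1 * (Z * ‖v - v'‖ * (4 * wt v * S + 3 * κ * wt v' * S)) := by gcongr
        _ = _ := by ring
    have t5 : |(psi R v - psi R v') * G v'| ≤ Z * (3 * wt v' * S) * ‖v - v'‖ := by
      rw [abs_mul]
      have := hGb' v'
      calc _ ≤ |psi R v - psi R v'| * (Z * (3 * (1 + ‖v'‖) * wt v' * S)) := by gcongr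
        _ = Z * (3 * wt v' * S) * (|psi R v - psi R v'| * (1 + ‖v'‖)) := by ring
        _ ≤ _ := by gcongr
    have hsum : |(f v - f v') * (1 - psi R v * a v) - f v' * (psi R v * (a v - a v'))
          - f v' * ((psi R v - psi R v') * a v') + psi R v * (G v - G v')
          + (psi R v - psi R v') * G v'| ≤ Z * (wt v + wt v') * ‖v - v'‖ * (1 - psi R v * a v)
          + Z * wt v' * (1 * (S * ‖v - v'‖)) + Z * wt v' * (S * ‖v - v'‖)
          + (Z * ‖v - v'‖ * (psi R v * a v * (wt v + wt v'))
          + Z * ‖v - v'‖ * (4 * wt v * S + 3 * κ * wt v' * S))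
          + Z * (3 * wt v' * S) * ‖v - v'‖ := abs5 t1 t2 t3 t4 t5
    rw [hdec]
    refine hsum.trans ?_
    have : 0 ≤ Z * ‖v - v'‖ * S * (wt v * (5 + 3 * κ) + 4 * wt v') := by positivity
    linarith

/-- The truncated linearized operator preserves the class. -/
lemma psiL_cls (hK : GoodKer B κ Bn) {Z R : ℝ} {f : Vd d → ℝ} (hf : Cls Z f) (hR : 1 ≤ R)
    {π : Measure (Vd d)} (hi : Integrable w3 π) (hR2 : ∫ v, (1 + ‖v‖) ∂π ≤ 4) :
    Cls (Z * (8 * R + (9 + 3 * κ) * ∫ v, w3 v ∂π))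
      (fun v => psi R v * ∫ vs, colJ Bn f v vs ∂π) := by
  have hR0 : 0 < R := by linarith
  set s : ℝ≥0∞ := ENNReal.ofReal (1 / (4 * R)) with hs
  have hst : s.toReal = 1 / (4 * R) := ENNReal.toReal_ofReal (by positivity)
  have h1 := one_step hK hf hR (Pm := s • π) (hi.smul_measure ENNReal.ofReal_ne_top) (by
    rw [integral_smul_measure, hst, smul_eq_mul]
    calc R * (1 / (4 * R) * ∫ v, (1 + ‖v‖) ∂π) ≤ R * (1 / (4 * R) * 4) := by gcongr
      _ = 1 := by field_simp)
  have h2 := ((h1.sub hf).smul (4 * R) (by positivity))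
  have e : (fun v => 4 * R * ((f v + psi R v * ∫ vs, colJ Bn f v vs ∂(s • π)) - f v))
      = (fun v => psi R v * ∫ vs, colJ Bn f v vs ∂π) := by
    ext v
    rw [integral_smul_measure, hst, smul_eq_mul]
    field_simp
    ring
  rw [e] at h2
  refine h2.mono (le_of_eq ?_)
  rw [integral_smul_measure, hst, smul_eq_mul]
  field_simp
  ring

end ker

end KacAux

namespace KacAux

variable {d : ℕ}

/-- A measurable path of probability measures with unit energy and bounded supports. -/
structure GoodPath (Rad : ℝ) (μ : ℝ → Measure (Vd d)) : Prop where
  meas : Measurable μ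
  prob : ∀ t, IsProbabilityMeasure (μ t)
  en : ∀ t, ∫ v, ‖v‖ ^ 2 ∂(μ t) = 1
  bdd : ∀ t, ∀ᵐ v ∂(μ t), ‖v‖ ≤ Rad

lemma GoodPath.nonneg {Rad : ℝ} {μ : ℝ → Measure (Vd d)} (h : GoodPath Rad μ) : 0 ≤ Rad := by
  have := h.prob 0
  obtain ⟨v, hv⟩ := (h.bdd 0).exists
  exact (norm_nonneg v).trans hv

lemma GoodPath.integrable {Rad : ℝ} {μ : ℝ → Measure (Vd d)} (h : GoodPath Rad μ) (t : ℝ)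
    {g : Vd d → ℝ} (hg : Measurable g) (c : ℝ) (hc : ∀ v, ‖v‖ ≤ Rad → |g v| ≤ c) :
    Integrable g (μ t) := by
  have := h.prob t
  refine Integrable.of_bound (C := c) hg.aestronglyMeasurable ?_
  filter_upwards [h.bdd t] with v hv using hc v hv

lemma GoodPath.integrable_cont {Rad : ℝ} {μ : ℝ → Measure (Vd d)} (h : GoodPath Rad μ) (t : ℝ)
    {g : Vd d → ℝ} (hg : Continuous g) : Integrable g (μ t) := by
  obtain ⟨c, hc⟩ := (isCompact_closedBall (0 : Vd d) Rad).exists_bound_of_continuousOn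
    hg.continuousOn
  exact h.integrable t hg.measurable c fun v hv => hc v (by simpa using hv)

lemma GoodPath.bound {Rad : ℝ} {μ : ℝ → Measure (Vd d)} (h : GoodPath Rad μ) (t : ℝ)
    {g : Vd d → ℝ} (c : ℝ) (hc : ∀ v, ‖v‖ ≤ Rad → |g v| ≤ c) :
    |∫ v, g v ∂(μ t)| ≤ c := by
  have := h.prob t
  have := norm_integral_le_of_norm_le_const (μ := μ t) (f := g) (C := c)
    (by filter_upwards [h.bdd t] with v hv using hc v hv)
  simpa using this

lemma GoodPath.meas_int {Rad : ℝ} {μ : ℝ → Measure (Vd d)} (h : GoodPath Rad μ)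
    {E : Type*} [MeasurableSpace E] {τ : E → ℝ} (hτ : Measurable τ)
    {g : E → Vd d → ℝ} (hg : Measurable (fun x : E × Vd d => g x.1 x.2)) :
    Measurable fun x => ∫ v, g x v ∂(μ (τ x)) := by
  let k : Kernel E (Vd d) := ⟨fun x => μ (τ x), h.meas.comp hτ⟩
  have hk : IsMarkovKernel k := ⟨fun x => h.prob (τ x)⟩
  exact (hg.stronglyMeasurable.integral_kernel_prod_right' (κ := k)).measurable

lemma GoodPath.intOn {Rad : ℝ} {μ : ℝ → Measure (Vd d)} (h : GoodPath Rad μ)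
    {g : ℝ → Vd d → ℝ} (hg : Measurable (fun x : ℝ × Vd d => g x.1 x.2)) (c : ℝ)
    (hc : ∀ r v, ‖v‖ ≤ Rad → |g r v| ≤ c) (s t : ℝ) :
    IntegrableOn (fun r => ∫ v, g r v ∂(μ r)) (Set.Ioc s t) := by
  have : IsFiniteMeasure (volume.restrict (Set.Ioc s t)) := ⟨by simp⟩
  refine Integrable.of_bound (C := c) ?_ (Eventually.of_forall fun r => h.bound r c (hc r))
  exact (h.meas_int measurable_id hg).aestronglyMeasurable

lemma GoodPath.intOn_cont {Rad : ℝ} {μ : ℝ → Measure (Vd d)} (h : GoodPath Rad μ)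
    {g : Vd d → ℝ} (hg : Continuous g) (s t : ℝ) :
    IntegrableOn (fun r => ∫ v, g v ∂(μ r)) (Set.Ioc s t) := by
  obtain ⟨c, hc⟩ := (isCompact_closedBall (0 : Vd d) Rad).exists_bound_of_continuousOn
    hg.continuousOn
  exact h.intOn (g := fun _ => g) (by fun_prop) c (fun r v hv => hc v (by simpa using hv)) s t

/-- time average of the path -/
def avg (μ : ℝ → Measure (Vd d)) (s t : ℝ) : Measure (Vd d) :=
  (volume.restrict (Set.Ioc s t)).bind μ

lemma GoodPath.avg_integrable {Rad : ℝ} {μ : ℝ → Measure (Vd d)} (h : GoodPath Rad μ) (s t : ℝ)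
    {g : Vd d → ℝ} (hg : Measurable g) (c : ℝ) (hc : ∀ v, ‖v‖ ≤ Rad → |g v| ≤ c) :
    Integrable g (avg μ s t) := by
  let k : Kernel ℝ (Vd d) := ⟨μ, h.meas⟩
  have hk : IsMarkovKernel k := ⟨h.prob⟩
  have : IsFiniteMeasure (volume.restrict (Set.Ioc s t)) := ⟨by simp⟩
  change Integrable g (k ∘ₘ (volume.restrict (Set.Ioc s t)))
  rw [Measure.integrable_comp_iff hg.aestronglyMeasurable]
  refine ⟨Eventually.of_forall fun r => h.integrable r hg c hc, ?_⟩
  exact h.intOn (g := fun _ v => ‖g v‖) (by fun_prop) c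
    (fun r v hv => by simpa using hc v hv) s t

lemma GoodPath.avg_integral {Rad : ℝ} {μ : ℝ → Measure (Vd d)} (h : GoodPath Rad μ) (s t : ℝ)
    {g : Vd d → ℝ} (hg : Measurable g) (c : ℝ) (hc : ∀ v, ‖v‖ ≤ Rad → |g v| ≤ c) :
    ∫ v, g v ∂(avg μ s t) = ∫ r in Set.Ioc s t, ∫ v, g v ∂(μ r) := by
  let k : Kernel ℝ (Vd d) := ⟨μ, h.meas⟩
  have hi := h.avg_integrable s t hg c hc
  change Integrable g (k ∘ₘ (volume.restrict (Set.Ioc s t))) at hi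
  change ∫ v, g v ∂(k ∘ₘ (volume.restrict (Set.Ioc s t))) = _
  rw [Measure.comp_eq_comp_const_apply] at hi ⊢
  rw [Kernel.integral_comp hi, Kernel.const_apply]
  rfl

lemma GoodPath.lin {Rad : ℝ} {μ : ℝ → Measure (Vd d)} (h : GoodPath Rad μ) (t : ℝ) :
    ∫ v, (1 + ‖v‖) ∂(μ t) ≤ 2 := by
  have := h.prob t
  have h1 : ∫ v, (1 + ‖v‖) ∂(μ t) ≤ ∫ v, (3/2 + ‖v‖ ^ 2 / 2) ∂(μ t) := by
    refine integral_mono (h.integrable_cont t (by fun_prop)) (h.integrable_cont t (by fun_prop))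
      fun v => ?_
    nlinarith [sq_nonneg (‖v‖ - 1)]
  have h2 : ∫ v, (3/2 + ‖v‖ ^ 2 / 2) ∂(μ t) = 2 := by
    rw [integral_add (integrable_const _) (h.integrable_cont t (by fun_prop)), integral_div, integral_div, h.en]
    simp; norm_num
  rw [h2] at h1; exact h1

lemma GoodPath.quad {Rad : ℝ} {μ : ℝ → Measure (Vd d)} (h : GoodPath Rad μ) (t : ℝ) :
    ∫ v, (1 + ‖v‖) ^ 2 ∂(μ t) ≤ 4 := by
  have := h.prob t
  have h1 : ∫ v, (1 + ‖v‖) ^ 2 ∂(μ t) ≤ ∫ v, (2 + 2 * ‖v‖ ^ 2) ∂(μ t) := by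
    refine integral_mono (h.integrable_cont t (by fun_prop)) (h.integrable_cont t (by fun_prop))
      fun v => ?_
    nlinarith [sq_nonneg (‖v‖ - 1)]
  have h2 : ∫ v, (2 + 2 * ‖v‖ ^ 2) ∂(μ t) = 4 := by
    rw [integral_add (integrable_const _) (h.integrable_cont t (by fun_prop)),
      integral_const_mul, h.en]
    simp; norm_num
  rw [h2] at h1; exact h1

/-- The moment weight of order `3 + β`. -/
def wp (β : ℝ) (v : Vd d) : ℝ := (1 + ‖v‖) ^ (3 + β)

lemma continuous_wp (β : ℝ) (hβ : 0 < β) : Continuous (wp β : Vd d → ℝ) := by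
  unfold wp
  exact Continuous.rpow_const (by fun_prop) fun v => Or.inr (by linarith)

lemma wp_nonneg (β : ℝ) (v : Vd d) : 0 ≤ wp β v := by unfold wp; positivity

lemma w3_le_wp {β : ℝ} (hβ : 0 < β) (v : Vd d) : w3 v ≤ wp β v := by
  unfold w3 wp
  rw [← Real.rpow_natCast]
  exact Real.rpow_le_rpow_of_exponent_le (by linarith [norm_nonneg v]) (by push_cast; linarith)

lemma psi_compl {R β : ℝ} (hR : 1 ≤ R) (hβ : 0 < β) (hβ1 : β ≤ 1) (v : Vd d) :
    1 - psi R v ≤ R ^ (-β) * (1 + ‖v‖) ^ β := by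
  have hn := norm_nonneg v
  have hR0 : 0 < R := by linarith
  have e : R ^ (-β) * (1 + ‖v‖) ^ β = ((1 + ‖v‖) / R) ^ β := by
    rw [Real.div_rpow (by positivity) hR0.le, Real.rpow_neg hR0.le]; ring
  rw [e]
  rcases le_total R (1 + ‖v‖) with h | h
  · have : 1 ≤ ((1 + ‖v‖) / R) ^ β := Real.one_le_rpow (by rwa [one_le_div hR0]) hβ.le
    linarith [psi_nonneg hR v]
  · have h1 : (1 + ‖v‖) / R ≤ ((1 + ‖v‖) / R) ^ β := by
      conv_lhs => rw [← Real.rpow_one ((1 + ‖v‖) / R)]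
      exact Real.rpow_le_rpow_of_exponent_ge (by positivity) (by rwa [div_le_one hR0]) hβ1
    have h2 : 1 - psi R v ≤ (1 + ‖v‖) / R := by
      have : 1 - psi R v = ‖v‖ / (R + ‖v‖) := by unfold psi; field_simp; ring
      rw [this]
      gcongr <;> linarith
    linarith

end KacAux

namespace KacAux

variable {d : ℕ}

lemma meas_reidx {J : Vd d → Vd d → ℝ} (h : Measurable (fun x : Vd d × Vd d => J x.1 x.2)) :
    Measurable fun y : (ℝ × Vd d) × Vd d => J y.1.2 y.2 :=
  h.comp (g := fun x : Vd d × Vd d => J x.1 x.2)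
    ((measurable_snd.comp measurable_fst).prodMk measurable_snd)

section pathwise
variable {B : Vd d → Measure (Vd d)} {κ : ℝ} {Bn : Kernel (Vd d) (Vd d)}

/-- Noise functional. -/
def nz (B : Vd d → Measure (Vd d)) (μ : ℝ → Measure (Vd d)) (f : Vd d → ℝ) (s t : ℝ) : ℝ :=
  (∫ v, f v ∂(μ t)) - (∫ v, f v ∂(μ s)) - ∫ r in Set.Ioc s t, QInt B f (μ r) (μ r)

/-- bound for `colJ` on the ball -/
lemma colJ_ball (hK : GoodKer B κ Bn) {Z : ℝ} {f : Vd d → ℝ} (hf : Cls Z f) {Rad : ℝ}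
    {v vs : Vd d} (hv : ‖v‖ ≤ Rad) (hvs : ‖vs‖ ≤ Rad) :
    |colJ Bn f v vs| ≤ 2 * Z * ((Rad + Rad) * ((1 + Rad ^ 2) + (1 + Rad ^ 2))) := by
  have hZ := hf.nonneg
  refine (colJ_bound hK hf v vs).trans ?_
  have h1 : ‖v - vs‖ ≤ Rad + Rad := (norm_sub_le _ _).trans (add_le_add hv hvs)
  have h2 : wt v ≤ 1 + Rad ^ 2 := by unfold wt; gcongr
  have h3 : wt vs ≤ 1 + Rad ^ 2 := by unfold wt; gcongr
  have h4 := wt_pos v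
  have h5 := wt_pos vs
  have h6 : 0 ≤ Rad := (norm_nonneg v).trans hv
  gcongr

variable {Rad : ℝ} {μ μ' : ℝ → Measure (Vd d)}

lemma inner_ball (hK : GoodKer B κ Bn) (hμ : GoodPath Rad μ) {Z : ℝ} {f : Vd d → ℝ} (hf : Cls Z f)
    (r : ℝ) {v : Vd d} (hv : ‖v‖ ≤ Rad) :
    |∫ vs, colJ Bn f v vs ∂(μ r)| ≤ 2 * Z * ((Rad + Rad) * ((1 + Rad ^ 2) + (1 + Rad ^ 2))) :=
  hμ.bound r _ fun _ hvs => colJ_ball hK hf hv hvs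

lemma inner_meas (hK : GoodKer B κ Bn) (hμ : GoodPath Rad μ) {f : Vd d → ℝ} (hf : Measurable f) :
    Measurable (fun x : ℝ × Vd d => ∫ vs, colJ Bn f x.2 vs ∂(μ x.1)) := by
  have hm := measurable_colJ hK hf
  have h2 := meas_reidx (J := colJ Bn f) hm
  have h3 := hμ.meas_int (E := ℝ × Vd d) measurable_fst (g := fun x vs => colJ Bn f x.2 vs) h2
  exact h3

lemma inner_meas' (hK : GoodKer B κ Bn) (hμ : GoodPath Rad μ) {f : Vd d → ℝ} (hf : Measurable f)
    (r : ℝ) : Measurable (fun v : Vd d => ∫ vs, colJ Bn f v vs ∂(μ r)) :=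
  (inner_meas hK hμ hf).comp (measurable_const.prodMk measurable_id : Measurable fun v : Vd d => (r, v))

lemma inner_int (hK : GoodKer B κ Bn) (hμ : GoodPath Rad μ) (hμ' : GoodPath Rad μ')
    {Z : ℝ} {f : Vd d → ℝ} (hf : Cls Z f) (r s : ℝ) :
    Integrable (fun v : Vd d => ∫ vs, colJ Bn f v vs ∂(μ r)) (μ' s) :=
  hμ'.integrable s (inner_meas' hK hμ hf.continuous.measurable r) _ fun _ hv => inner_ball hK hμ hf r hv

lemma cross_symm (hK : GoodKer B κ Bn) (hμ : GoodPath Rad μ) (hμ' : GoodPath Rad μ')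
    {Z : ℝ} {f : Vd d → ℝ} (hf : Cls Z f) (r : ℝ) :
    ∫ v, ∫ vs, colJ Bn f v vs ∂(μ r) ∂(μ' r) = ∫ v, ∫ vs, colJ Bn f v vs ∂(μ' r) ∂(μ r) := by
  have := hμ.prob r
  have := hμ'.prob r
  have hm := measurable_colJ hK hf.continuous.measurable
  rw [integral_integral_swap]
  · refine integral_congr_ae (Eventually.of_forall fun v => ?_)
    refine integral_congr_ae (Eventually.of_forall fun vs => ?_)
    exact colJ_symm hK hf.continuous.measurable _ _
  · refine Integrable.of_bound (C := 2 * Z * ((Rad + Rad) * ((1 + Rad ^ 2) + (1 + Rad ^ 2))))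
      hm.aestronglyMeasurable ?_
    have h1 : ∀ᵐ x ∂((μ' r).prod (μ r)), ‖x.1‖ ≤ Rad :=
      Measure.quasiMeasurePreserving_fst.ae (hμ'.bdd r)
    have h2 : ∀ᵐ x ∂((μ' r).prod (μ r)), ‖x.2‖ ≤ Rad :=
      Measure.quasiMeasurePreserving_snd.ae (hμ.bdd r)
    filter_upwards [h1, h2] with x hx1 hx2
    exact colJ_ball hK hf hx1 hx2

/-- linearized operator along two paths -/
def LL (Bn : Kernel (Vd d) (Vd d)) (μ μ' : ℝ → Measure (Vd d)) (f : Vd d → ℝ) (r : ℝ) (v : Vd d) : ℝ :=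
  (∫ vs, colJ Bn f v vs ∂(μ r)) + ∫ vs, colJ Bn f v vs ∂(μ' r)

lemma LL_meas (hK : GoodKer B κ Bn) (hμ : GoodPath Rad μ) (hμ' : GoodPath Rad μ')
    {f : Vd d → ℝ} (hf : Measurable f) : Measurable (fun x : ℝ × Vd d => LL Bn μ μ' f x.1 x.2) :=
  (inner_meas hK hμ hf).add (inner_meas hK hμ' hf)

lemma LL_ball (hK : GoodKer B κ Bn) (hμ : GoodPath Rad μ) (hμ' : GoodPath Rad μ')
    {Z : ℝ} {f : Vd d → ℝ} (hf : Cls Z f) (r : ℝ) {v : Vd d} (hv : ‖v‖ ≤ Rad) :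
    |LL Bn μ μ' f r v| ≤ 4 * Z * ((Rad + Rad) * ((1 + Rad ^ 2) + (1 + Rad ^ 2))) := by
  have h1 := inner_ball hK hμ hf r hv
  have h2 := inner_ball hK hμ' hf r hv
  unfold LL
  rw [abs_le] at *
  constructor <;> linarith

lemma LL_int (hK : GoodKer B κ Bn) (hμ : GoodPath Rad μ) (hμ' : GoodPath Rad μ')
    {Z : ℝ} {f : Vd d → ℝ} (hf : Cls Z f) (r : ℝ) {ρ : ℝ → Measure (Vd d)} (hρ : GoodPath Rad ρ)
    (s : ℝ) : Integrable (LL Bn μ μ' f r) (ρ s) :=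
  hρ.integrable s ((LL_meas hK hμ hμ' hf.continuous.measurable).comp
    (measurable_const.prodMk measurable_id : Measurable fun v : Vd d => (r, v))) _ fun _ hv => LL_ball hK hμ hμ' hf r hv

lemma QInt_diff (hK : GoodKer B κ Bn) (hμ : GoodPath Rad μ) (hμ' : GoodPath Rad μ')
    {Z : ℝ} {f : Vd d → ℝ} (hf : Cls Z f) (r : ℝ) :
    QInt B f (μ r) (μ r) - QInt B f (μ' r) (μ' r)
      = (∫ v, LL Bn μ μ' f r v ∂(μ r)) - ∫ v, LL Bn μ μ' f r v ∂(μ' r) := by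
  rw [QInt_eq hK, QInt_eq hK]
  unfold LL
  rw [integral_add (inner_int hK hμ hμ hf r r) (inner_int hK hμ' hμ hf r r),
    integral_add (inner_int hK hμ hμ' hf r r) (inner_int hK hμ' hμ' hf r r),
    cross_symm hK hμ hμ' hf r]
  ring

lemma w3_int (hμ : GoodPath Rad μ) (t : ℝ) : Integrable w3 (μ t) :=
  hμ.integrable_cont t continuous_w3

lemma inner_abs (hK : GoodKer B κ Bn) (hμ : GoodPath Rad μ) {Z : ℝ} {f : Vd d → ℝ} (hf : Cls Z f)
    (r : ℝ) (v : Vd d) :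
    |∫ vs, colJ Bn f v vs ∂(μ r)| ≤ 2 * Z * (2 * ((1 + ‖v‖) * wt v) + (1 + ‖v‖) * ∫ v, w3 v ∂(μ r)) := by
  have hZ := hf.nonneg
  have h0 := hμ.lin r
  have i1 : Integrable (fun v : Vd d => 1 + ‖v‖) (μ r) := hμ.integrable_cont r (by fun_prop)
  have hw := wt_pos v
  calc _ ≤ ∫ vs, |colJ Bn f v vs| ∂(μ r) := abs_integral_le_integral_abs
    _ ≤ ∫ vs, 2 * Z * ((1 + ‖v‖) * wt v * (1 + ‖vs‖) + (1 + ‖v‖) * w3 vs) ∂(μ r) := by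
      refine integral_mono (colJ_int hK hf (w3_int hμ r) v).abs
        (((i1.const_mul _).add ((w3_int hμ r).const_mul _)).const_mul _) fun vs => ?_
      refine (colJ_bound hK hf v vs).trans ?_
      refine mul_le_mul_of_nonneg_left ?_ (by positivity)
      have h1 := norm_sub_le_one v vs
      have h2 := lin_wt_le_w3 vs
      have h3 := wt_pos vs
      calc ‖v - vs‖ * (wt v + wt vs) ≤ ((1 + ‖v‖) * (1 + ‖vs‖)) * (wt v + wt vs) := by gcongr
        _ = (1 + ‖v‖) * wt v * (1 + ‖vs‖) + (1 + ‖v‖) * ((1 + ‖vs‖) * wt vs) := by ring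
        _ ≤ _ := by gcongr
    _ = 2 * Z * ((1 + ‖v‖) * wt v * (∫ v, (1 + ‖v‖) ∂(μ r)) + (1 + ‖v‖) * ∫ v, w3 v ∂(μ r)) := by
      rw [integral_const_mul, integral_add (i1.const_mul _) ((w3_int hμ r).const_mul _),
        integral_const_mul, integral_const_mul]
    _ ≤ 2 * Z * ((1 + ‖v‖) * wt v * 2 + (1 + ‖v‖) * ∫ v, w3 v ∂(μ r)) := by gcongr
    _ = _ := by ring

lemma QInt_bound (hK : GoodKer B κ Bn) (hμ : GoodPath Rad μ) {Z : ℝ} {f : Vd d → ℝ} (hf : Cls Z f)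
    (r : ℝ) : |QInt B f (μ r) (μ r)| ≤ Z * (8 * ∫ v, w3 v ∂(μ r)) := by
  have hZ := hf.nonneg
  rw [QInt_eq hK]
  have h0 := hμ.lin r
  have i1 : Integrable (fun v : Vd d => 1 + ‖v‖) (μ r) := hμ.integrable_cont r (by fun_prop)
  have i3 := w3_int hμ r
  have hS : 0 ≤ ∫ v, w3 v ∂(μ r) := integral_nonneg w3_nonneg
  calc _ ≤ ∫ v, |∫ vs, colJ Bn f v vs ∂(μ r)| ∂(μ r) := abs_integral_le_integral_abs
    _ ≤ ∫ v, 2 * Z * (2 * w3 v + (1 + ‖v‖) * ∫ v, w3 v ∂(μ r)) ∂(μ r) := by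
      refine integral_mono (inner_int hK hμ hμ hf r r).abs
        (((i3.const_mul _).add (i1.mul_const _)).const_mul _) fun v => ?_
      refine (inner_abs hK hμ hf r v).trans ?_
      have := lin_wt_le_w3 v
      gcongr
    _ = 2 * Z * (2 * (∫ v, w3 v ∂(μ r)) + (∫ v, (1 + ‖v‖) ∂(μ r)) * ∫ v, w3 v ∂(μ r)) := by
      rw [integral_const_mul, integral_add (i3.const_mul _) (i1.mul_const _),
        integral_const_mul, integral_mul_const]
    _ ≤ 2 * Z * (2 * (∫ v, w3 v ∂(μ r)) + 2 * ∫ v, w3 v ∂(μ r)) := by gcongr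
    _ = _ := by ring

lemma QInt_intOn (hK : GoodKer B κ Bn) (hμ : GoodPath Rad μ) {Z : ℝ} {f : Vd d → ℝ} (hf : Cls Z f)
    (s t : ℝ) : IntegrableOn (fun r => QInt B f (μ r) (μ r)) (Set.Ioc s t) := by
  simp only [QInt_eq hK]
  exact hμ.intOn (inner_meas hK hμ hf.continuous.measurable) _
    (fun r v hv => inner_ball hK hμ hf r hv) s t

/-- time increment bound for a class function -/
lemma incr_bound (hK : GoodKer B κ Bn) (hμ : GoodPath Rad μ) {Z η ω : ℝ} {f : Vd d → ℝ} (hf : Cls Z f)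
    {s t : ℝ} (hn : |nz B μ f s t| ≤ Z * η) (hω : ∫ r in Set.Ioc s t, ∫ v, w3 v ∂(μ r) ≤ ω) :
    |(∫ v, f v ∂(μ t)) - ∫ v, f v ∂(μ s)| ≤ Z * (η + 8 * ω) := by
  have hZ := hf.nonneg
  have h1 : |∫ r in Set.Ioc s t, QInt B f (μ r) (μ r)| ≤ Z * (8 * ω) := by
    calc _ ≤ ∫ r in Set.Ioc s t, |QInt B f (μ r) (μ r)| := abs_integral_le_integral_abs
      _ ≤ ∫ r in Set.Ioc s t, Z * (8 * ∫ v, w3 v ∂(μ r)) := by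
        refine integral_mono (QInt_intOn hK hμ hf s t).abs
          (((hμ.intOn_cont continuous_w3 s t).const_mul _).const_mul _) fun r => QInt_bound hK hμ hf r
      _ = Z * (8 * ∫ r in Set.Ioc s t, ∫ v, w3 v ∂(μ r)) := by
        rw [integral_const_mul, integral_const_mul]
      _ ≤ _ := by gcongr
  unfold nz at hn
  rw [abs_le] at *
  constructor <;> linarith

end pathwise
end KacAux

namespace KacAux

variable {d : ℕ}

section pathwise
variable {B : Vd d → Measure (Vd d)} {κ : ℝ} {Bn : Kernel (Vd d) (Vd d)}
variable {Rad : ℝ} {μ μ' : ℝ → Measure (Vd d)}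

/-- third moments -/
def S3 (μ : ℝ → Measure (Vd d)) (r : ℝ) : ℝ := ∫ v, w3 v ∂(μ r)
/-- `3+β` moments -/
def Sp (β : ℝ) (μ : ℝ → Measure (Vd d)) (r : ℝ) : ℝ := ∫ v, wp β v ∂(μ r)

lemma S3_nonneg (r : ℝ) : 0 ≤ S3 μ r := integral_nonneg w3_nonneg
lemma Sp_nonneg (β r : ℝ) : 0 ≤ Sp β μ r := integral_nonneg (wp_nonneg β)
lemma S3_le_Sp (hμ : GoodPath Rad μ) {β : ℝ} (hβ : 0 < β) (r : ℝ) : S3 μ r ≤ Sp β μ r :=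
  integral_mono (w3_int hμ r) (hμ.integrable_cont r (continuous_wp β hβ)) (w3_le_wp hβ)

lemma psi_meas {R : ℝ} (hR : 1 ≤ R) : Measurable (psi R : Vd d → ℝ) := (continuous_psi hR).measurable

lemma LL_meas' (hK : GoodKer B κ Bn) (hμ : GoodPath Rad μ) (hμ' : GoodPath Rad μ')
    {f : Vd d → ℝ} (hf : Measurable f) (r : ℝ) : Measurable (LL Bn μ μ' f r) :=
  (inner_meas' hK hμ hf r).add (inner_meas' hK hμ' hf r)

lemma psiLL_ball (hK : GoodKer B κ Bn) (hμ : GoodPath Rad μ) (hμ' : GoodPath Rad μ')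
    {Z R : ℝ} (hR : 1 ≤ R) {f : Vd d → ℝ} (hf : Cls Z f) (r : ℝ) {v : Vd d} (hv : ‖v‖ ≤ Rad) :
    |psi R v * LL Bn μ μ' f r v| ≤ 4 * Z * ((Rad + Rad) * ((1 + Rad ^ 2) + (1 + Rad ^ 2))) := by
  rw [abs_mul, abs_of_nonneg (psi_nonneg hR v)]
  refine (mul_le_of_le_one_left (abs_nonneg _) (psi_le_one hR v)).trans ?_
  exact LL_ball hK hμ hμ' hf r hv

lemma psiLL_int (hK : GoodKer B κ Bn) (hμ : GoodPath Rad μ) (hμ' : GoodPath Rad μ')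
    {Z R : ℝ} (hR : 1 ≤ R) {f : Vd d → ℝ} (hf : Cls Z f) (r : ℝ) {ρ : ℝ → Measure (Vd d)}
    (hρ : GoodPath Rad ρ) (s : ℝ) : Integrable (fun v => psi R v * LL Bn μ μ' f r v) (ρ s) :=
  hρ.integrable s ((psi_meas hR).mul (LL_meas' hK hμ hμ' hf.continuous.measurable r)) _
    fun _ hv => psiLL_ball hK hμ hμ' hR hf r hv

lemma tail_bound (hK : GoodKer B κ Bn) (hμ : GoodPath Rad μ) (hμ' : GoodPath Rad μ')
    {Z R β : ℝ} (hR : 1 ≤ R) (hβ : 0 < β) (hβ1 : β ≤ 1) {f : Vd d → ℝ} (hf : Cls Z f) (r : ℝ)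
    {ρ : ℝ → Measure (Vd d)} (hρ : GoodPath Rad ρ) :
    |(∫ v, LL Bn μ μ' f r v ∂(ρ r)) - ∫ v, psi R v * LL Bn μ μ' f r v ∂(ρ r)|
      ≤ 2 * Z * R ^ (-β) * (4 * Sp β ρ r + 4 * (S3 μ r + S3 μ' r)) := by
  have hZ := hf.nonneg
  have iL := LL_int hK hμ hμ' hf r hρ r
  have iP := psiLL_int hK hμ hμ' hR hf r hρ r
  have iw := hρ.integrable_cont r (continuous_wp (d := d) β hβ)
  have iq : Integrable (fun v : Vd d => (1 + ‖v‖) ^ 2) (ρ r) := hρ.integrable_cont r (by fun_prop)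
  have hq := hρ.quad r
  have hS := S3_nonneg (μ := μ) r
  have hS' := S3_nonneg (μ := μ') r
  have hR0 : 0 ≤ R := by linarith
  rw [← integral_sub iL iP]
  calc _ ≤ ∫ v, |LL Bn μ μ' f r v - psi R v * LL Bn μ μ' f r v| ∂(ρ r) :=
        abs_integral_le_integral_abs
    _ ≤ ∫ v, 2 * Z * R ^ (-β) * (4 * wp β v + (1 + ‖v‖) ^ 2 * (S3 μ r + S3 μ' r)) ∂(ρ r) := by
      refine integral_mono (iL.sub iP).abs (((iw.const_mul _).add (iq.mul_const _)).const_mul _)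
        fun v => ?_
      have e : LL Bn μ μ' f r v - psi R v * LL Bn μ μ' f r v
        = (1 - psi R v) * LL Bn μ μ' f r v := by ring
      have p1 := psi_le_one hR v
      have p2 := psi_compl hR hβ hβ1 v
      have w1 := wt_pos v
      have h1 := inner_abs hK hμ hf r v
      have h2 := inner_abs hK hμ' hf r v
      have h3 : |LL Bn μ μ' f r v| ≤ 2 * Z * (4 * ((1 + ‖v‖) * wt v) + (1 + ‖v‖) * (S3 μ r + S3 μ' r)) := by
        unfold LL S3
        refine (abs_add_le _ _).trans ((add_le_add h1 h2).trans (le_of_eq ?_))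
        ring
      have g1 : (1 + ‖v‖) ^ β * (1 + ‖v‖) ≤ (1 + ‖v‖) ^ 2 := by
        have hn := norm_nonneg v
        have : (1 + ‖v‖) ^ β ≤ 1 + ‖v‖ := by
          conv_rhs => rw [← Real.rpow_one (1 + ‖v‖)]
          exact Real.rpow_le_rpow_of_exponent_le (by linarith) hβ1
        calc _ ≤ (1 + ‖v‖) * (1 + ‖v‖) := by gcongr
          _ = _ := by ring
      have g2 : (1 + ‖v‖) ^ β * ((1 + ‖v‖) * wt v) ≤ wp β v := by
        have hn := norm_nonneg v
        have : wp β v = (1 + ‖v‖) ^ β * w3 v := by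
          unfold wp w3
          rw [Real.rpow_add (by linarith), mul_comm]
          norm_num
        rw [this]
        have := lin_wt_le_w3 v
        gcongr
      simp only
      rw [e, abs_mul, abs_of_nonneg (by linarith)]
      calc _ ≤ (R ^ (-β) * (1 + ‖v‖) ^ β) *
            (2 * Z * (4 * ((1 + ‖v‖) * wt v) + (1 + ‖v‖) * (S3 μ r + S3 μ' r))) := by gcongr
        _ = 2 * Z * R ^ (-β) * (4 * ((1 + ‖v‖) ^ β * ((1 + ‖v‖) * wt v))
            + ((1 + ‖v‖) ^ β * (1 + ‖v‖)) * (S3 μ r + S3 μ' r)) := by ring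
        _ ≤ _ := by gcongr
    _ = 2 * Z * R ^ (-β) * (4 * Sp β ρ r + (∫ v, (1 + ‖v‖) ^ 2 ∂(ρ r)) * (S3 μ r + S3 μ' r)) := by
      rw [integral_const_mul, integral_add (iw.const_mul _) (iq.mul_const _),
        integral_const_mul, integral_mul_const]
      rfl
    _ ≤ _ := by gcongr

lemma psiLL_cls (hK : GoodKer B κ Bn) (hμ : GoodPath Rad μ) (hμ' : GoodPath Rad μ')
    {Z R : ℝ} (hR : 1 ≤ R) {f : Vd d → ℝ} (hf : Cls Z f) (r : ℝ) :
    Cls (Z * (8 * R + (9 + 3 * κ) * (S3 μ r + S3 μ' r))) (fun v => psi R v * LL Bn μ μ' f r v) := by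
  have i1 := w3_int hμ r
  have i2 := w3_int hμ' r
  have l1 : Integrable (fun v : Vd d => 1 + ‖v‖) (μ r) := hμ.integrable_cont r (by fun_prop)
  have l2 : Integrable (fun v : Vd d => 1 + ‖v‖) (μ' r) := hμ'.integrable_cont r (by fun_prop)
  have h := psiL_cls hK hf hR (π := μ r + μ' r) (i1.add_measure i2) (by
    rw [integral_add_measure l1 l2]
    linarith [hμ.lin r, hμ'.lin r])
  rw [integral_add_measure i1 i2] at h
  have e : (fun v => psi R v * ∫ vs, colJ Bn f v vs ∂(μ r + μ' r))
      = fun v => psi R v * LL Bn μ μ' f r v := by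
    ext v
    rw [integral_add_measure (colJ_int hK hf i1 v) (colJ_int hK hf i2 v)]
    rfl
  rw [e] at h
  exact h

/-- pairing with the difference of the two paths -/
def pr (μ μ' : ℝ → Measure (Vd d)) (f : Vd d → ℝ) (t : ℝ) : ℝ :=
  (∫ v, f v ∂(μ t)) - ∫ v, f v ∂(μ' t)

lemma swap_int (hK : GoodKer B κ Bn) (hμ : GoodPath Rad μ) (hμ' : GoodPath Rad μ')
    {Z R : ℝ} (hR : 1 ≤ R) {f : Vd d → ℝ} (hf : Cls Z f) (s t : ℝ) {ρ : ℝ → Measure (Vd d)}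
    (hρ : GoodPath Rad ρ) :
    ∫ v, psi R v * (∫ r in Set.Ioc s t, LL Bn μ μ' f r v) ∂(ρ s)
      = ∫ r in Set.Ioc s t, ∫ v, psi R v * LL Bn μ μ' f r v ∂(ρ s) := by
  have := hρ.prob s
  have : IsFiniteMeasure (volume.restrict (Set.Ioc s t)) := ⟨by simp⟩
  simp only [← integral_const_mul]
  rw [integral_integral_swap]
  have hm := LL_meas hK hμ hμ' hf.continuous.measurable
  have hm2 : Measurable (fun x : Vd d × ℝ => LL Bn μ μ' f x.2 x.1) := by
    have := hm.comp (measurable_swap (α := Vd d) (β := ℝ))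
    exact this
  have hp := psi_meas (d := d) hR
  refine Integrable.of_bound (C := 4 * Z * ((Rad + Rad) * ((1 + Rad ^ 2) + (1 + Rad ^ 2))))
      ((hp.comp measurable_fst).mul hm2).aestronglyMeasurable ?_
  have h1 : ∀ᵐ x ∂((ρ s).prod (volume.restrict (Set.Ioc s t))), ‖x.1‖ ≤ Rad :=
      Measure.quasiMeasurePreserving_fst.ae (hρ.bdd s)
  filter_upwards [h1] with x hx
  exact psiLL_ball hK hμ hμ' hR hf x.2 hx

lemma avg_colJ (hK : GoodKer B κ Bn) (hμ : GoodPath Rad μ) {Z : ℝ} {f : Vd d → ℝ} (hf : Cls Z f)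
    (s t : ℝ) (v : Vd d) :
    ∫ vs, colJ Bn f v vs ∂(avg μ s t) = ∫ r in Set.Ioc s t, ∫ vs, colJ Bn f v vs ∂(μ r) := by
  have hm := measurable_colJ hK hf.continuous.measurable
  have hm' : Measurable (fun vs => colJ Bn f v vs) := by fun_prop
  refine hμ.avg_integral s t hm' _ fun vs hvs =>
    colJ_ball hK hf (Rad := max ‖v‖ Rad) (le_max_left _ _) (hvs.trans (le_max_right _ _))

lemma inner_intOn (hK : GoodKer B κ Bn) (hμ : GoodPath Rad μ) {Z : ℝ} {f : Vd d → ℝ} (hf : Cls Z f)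
    (s t : ℝ) (v : Vd d) : IntegrableOn (fun r => ∫ vs, colJ Bn f v vs ∂(μ r)) (Set.Ioc s t) := by
  have hm := measurable_colJ hK hf.continuous.measurable
  have hm' : Measurable (fun vs => colJ Bn f v vs) := by fun_prop
  refine hμ.intOn (g := fun _ vs => colJ Bn f v vs) (hm'.comp measurable_snd) _ (fun r vs hvs =>
    colJ_ball hK hf (Rad := max ‖v‖ Rad) (le_max_left _ _) (hvs.trans (le_max_right _ _))) s t

lemma step (hK : GoodKer B κ Bn) (hμ : GoodPath Rad μ) (hμ' : GoodPath Rad μ')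
    {β R η ω h T : ℝ} (hβ : 0 < β) (hβ1 : β ≤ 1) (hR : 1 ≤ R) (hRh : 4 * h * R ≤ 1)
    (hnz : ∀ Z f, Cls Z f → ∀ s t, 0 ≤ s → s ≤ t → t ≤ T → |nz B μ f s t| ≤ Z * η)
    (hnz' : ∀ Z f, Cls Z f → ∀ s t, 0 ≤ s → s ≤ t → t ≤ T → |nz B μ' f s t| ≤ Z * η)
    (hω : ∀ s t, 0 ≤ s → s ≤ t → t ≤ T → t - s ≤ h → ∫ r in Set.Ioc s t, S3 μ r ≤ ω)
    (hω' : ∀ s t, 0 ≤ s → s ≤ t → t ≤ T → t - s ≤ h → ∫ r in Set.Ioc s t, S3 μ' r ≤ ω)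
    {Z : ℝ} {f : Vd d → ℝ} (hf : Cls Z f) {s t : ℝ} (hs : 0 ≤ s) (hst : s ≤ t) (htT : t ≤ T)
    (hh : t - s ≤ h) (Q : ℝ) (hQ : Q = ∫ r in Set.Ioc s t, (Sp β μ r + Sp β μ' r)) :
    ∃ F, Cls (Z * (1 + (9 + 3 * κ) * Q)) F ∧
      |pr μ μ' f t - pr μ μ' F s| ≤ Z * (2 * η + 24 * R ^ (-β) * Q
        + 2 * (η + 8 * ω) * (8 * R * (t - s) + (9 + 3 * κ) * Q)) := by
  have hZ := hf.nonneg
  have hκ := hK.one_le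
  have hR0 : 0 < R := by linarith
  have iS : IntegrableOn (S3 μ) (Set.Ioc s t) := hμ.intOn_cont continuous_w3 s t
  have iS' : IntegrableOn (S3 μ') (Set.Ioc s t) := hμ'.intOn_cont continuous_w3 s t
  have iq : IntegrableOn (Sp β μ) (Set.Ioc s t) := hμ.intOn_cont (continuous_wp β hβ) s t
  have iq' : IntegrableOn (Sp β μ') (Set.Ioc s t) := hμ'.intOn_cont (continuous_wp β hβ) s t
  have icont : ∀ g : Vd d → ℝ, Continuous g → Integrable g (avg μ s t) ∧
      ∫ v, g v ∂(avg μ s t) = ∫ r in Set.Ioc s t, ∫ v, g v ∂(μ r) := by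
    intro g hg
    obtain ⟨c, hc⟩ := (isCompact_closedBall (0 : Vd d) Rad).exists_bound_of_continuousOn
      hg.continuousOn
    exact ⟨hμ.avg_integrable s t hg.measurable c fun v hv => hc v (by simpa using hv),
      hμ.avg_integral s t hg.measurable c fun v hv => hc v (by simpa using hv)⟩
  have icont' : ∀ g : Vd d → ℝ, Continuous g → Integrable g (avg μ' s t) ∧
      ∫ v, g v ∂(avg μ' s t) = ∫ r in Set.Ioc s t, ∫ v, g v ∂(μ' r) := by
    intro g hg
    obtain ⟨c, hc⟩ := (isCompact_closedBall (0 : Vd d) Rad).exists_bound_of_continuousOn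
      hg.continuousOn
    exact ⟨hμ'.avg_integrable s t hg.measurable c fun v hv => hc v (by simpa using hv),
      hμ'.avg_integral s t hg.measurable c fun v hv => hc v (by simpa using hv)⟩
  have a3 := icont _ continuous_w3
  have a3' := icont' _ continuous_w3
  have al := icont (fun v => 1 + ‖v‖) (by fun_prop)
  have al' := icont' (fun v => 1 + ‖v‖) (by fun_prop)
  have linb : ∀ (ρ : ℝ → Measure (Vd d)), GoodPath Rad ρ →
      ∫ r in Set.Ioc s t, ∫ v, (1 + ‖v‖) ∂(ρ r) ≤ 2 * (t - s) := by
    intro ρ hρ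
    calc _ ≤ ∫ r in Set.Ioc s t, (2:ℝ) := by
          refine integral_mono (hρ.intOn_cont (by fun_prop) s t) (by simp) fun r => hρ.lin r
      _ = _ := by simp [hst]; ring
  have i3 : Integrable w3 (avg μ s t + avg μ' s t) := a3.1.add_measure a3'.1
  set F : Vd d → ℝ := fun v => f v + psi R v * ∫ vs, colJ Bn f v vs ∂(avg μ s t + avg μ' s t) with hF
  have hFc := one_step hK hf hR i3 (by
    rw [integral_add_measure al.1 al'.1, al.2, al'.2]
    have h1 := linb μ hμ
    have h2 := linb μ' hμ'
    calc _ ≤ R * (2 * h + 2 * h) := by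
          refine mul_le_mul_of_nonneg_left ?_ hR0.le; linarith
      _ = 4 * h * R := by ring
      _ ≤ 1 := hRh)
  have hS3Q : ∫ v, w3 v ∂(avg μ s t + avg μ' s t) ≤ Q := by
    rw [integral_add_measure a3.1 a3'.1, a3.2, a3'.2, hQ]
    rw [← integral_add (hμ.intOn_cont continuous_w3 s t) (hμ'.intOn_cont continuous_w3 s t)]
    exact integral_mono (iS.add iS') (iq.add iq')
      fun r => add_le_add (S3_le_Sp hμ hβ r) (S3_le_Sp hμ' hβ r)
  have hFL : ∀ v, F v = f v + psi R v * ∫ r in Set.Ioc s t, LL Bn μ μ' f r v := by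
    intro v
    simp only [hF]
    rw [integral_add_measure, avg_colJ hK hμ hf, avg_colJ hK hμ' hf]
    · unfold LL
      rw [integral_add (inner_intOn hK hμ hf s t v) (inner_intOn hK hμ' hf s t v)]
    · exact colJ_int hK hf a3.1 v
    · exact colJ_int hK hf a3'.1 v
  have iLLv : ∀ v, ∫ r in Set.Ioc s t, LL Bn μ μ' f r v
      = ∫ vs, colJ Bn f v vs ∂(avg μ s t + avg μ' s t) := by
    intro v
    rw [integral_add_measure (colJ_int hK hf a3.1 v) (colJ_int hK hf a3'.1 v),
      avg_colJ hK hμ hf, avg_colJ hK hμ' hf]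
    unfold LL
    rw [integral_add (inner_intOn hK hμ hf s t v) (inner_intOn hK hμ' hf s t v)]
  have hFint : ∀ (ρ : ℝ → Measure (Vd d)), GoodPath Rad ρ → ∫ v, F v ∂(ρ s) = (∫ v, f v ∂(ρ s))
      + ∫ r in Set.Ioc s t, ∫ v, psi R v * LL Bn μ μ' f r v ∂(ρ s) := by
    intro ρ hρ
    rw [← swap_int hK hμ hμ' hR hf s t hρ]
    have e1 : Integrable f (ρ s) := hρ.integrable_cont s hf.continuous
    have e2 : Integrable (fun v => psi R v * ∫ r in Set.Ioc s t, LL Bn μ μ' f r v) (ρ s) := by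
      have : (fun v => psi R v * ∫ r in Set.Ioc s t, LL Bn μ μ' f r v) = fun v => F v - f v := by
        ext v; rw [hFL]; ring
      rw [this]
      exact (hρ.integrable_cont s hFc.continuous).sub e1
    rw [← integral_add e1 e2]
    simp only [hFL]
  refine ⟨F, hFc.mono (by gcongr), ?_⟩
  have iA : ∀ (ρ : ℝ → Measure (Vd d)), GoodPath Rad ρ →
      IntegrableOn (fun r => ∫ v, LL Bn μ μ' f r v ∂(ρ r)) (Set.Ioc s t) := fun ρ hρ =>
    hρ.intOn (LL_meas hK hμ hμ' hf.continuous.measurable) _ (fun r v hv => LL_ball hK hμ hμ' hf r hv) s t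
  have iB : ∀ (ρ : ℝ → Measure (Vd d)), GoodPath Rad ρ →
      IntegrableOn (fun r => ∫ v, psi R v * LL Bn μ μ' f r v ∂(ρ s)) (Set.Ioc s t) := by
    intro ρ hρ
    have : IsFiniteMeasure (volume.restrict (Set.Ioc s t)) := ⟨by simp⟩
    refine Integrable.of_bound (C := 4 * Z * ((Rad + Rad) * ((1 + Rad ^ 2) + (1 + Rad ^ 2)))) ?_
      (Eventually.of_forall fun r => hρ.bound s _ fun v hv => psiLL_ball hK hμ hμ' hR hf r hv)
    refine (hρ.meas_int (τ := fun _ : ℝ => s) measurable_const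
      (g := fun r v => psi R v * LL Bn μ μ' f r v) ?_).aestronglyMeasurable
    exact ((psi_meas hR).comp measurable_snd).mul (LL_meas hK hμ hμ' hf.continuous.measurable)
  set E : ℝ → ℝ := fun r => ((∫ v, LL Bn μ μ' f r v ∂(μ r)) - ∫ v, LL Bn μ μ' f r v ∂(μ' r))
    - ((∫ v, psi R v * LL Bn μ μ' f r v ∂(μ s)) - ∫ v, psi R v * LL Bn μ μ' f r v ∂(μ' s)) with hE
  have iE : IntegrableOn E (Set.Ioc s t) :=
    ((iA μ hμ).sub (iA μ' hμ')).sub ((iB μ hμ).sub (iB μ' hμ'))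
  have hid : pr μ μ' f t - pr μ μ' F s = nz B μ f s t - nz B μ' f s t + ∫ r in Set.Ioc s t, E r := by
    unfold pr
    rw [hFint μ hμ, hFint μ' hμ']
    have e1 : ∫ r in Set.Ioc s t, E r =
        ((∫ r in Set.Ioc s t, QInt B f (μ r) (μ r)) - ∫ r in Set.Ioc s t, QInt B f (μ' r) (μ' r))
        - ((∫ r in Set.Ioc s t, ∫ v, psi R v * LL Bn μ μ' f r v ∂(μ s))
          - ∫ r in Set.Ioc s t, ∫ v, psi R v * LL Bn μ μ' f r v ∂(μ' s)) := by
      rw [← integral_sub (QInt_intOn hK hμ hf s t) (QInt_intOn hK hμ' hf s t)]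
      simp only [QInt_diff hK hμ hμ' hf]
      rw [← integral_sub (iB μ hμ) (iB μ' hμ'), ← integral_sub]
      · exact (iA μ hμ).sub (iA μ' hμ')
      · exact (iB μ hμ).sub (iB μ' hμ')
    rw [e1]
    unfold nz
    ring
  have hD : ∀ r ∈ Set.Ioc s t, |E r| ≤ Z * (24 * R ^ (-β) * (Sp β μ r + Sp β μ' r)
      + 2 * (η + 8 * ω) * (8 * R + (9 + 3 * κ) * (Sp β μ r + Sp β μ' r))) := by
    intro r hr
    have c := psiLL_cls hK hμ hμ' hR hf r
    have n0 : 0 ≤ η + 8 * ω := by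
      have e1 : (0:ℝ) ≤ η := by
        have h1 : Cls 1 (fun _ : Vd d => (0:ℝ)) :=
          ⟨fun v => by simpa using (zero_le_one.trans (wt_pos v)), fun v v' => by
            have := wt_pos v; have := wt_pos v'; simp; positivity⟩
        have := hnz 1 _ h1 s t hs hst htT
        have := abs_nonneg (nz B μ (fun _ : Vd d => (0:ℝ)) s t)
        linarith
      have e2 : 0 ≤ ω := (integral_nonneg fun r => S3_nonneg r).trans (hω s t hs hst htT hh)
      linarith
    have b1 := incr_bound hK hμ c (hnz _ _ c s r hs hr.1.le (hr.2.trans htT))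
      (hω s r hs hr.1.le (hr.2.trans htT) (by linarith [hr.2]))
    have b2 := incr_bound hK hμ' c (hnz' _ _ c s r hs hr.1.le (hr.2.trans htT))
      (hω' s r hs hr.1.le (hr.2.trans htT) (by linarith [hr.2]))
    have b3 := tail_bound hK hμ hμ' hR hβ hβ1 hf r hμ
    have b4 := tail_bound hK hμ hμ' hR hβ hβ1 hf r hμ'
    have s1 := S3_le_Sp hμ hβ r
    have s2 := S3_le_Sp hμ' hβ r
    have hRb : 0 ≤ R ^ (-β) := by positivity
    have tot : |E r| ≤ 2 * Z * R ^ (-β) * (4 * Sp β μ r + 4 * (S3 μ r + S3 μ' r))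
        + 2 * Z * R ^ (-β) * (4 * Sp β μ' r + 4 * (S3 μ r + S3 μ' r))
        + Z * (8 * R + (9 + 3 * κ) * (S3 μ r + S3 μ' r)) * (η + 8 * ω)
        + Z * (8 * R + (9 + 3 * κ) * (S3 μ r + S3 μ' r)) * (η + 8 * ω) := by
      simp only [hE]
      rw [abs_le] at b1 b2 b3 b4 ⊢
      constructor <;> linarith
    refine tot.trans ?_
    have g1 : 2 * Z * R ^ (-β) * (4 * Sp β μ r + 4 * (S3 μ r + S3 μ' r))
        + 2 * Z * R ^ (-β) * (4 * Sp β μ' r + 4 * (S3 μ r + S3 μ' r))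
        ≤ Z * (24 * R ^ (-β) * (Sp β μ r + Sp β μ' r)) := by
      have : 0 ≤ Z * R ^ (-β) * (Sp β μ r - S3 μ r + (Sp β μ' r - S3 μ' r)) :=
        mul_nonneg (mul_nonneg hZ hRb) (by linarith)
      linarith
    have g2 : Z * (8 * R + (9 + 3 * κ) * (S3 μ r + S3 μ' r)) * (η + 8 * ω)
        ≤ Z * (8 * R + (9 + 3 * κ) * (Sp β μ r + Sp β μ' r)) * (η + 8 * ω) := by gcongr
    linarith
  have hEint : |∫ r in Set.Ioc s t, E r| ≤ Z * (24 * R ^ (-β) * Q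
      + 2 * (η + 8 * ω) * (8 * R * (t - s) + (9 + 3 * κ) * Q)) := by
    have iqq : IntegrableOn (fun r => Sp β μ r + Sp β μ' r) (Set.Ioc s t) := iq.add iq'
    have : IsFiniteMeasure (volume.restrict (Set.Ioc s t)) := ⟨by simp⟩
    have ic : IntegrableOn (fun _ : ℝ => 8 * R) (Set.Ioc s t) := integrable_const _
    have j1 : IntegrableOn (fun r => 24 * R ^ (-β) * (Sp β μ r + Sp β μ' r)) (Set.Ioc s t) :=
      iqq.const_mul _
    have j2 : IntegrableOn (fun r => 8 * R + (9 + 3 * κ) * (Sp β μ r + Sp β μ' r)) (Set.Ioc s t) :=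
      ic.add (iqq.const_mul _)
    have hc : ∫ _ in Set.Ioc s t, 8 * R = 8 * R * (t - s) := by
      rw [setIntegral_const, Real.volume_real_Ioc_of_le hst, smul_eq_mul, mul_comm]
    have hj1 : ∫ r in Set.Ioc s t, 24 * R ^ (-β) * (Sp β μ r + Sp β μ' r) = 24 * R ^ (-β) * Q := by
      rw [integral_const_mul, ← hQ]
    have hj2 : ∫ r in Set.Ioc s t, (8 * R + (9 + 3 * κ) * (Sp β μ r + Sp β μ' r))
        = 8 * R * (t - s) + (9 + 3 * κ) * Q := by
      rw [integral_add ic (iqq.const_mul _), hc, integral_const_mul, ← hQ]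
    calc _ ≤ ∫ r in Set.Ioc s t, |E r| := abs_integral_le_integral_abs
      _ ≤ ∫ r in Set.Ioc s t, Z * (24 * R ^ (-β) * (Sp β μ r + Sp β μ' r)
          + 2 * (η + 8 * ω) * (8 * R + (9 + 3 * κ) * (Sp β μ r + Sp β μ' r))) :=
        setIntegral_mono_on iE.abs ((j1.add (j2.const_mul _)).const_mul _) measurableSet_Ioc hD
      _ = _ := by
        rw [integral_const_mul, integral_add j1 (j2.const_mul _), hj1, integral_const_mul, hj2]
  have n1 := hnz _ _ hf s t hs hst htT
  have n2 := hnz' _ _ hf s t hs hst htT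
  rw [hid]
  rw [abs_le] at n1 n2 hEint ⊢
  constructor <;> linarith

end pathwise
end KacAux

namespace KacAux
variable {d : ℕ}

section grid
variable {B : Vd d → Measure (Vd d)} {κ : ℝ} {Bn : Kernel (Vd d) (Vd d)}
variable {Rad : ℝ} {μ μ' : ℝ → Measure (Vd d)}

lemma Sp_intOn (hμ : GoodPath Rad μ) {β : ℝ} (hβ : 0 < β) (s t : ℝ) :
    IntegrableOn (Sp β μ) (Set.Ioc s t) := by
  exact hμ.intOn_cont (continuous_wp β (by linarith)) s t

lemma grid_arith {q Q C0 x y e : ℝ} (hC : 0 ≤ C0) (hq : 0 ≤ q) (hQ : 0 ≤ Q) (hx : 0 ≤ x)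
    (hy : 0 ≤ y) (he : e ≤ y) :
    (1 + C0 * Q) * (Real.exp (C0 * q) * x) + e ≤ Real.exp (C0 * (q + Q)) * (x + y) := by
  have h1 : 1 + C0 * Q ≤ Real.exp (C0 * Q) := by linarith [Real.add_one_le_exp (C0 * Q)]
  have h2 : Real.exp (C0 * (q + Q)) = Real.exp (C0 * Q) * Real.exp (C0 * q) := by
    rw [← Real.exp_add]; ring_nf
  have h3 : 1 ≤ Real.exp (C0 * (q + Q)) := Real.one_le_exp (by positivity)
  have h4 : (1 + C0 * Q) * (Real.exp (C0 * q) * x) ≤ Real.exp (C0 * (q + Q)) * x := by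
    rw [h2, mul_assoc]
    gcongr
  nlinarith

lemma grid (hK : GoodKer B κ Bn) (hμ : GoodPath Rad μ) (hμ' : GoodPath Rad μ')
    {β R η ω h T D0 : ℝ} (hβ : 0 < β) (hβ1 : β ≤ 1) (hR : 1 ≤ R) (hRh : 4 * h * R ≤ 1)
    (hη : 0 ≤ η) (hω0 : 0 ≤ ω) (hD : 0 ≤ D0)
    (hnz : ∀ Z f, Cls Z f → ∀ s t, 0 ≤ s → s ≤ t → t ≤ T → |nz B μ f s t| ≤ Z * η)
    (hnz' : ∀ Z f, Cls Z f → ∀ s t, 0 ≤ s → s ≤ t → t ≤ T → |nz B μ' f s t| ≤ Z * η)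
    (hω : ∀ s t, 0 ≤ s → s ≤ t → t ≤ T → t - s ≤ h → ∫ r in Set.Ioc s t, S3 μ r ≤ ω)
    (hω' : ∀ s t, 0 ≤ s → s ≤ t → t ≤ T → t - s ≤ h → ∫ r in Set.Ioc s t, S3 μ' r ≤ ω)
    (h0 : ∀ Z f, Cls Z f → |pr μ μ' f 0| ≤ Z * D0) {δ : ℝ} (hδ : 0 ≤ δ) (hδh : δ ≤ h) (k : ℕ) :
    k * δ ≤ T → ∀ Z f, Cls Z f → |pr μ μ' f (k * δ)| ≤
      Z * (Real.exp ((9 + 3 * κ) * ∫ r in Set.Ioc 0 (k * δ), (Sp β μ r + Sp β μ' r)) *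
        (D0 + (2 * k * η + 24 * R ^ (-β) * (∫ r in Set.Ioc 0 (k * δ), (Sp β μ r + Sp β μ' r))
        + 2 * (η + 8 * ω) * (8 * R * (k * δ)
          + (9 + 3 * κ) * ∫ r in Set.Ioc 0 (k * δ), (Sp β μ r + Sp β μ' r))))) := by
  have hκ := hK.one_le
  induction k with
  | zero =>
    intro _ Z f hf
    simpa using h0 Z f hf
  | succ k ih =>
    intro hkT Z f hf
    have hZ := hf.nonneg
    have hk1 : (k:ℝ) * δ ≤ (k + 1 : ℕ) * δ := by push_cast; linarith
    have hk0 : 0 ≤ (k:ℝ) * δ := by positivity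
    obtain ⟨F, hF, hFe⟩ := step hK hμ hμ' hβ hβ1 hR hRh hnz hnz' hω hω' hf hk0 hk1 hkT
      (by push_cast; linarith) _ rfl
    have hi := ih (hk1.trans hkT) _ F hF
    have hqq : (∫ r in Set.Ioc 0 ((k + 1 : ℕ) * δ), (Sp β μ r + Sp β μ' r))
        = (∫ r in Set.Ioc 0 ((k:ℝ) * δ), (Sp β μ r + Sp β μ' r))
          + ∫ r in Set.Ioc ((k:ℝ) * δ) ((k + 1 : ℕ) * δ), (Sp β μ r + Sp β μ' r) := by
      rw [← Set.Ioc_union_Ioc_eq_Ioc hk0 hk1]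
      exact setIntegral_union (Set.Ioc_disjoint_Ioc_of_le le_rfl) measurableSet_Ioc
        ((Sp_intOn hμ hβ _ _).add (Sp_intOn hμ' hβ _ _)) ((Sp_intOn hμ hβ _ _).add (Sp_intOn hμ' hβ _ _))
    rw [hqq]
    have hnn : ∀ s t : ℝ, 0 ≤ ∫ r in Set.Ioc s t, (Sp β μ r + Sp β μ' r) := fun s t =>
      integral_nonneg fun r => add_nonneg (Sp_nonneg β r) (Sp_nonneg β r)
    have hQ := hnn (k * δ) ((k + 1 : ℕ) * δ)
    have hq := hnn 0 (k * δ)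
    generalize (∫ r in Set.Ioc 0 ((k:ℝ) * δ), (Sp β μ r + Sp β μ' r)) = q at *
    generalize (∫ r in Set.Ioc ((k:ℝ) * δ) ((k + 1 : ℕ) * δ), (Sp β μ r + Sp β μ' r)) = Q at *
    have hRb : 0 ≤ R ^ (-β) := by positivity
    have key := grid_arith (q := q) (Q := Q) (C0 := 9 + 3 * κ)
      (x := D0 + (2 * k * η + 24 * R ^ (-β) * q + 2 * (η + 8 * ω) * (8 * R * (k * δ) + (9 + 3 * κ) * q)))
      (y := 2 * η + 24 * R ^ (-β) * Q + 2 * (η + 8 * ω) * (8 * R * δ + (9 + 3 * κ) * Q))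
      (e := 2 * η + 24 * R ^ (-β) * Q + 2 * (η + 8 * ω) * (8 * R * δ + (9 + 3 * κ) * Q))
      (by positivity) hq hQ (by positivity) (by positivity) le_rfl
    have h1 : |pr μ μ' f ((k + 1 : ℕ) * δ)| ≤ |pr μ μ' F (k * δ)| +
        Z * (2 * η + 24 * R ^ (-β) * Q + 2 * (η + 8 * ω) * (8 * R * δ + (9 + 3 * κ) * Q)) := by
      have e : ((k + 1 : ℕ) * δ - k * δ : ℝ) = δ := by push_cast; ring
      rw [e] at hFe
      have := abs_sub_abs_le_abs_sub (pr μ μ' f ((k + 1 : ℕ) * δ)) (pr μ μ' F (k * δ))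
      linarith
    have h2 := mul_le_mul_of_nonneg_left key hZ
    push_cast at h1 ⊢
    refine h1.trans ((add_le_add_left hi _).trans (le_trans (le_of_eq ?_) (h2.trans (le_of_eq ?_)))) <;> ring

lemma S3_omega (hμ : GoodPath Rad μ) {β K T Λ : ℝ} (hβ : 0 < β) (hΛ : 1 ≤ Λ)
    (hKi : ∫ r in Set.Ioc 0 T, Sp β μ r ≤ K) {s t : ℝ} (hs : 0 ≤ s) (hst : s ≤ t) (ht : t ≤ T) :
    ∫ r in Set.Ioc s t, S3 μ r ≤ 4 * Λ * (t - s) + Λ ^ (-β) * K := by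
  have hΛ0 : 0 < Λ := by linarith
  have hpt : ∀ v : Vd d, w3 v ≤ Λ * (1 + ‖v‖) ^ 2 + Λ ^ (-β) * wp β v := by
    intro v
    have hx : 0 < 1 + ‖v‖ := by positivity
    have hw : wp β v = w3 v * (1 + ‖v‖) ^ β := by
      unfold wp w3
      rw [Real.rpow_add hx]; norm_cast
    have hwn := w3_nonneg v
    rcases le_total (1 + ‖v‖) Λ with hle | hle
    · have h1 : w3 v ≤ Λ * (1 + ‖v‖) ^ 2 := by
        unfold w3; rw [pow_succ' _ 2]; gcongr
      have : 0 ≤ Λ ^ (-β) * wp β v := mul_nonneg (by positivity) (wp_nonneg _ _)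
      linarith
    · have h1 : 1 ≤ Λ ^ (-β) * (1 + ‖v‖) ^ β := by
        rw [Real.rpow_neg hΛ0.le, ← div_eq_inv_mul, one_le_div (by positivity)]
        gcongr
      have : 0 ≤ Λ * (1 + ‖v‖) ^ 2 := by positivity
      rw [hw]
      nlinarith
  have iq := hμ.intOn_cont (g := fun v => (1 + ‖v‖) ^ 2) (by fun_prop) s t
  have hr : ∀ r, S3 μ r ≤ Λ * 4 + Λ ^ (-β) * Sp β μ r := by
    intro r
    have i1 : Integrable (fun v => (1 + ‖v‖) ^ 2) (μ r) := hμ.integrable_cont r (by fun_prop)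
    have i2 : Integrable (wp β) (μ r) := hμ.integrable_cont r (continuous_wp β (by linarith))
    calc S3 μ r ≤ ∫ v, (Λ * (1 + ‖v‖) ^ 2 + Λ ^ (-β) * wp β v) ∂(μ r) :=
          integral_mono (hμ.integrable_cont r continuous_w3) ((i1.const_mul _).add (i2.const_mul _)) hpt
      _ = Λ * ∫ v, (1 + ‖v‖) ^ 2 ∂(μ r) + Λ ^ (-β) * Sp β μ r := by
          rw [integral_add (i1.const_mul _) (i2.const_mul _), integral_const_mul, integral_const_mul]; rfl
      _ ≤ _ := by have := hμ.quad r; gcongr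
  have : IsFiniteMeasure (volume.restrict (Set.Ioc s t)) := ⟨by simp⟩
  have iS := Sp_intOn hμ hβ s t
  have ic : IntegrableOn (fun _ : ℝ => Λ * 4) (Set.Ioc s t) := integrable_const _
  calc _ ≤ ∫ r in Set.Ioc s t, (Λ * 4 + Λ ^ (-β) * Sp β μ r) :=
        integral_mono (hμ.intOn_cont continuous_w3 s t) (ic.add (iS.const_mul _)) hr
    _ = Λ * 4 * (t - s) + Λ ^ (-β) * ∫ r in Set.Ioc s t, Sp β μ r := by
        have hc : ∫ _ in Set.Ioc s t, Λ * 4 = Λ * 4 * (t - s) := by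
          rw [setIntegral_const, Real.volume_real_Ioc_of_le hst, smul_eq_mul, mul_comm]
        rw [integral_add ic (iS.const_mul _), hc, integral_const_mul]
    _ ≤ _ := by
        have : ∫ r in Set.Ioc s t, Sp β μ r ≤ K := by
          refine le_trans ?_ hKi
          exact setIntegral_mono_set (Sp_intOn hμ hβ 0 T) (Eventually.of_forall fun r => Sp_nonneg β r)
            (Set.Ioc_subset_Ioc hs ht).eventuallyLE
        have : Λ ^ (-β) * ∫ r in Set.Ioc s t, Sp β μ r ≤ Λ ^ (-β) * K := by gcongr
        linarith

end grid

set_option maxHeartbeats 1000000 in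
lemma det_est {B : Vd d → Measure (Vd d)} {κ : ℝ} {Bn : Kernel (Vd d) (Vd d)}
    (hK : GoodKer B κ Bn) {β T K Ce : ℝ} (hβ : 0 < β) (hβ1 : β ≤ 1) (hT : 0 ≤ T) (hK0 : 0 ≤ K)
    (hCe : 0 ≤ Ce) :
    ∃ C : ℝ, 0 ≤ C ∧ ∀ n : ℕ, 1 ≤ n → ∀ (Rad : ℝ) (μ μ' : ℝ → Measure (Vd d)),
      GoodPath Rad μ → GoodPath Rad μ' →
      (∀ Z f, Cls Z f → ∀ s t, 0 ≤ s → s ≤ t → t ≤ T → |nz B μ f s t| ≤ Z * (Ce * ((n:ℝ) ^ 2)⁻¹)) →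
      (∀ Z f, Cls Z f → ∀ s t, 0 ≤ s → s ≤ t → t ≤ T → |nz B μ' f s t| ≤ Z * (Ce * ((n:ℝ) ^ 2)⁻¹)) →
      ∫ r in Set.Ioc 0 T, Sp β μ r ≤ K → ∫ r in Set.Ioc 0 T, Sp β μ' r ≤ K →
      ∀ D0, 0 ≤ D0 → (∀ Z f, Cls Z f → |pr μ μ' f 0| ≤ Z * D0) →
      ∀ t, 0 ≤ t → t ≤ T → ∀ Z f, Cls Z f →
        |pr μ μ' f t| ≤ Z * (C * (D0 + (n:ℝ) ^ (-(β ^ 2 / 4)))) := by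
  have hκ := hK.one_le
  obtain ⟨m, hm⟩ := exists_nat_ge (4 * T + 1)
  set C1 : ℝ := 2 * m * Ce + 48 * K + 2 * (Ce + 8 * (1 + K)) * (8 * T + 2 * (9 + 3 * κ) * K) + 1 with hC1
  have hC1n : 1 ≤ C1 := by
    have : 0 ≤ 2 * m * Ce + 48 * K + 2 * (Ce + 8 * (1 + K)) * (8 * T + 2 * (9 + 3 * κ) * K) := by positivity
    linarith
  refine ⟨Real.exp ((9 + 3 * κ) * (2 * K)) * C1, by positivity, ?_⟩
  intro n hn Rad μ μ' hμ hμ' hnz hnz' hKi hKi' D0 hD0 h0 t ht htT Z f hf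
  have hn1 : (1:ℝ) ≤ n := by exact_mod_cast hn
  have hn0 : (0:ℝ) < n := by linarith
  have hm0 : (0:ℝ) < m := by linarith
  have hM : ((n * m : ℕ) : ℝ) = n * m := by push_cast; ring
  set h : ℝ := T / (n * m) with hh
  set R : ℝ := (n:ℝ) ^ (β / 4) with hR
  set Λ : ℝ := (n:ℝ) ^ ((1:ℝ) / 2) with hΛ
  have hR1 : 1 ≤ R := Real.one_le_rpow hn1 (by positivity)
  have hRn : R ≤ n := by
    calc R ≤ (n:ℝ) ^ (1:ℝ) := Real.rpow_le_rpow_of_exponent_le hn1 (by linarith)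
      _ = n := Real.rpow_one _
  have hΛ1 : 1 ≤ Λ := Real.one_le_rpow hn1 (by norm_num)
  have hh0 : 0 ≤ h := by positivity
  have h4 : 4 * h ≤ 1 / n := by
    rw [hh, le_div_iff₀ hn0]
    calc 4 * (T / (n * m)) * n = 4 * T / m := by field_simp
      _ ≤ 1 := by rw [div_le_one hm0]; linarith
  have hRh : 4 * h * R ≤ 1 := by
    calc 4 * h * R ≤ 1 / n * n := by gcongr
      _ = 1 := by field_simp
  set x : ℝ := (n:ℝ) ^ (-(β ^ 2 / 4)) with hx
  set y : ℝ := (n:ℝ) ^ (-(β / 2)) with hy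
  have hx0 : 0 < x := by positivity
  have hy0 : 0 < y := by positivity
  have hinv : (n:ℝ)⁻¹ = (n:ℝ) ^ (-1:ℝ) := by rw [Real.rpow_neg_one]
  have hnx : (n:ℝ)⁻¹ ≤ x := by
    rw [hinv]; apply Real.rpow_le_rpow_of_exponent_le hn1; nlinarith
  have hny : (n:ℝ)⁻¹ ≤ y := by
    rw [hinv]; apply Real.rpow_le_rpow_of_exponent_le hn1; nlinarith
  have hRx : R ^ (-β) = x := by
    rw [hR, hx, ← Real.rpow_mul hn0.le]; congr 1; ring
  have hyR : y * R ≤ x := by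
    rw [hy, hR, ← Real.rpow_add hn0, hx]; apply Real.rpow_le_rpow_of_exponent_le hn1; nlinarith
  have hΛy : Λ ^ (-β) = y := by
    rw [hΛ, hy, ← Real.rpow_mul hn0.le]; congr 1; ring
  have hΛh : 4 * Λ * h ≤ y := by
    calc 4 * Λ * h = Λ * (4 * h) := by ring
      _ ≤ Λ * (1 / n) := by gcongr
      _ = (n:ℝ) ^ (-((1:ℝ) / 2)) := by
        rw [one_div, hinv, hΛ, ← Real.rpow_add hn0]; norm_num
      _ ≤ y := by apply Real.rpow_le_rpow_of_exponent_le hn1; linarith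
  have hn2 : ((n:ℝ) ^ 2)⁻¹ ≤ (n:ℝ)⁻¹ := by
    apply inv_anti₀ hn0; nlinarith
  have hω : ∀ (ρ : ℝ → Measure (Vd d)), GoodPath Rad ρ → ∫ r in Set.Ioc 0 T, Sp β ρ r ≤ K →
      ∀ s t, 0 ≤ s → s ≤ t → t ≤ T → t - s ≤ h → ∫ r in Set.Ioc s t, S3 ρ r ≤ (1 + K) * y := by
    intro ρ hρ hk s t hs hst htT hts
    refine (S3_omega hρ hβ hΛ1 hk hs hst htT).trans ?_
    rw [hΛy]
    have : 4 * Λ * (t - s) ≤ 4 * Λ * h := by gcongr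
    linarith
  have g := grid hK hμ hμ' hβ hβ1 hR1 hRh (η := Ce * ((n:ℝ) ^ 2)⁻¹) (ω := (1 + K) * y) (T := T)
    (by positivity) (by positivity) hD0 hnz hnz' (hω μ hμ hKi) (hω μ' hμ' hKi') h0
    (δ := t / (n * m)) (by positivity) (by rw [hh]; gcongr) (n * m)
  have ht' : ((n * m : ℕ) : ℝ) * (t / (n * m)) = t := by rw [hM]; field_simp
  rw [ht'] at g
  refine (g htT Z f hf).trans ?_
  have hZ := hf.nonneg
  have hnn : ∀ (ρ : ℝ → Measure (Vd d)), GoodPath Rad ρ → ∫ r in Set.Ioc 0 T, Sp β ρ r ≤ K →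
      ∫ r in Set.Ioc 0 t, Sp β ρ r ≤ K := fun ρ hρ hk =>
    (setIntegral_mono_set (Sp_intOn hρ hβ 0 T) (Eventually.of_forall fun r => Sp_nonneg β r)
            (Set.Ioc_subset_Ioc le_rfl htT).eventuallyLE).trans hk
  have hq : ∫ r in Set.Ioc 0 t, (Sp β μ r + Sp β μ' r) ≤ 2 * K := by
    rw [integral_add (Sp_intOn hμ hβ _ _) (Sp_intOn hμ' hβ _ _)]
    linarith [hnn μ hμ hKi, hnn μ' hμ' hKi']
  have hq0 : 0 ≤ ∫ r in Set.Ioc 0 t, (Sp β μ r + Sp β μ' r) :=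
    integral_nonneg fun r => add_nonneg (Sp_nonneg β r) (Sp_nonneg β r)
  generalize (∫ r in Set.Ioc 0 t, (Sp β μ r + Sp β μ' r)) = q at *
  rw [hRx, mul_assoc (Real.exp _)]
  clear_value x y R Λ
  have hCy : Ce * ((n:ℝ) ^ 2)⁻¹ ≤ Ce * y := by gcongr; exact hn2.trans hny
  have b1 : 2 * ((n * m : ℕ) : ℝ) * (Ce * ((n:ℝ) ^ 2)⁻¹) ≤ 2 * m * Ce * x := by
    rw [hM]
    calc 2 * (n * m) * (Ce * ((n:ℝ) ^ 2)⁻¹) = 2 * m * Ce * (n:ℝ)⁻¹ := by field_simp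
      _ ≤ _ := by gcongr
  have b2 : 24 * x * q ≤ 48 * K * x := by
    have : x * q ≤ x * (2 * K) := mul_le_mul_of_nonneg_left hq hx0.le
    linarith
  have b3 : 2 * (Ce * ((n:ℝ) ^ 2)⁻¹ + 8 * ((1 + K) * y)) * (8 * R * t + (9 + 3 * κ) * q)
      ≤ 2 * (Ce + 8 * (1 + K)) * (8 * T + 2 * (9 + 3 * κ) * K) * x := by
    calc _ ≤ 2 * (Ce * y + 8 * ((1 + K) * y)) * (8 * R * T + (9 + 3 * κ) * (2 * K) * R) := by
          have hz : (9 + 3 * κ) * q ≤ (9 + 3 * κ) * (2 * K) * R := by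
            calc (9 + 3 * κ) * q ≤ (9 + 3 * κ) * (2 * K) := by gcongr
              _ ≤ (9 + 3 * κ) * (2 * K) * R := le_mul_of_one_le_right (by positivity) hR1
          refine mul_le_mul (by linarith) (add_le_add (by gcongr) hz) (by positivity) (by positivity)
      _ = 2 * (Ce + 8 * (1 + K)) * (8 * T + 2 * (9 + 3 * κ) * K) * (y * R) := by ring
      _ ≤ _ := by gcongr
  gcongr Z * (Real.exp ((9 + 3 * κ) * ?_) * ?_)
  have : D0 ≤ C1 * D0 := le_mul_of_one_le_left hD0 hC1n
  have e : C1 * (D0 + x) = C1 * D0 + (2 * m * Ce * x + 48 * K * x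
    + 2 * (Ce + 8 * (1 + K)) * (8 * T + 2 * (9 + 3 * κ) * K) * x + x) := by rw [hC1]; ring
  rw [e]
  linarith

end KacAux

namespace KacAux
variable {d : ℕ}

section lin
variable {B : Vd d → Measure (Vd d)} {κ : ℝ} {Bn : Kernel (Vd d) (Vd d)}
variable {Rad : ℝ} {μ μ' : ℝ → Measure (Vd d)}

lemma post_norm (v vs σ : Vd d) (hσ : ‖σ‖ = 1) :
    ‖postV v vs σ‖ ≤ ‖v‖ + ‖vs‖ ∧ ‖postVs v vs σ‖ ≤ ‖v‖ + ‖vs‖ := by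
  have h := post_energy v vs σ hσ
  have h1 := norm_nonneg v
  have h2 := norm_nonneg vs
  have := mul_nonneg h1 h2
  constructor <;> apply abs_le_of_sq_le_sq' _ (by positivity) |>.2 <;> nlinarith [sq_nonneg ‖postV v vs σ‖, sq_nonneg ‖postVs v vs σ‖]

lemma colJ_abs (hK : GoodKer B κ Bn) {f : Vd d → ℝ} (v vs : Vd d) (b : ℝ)
    (hb : ∀ σ, ‖σ‖ = 1 → |f (postV v vs σ)| + |f (postVs v vs σ)| + |f v| + |f vs| ≤ b) :
    |colJ Bn f v vs| ≤ ‖v - vs‖ * b := by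
  unfold colJ
  rw [abs_mul, abs_norm]
  refine mul_le_mul_of_nonneg_left (hK.bound _ _ b fun σ hσ => ?_) (norm_nonneg _)
  refine le_trans ?_ (hb σ hσ)
  have a1 := abs_sub (f (postV v vs σ) + f (postVs v vs σ) - f v) (f vs)
  have a2 := abs_sub (f (postV v vs σ) + f (postVs v vs σ)) (f v)
  have a3 := abs_add_le (f (postV v vs σ)) (f (postVs v vs σ))
  linarith

lemma colJ_cball (hK : GoodKer B κ Bn) {f : Vd d → ℝ} (hf : Continuous f) (Rad : ℝ) :
    ∃ c, ∀ v vs : Vd d, ‖v‖ ≤ Rad → ‖vs‖ ≤ Rad → |colJ Bn f v vs| ≤ c := by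
  obtain ⟨b, hb⟩ := (isCompact_closedBall (0 : Vd d) (Rad + Rad)).exists_bound_of_continuousOn
    hf.continuousOn
  refine ⟨(Rad + Rad) * (4 * b), fun v vs hv hvs => ?_⟩
  have hR : 0 ≤ Rad := (norm_nonneg v).trans hv
  have hb' : ∀ w : Vd d, ‖w‖ ≤ Rad + Rad → |f w| ≤ b := fun w hw => hb w (by simpa using hw)
  have hb0 : 0 ≤ b := (abs_nonneg _).trans (hb' v (by linarith))
  refine (colJ_abs hK v vs (4 * b) fun σ hσ => ?_).trans ?_
  · have := post_norm v vs σ hσ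
    linarith [hb' _ (this.1.trans (add_le_add hv hvs)), hb' _ (this.2.trans (add_le_add hv hvs)),
      hb' v (by linarith), hb' vs (by linarith)]
  · have := (norm_sub_le v vs).trans (add_le_add hv hvs)
    gcongr

lemma cinner_ball (hK : GoodKer B κ Bn) (hμ : GoodPath Rad μ) {f : Vd d → ℝ} (hf : Continuous f) :
    ∃ c, ∀ r v, ‖v‖ ≤ Rad → |∫ vs, colJ Bn f v vs ∂(μ r)| ≤ c := by
  obtain ⟨c, hc⟩ := colJ_cball hK hf Rad
  exact ⟨c, fun r v hv => hμ.bound r _ fun vs hvs => hc v vs hv hvs⟩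

lemma ccolJ_int (hK : GoodKer B κ Bn) (hμ : GoodPath Rad μ) {f : Vd d → ℝ} (hf : Continuous f)
    (r : ℝ) {v : Vd d} (hv : ‖v‖ ≤ Rad) : Integrable (fun vs => colJ Bn f v vs) (μ r) := by
  obtain ⟨c, hc⟩ := colJ_cball hK hf Rad
  have hm := measurable_colJ hK hf.measurable
  have h2 : Measurable (fun vs => colJ Bn f v vs) := hm.of_uncurry_left (x := v)
  exact hμ.integrable r h2 c fun vs hvs => hc v vs hv hvs

lemma cinner_int (hK : GoodKer B κ Bn) (hμ : GoodPath Rad μ) {f : Vd d → ℝ} (hf : Continuous f)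
    (r : ℝ) : Integrable (fun v => ∫ vs, colJ Bn f v vs ∂(μ r)) (μ r) := by
  obtain ⟨c, hc⟩ := cinner_ball hK hμ hf
  exact hμ.integrable r (inner_meas' hK hμ hf.measurable r) c fun v hv => hc r v hv

lemma cQInt_intOn (hK : GoodKer B κ Bn) (hμ : GoodPath Rad μ) {f : Vd d → ℝ} (hf : Continuous f)
    (s t : ℝ) : IntegrableOn (fun r => QInt B f (μ r) (μ r)) (Set.Ioc s t) := by
  obtain ⟨c, hc⟩ := cinner_ball hK hμ hf
  simp only [QInt_eq hK]
  exact hμ.intOn (inner_meas hK hμ hf.measurable) c hc s t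

lemma colJ_lin (hK : GoodKer B κ Bn) {f g : Vd d → ℝ} (hf : Continuous f) (hg : Continuous g) (c : ℝ)
    (v vs : Vd d) : colJ Bn (fun w => f w + c * g w) v vs = colJ Bn f v vs + c * colJ Bn g v vs := by
  have hi : ∀ h : Vd d → ℝ, Continuous h →
      Integrable (fun σ => h (postV v vs σ) + h (postVs v vs σ) - h v - h vs) (Bn (v - vs)) := by
    intro h hh
    obtain ⟨b, hb⟩ := (isCompact_closedBall (0 : Vd d) (‖v‖ + ‖vs‖)).exists_bound_of_continuousOn
      hh.continuousOn
    have hb' : ∀ w : Vd d, ‖w‖ ≤ ‖v‖ + ‖vs‖ → |h w| ≤ b := fun w hw => hb w (by simpa using hw)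
    have c1 := hh.comp (continuous_postV' v vs)
    have c2 := hh.comp (continuous_postVs' v vs)
    refine hK.integrable _ _ (((c1.add c2).sub continuous_const).sub continuous_const).measurable (4 * b)
      fun σ hσ => ?_
    have hp := post_norm v vs σ hσ
    have e1 := hb' _ hp.1
    have e2 := hb' _ hp.2
    have e3 := hb' v (by linarith [norm_nonneg vs])
    have e4 := hb' vs (by linarith [norm_nonneg v])
    rw [abs_le] at *
    constructor <;> linarith
  unfold colJ
  have : ∫ σ, ((f (postV v vs σ) + c * g (postV v vs σ)) + (f (postVs v vs σ) + c * g (postVs v vs σ))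
      - (f v + c * g v) - (f vs + c * g vs)) ∂(Bn (v - vs)) =
      (∫ σ, (f (postV v vs σ) + f (postVs v vs σ) - f v - f vs) ∂(Bn (v - vs)))
      + c * ∫ σ, (g (postV v vs σ) + g (postVs v vs σ) - g v - g vs) ∂(Bn (v - vs)) := by
    rw [← integral_const_mul, ← integral_add (hi f hf) ((hi g hg).const_mul c)]
    congr 1; ext σ; ring
  rw [this]; ring

lemma QInt_lin (hK : GoodKer B κ Bn) (hμ : GoodPath Rad μ) {f g : Vd d → ℝ} (hf : Continuous f)
    (hg : Continuous g) (c : ℝ) (r : ℝ) :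
    QInt B (fun w => f w + c * g w) (μ r) (μ r) = QInt B f (μ r) (μ r) + c * QInt B g (μ r) (μ r) := by
  simp only [QInt_eq hK, colJ_lin hK hf hg]
  rw [← integral_const_mul, ← integral_add (cinner_int hK hμ hf r) ((cinner_int hK hμ hg r).const_mul c)]
  refine integral_congr_ae ?_
  filter_upwards [hμ.bdd r] with v hv
  rw [integral_add (ccolJ_int hK hμ hf r hv) ((ccolJ_int hK hμ hg r hv).const_mul c), integral_const_mul]

lemma nz_lin (hK : GoodKer B κ Bn) (hμ : GoodPath Rad μ) {f g : Vd d → ℝ} (hf : Continuous f)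
    (hg : Continuous g) (c s t : ℝ) :
    nz B μ (fun w => f w + c * g w) s t = nz B μ f s t + c * nz B μ g s t := by
  unfold nz
  simp only [QInt_lin hK hμ hf hg]
  have e : ∀ r, ∫ v, (f v + c * g v) ∂(μ r) = ∫ v, f v ∂(μ r) + c * ∫ v, g v ∂(μ r) := fun r => by
    rw [integral_add (hμ.integrable_cont r hf) ((hμ.integrable_cont r hg).const_mul c), integral_const_mul]
  rw [e, e, integral_add (cQInt_intOn hK hμ hf s t) ((cQInt_intOn hK hμ hg s t).const_mul c),
    integral_const_mul]
  ring

lemma nz_sum (hK : GoodKer B κ Bn) (hμ : GoodPath Rad μ) {ι : Type} (S : Finset ι) (c : ι → ℝ)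
    (φ : ι → Vd d → ℝ) (hφ : ∀ j, Continuous (φ j)) (s t : ℝ) :
    nz B μ (fun w => ∑ j ∈ S, c j * φ j w) s t = ∑ j ∈ S, c j * nz B μ (φ j) s t := by
  classical
  induction S using Finset.induction_on with
  | empty => simp [nz, QInt]
  | insert a S ha ih =>
    simp only [Finset.sum_insert ha]
    rw [← ih]
    have hc : Continuous (fun w => ∑ j ∈ S, c j * φ j w) := by fun_prop
    have := nz_lin hK hμ hc (hφ a) (c a) s t
    rw [add_comm, ← this]
    simp only [add_comm]

lemma nz_split (hK : GoodKer B κ Bn) (hμ : GoodPath Rad μ) {f : Vd d → ℝ} (hf : Continuous f)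
    {s t : ℝ} (hs : 0 ≤ s) (hst : s ≤ t) : nz B μ f s t = nz B μ f 0 t - nz B μ f 0 s := by
  unfold nz
  rw [← Set.Ioc_union_Ioc_eq_Ioc hs hst, setIntegral_union (Set.Ioc_disjoint_Ioc_of_le le_rfl)
    measurableSet_Ioc (cQInt_intOn hK hμ hf _ _) (cQInt_intOn hK hμ hf _ _)]
  ring

lemma rpow_conv {a b p : ℝ} (ha : 0 ≤ a) (hb : 0 ≤ b) (hp : 1 ≤ p) (hp3 : p ≤ 3) :
    (a + b) ^ p ≤ 4 * (a ^ p + b ^ p) := by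
  have h : (a + b) ^ p ≤ 2 ^ (p - 1) * (a ^ p + b ^ p) := by
    have := NNReal.rpow_add_le_mul_rpow_add_rpow ⟨a, ha⟩ ⟨b, hb⟩ hp
    exact_mod_cast this
  refine h.trans ?_
  have : (2:ℝ) ^ (p - 1) ≤ 4 := by
    calc (2:ℝ) ^ (p - 1) ≤ 2 ^ (2:ℝ) := Real.rpow_le_rpow_of_exponent_le (by norm_num) (by linarith)
      _ = 4 := by norm_num
  gcongr

/-- weight of order p = 2+β -/
def up (β : ℝ) (v : Vd d) : ℝ := (1 + ‖v‖) ^ (2 + β)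

lemma continuous_up {β : ℝ} (hβ : 0 < β) : Continuous (up β : Vd d → ℝ) := by
  unfold up
  exact (by fun_prop : Continuous fun v : Vd d => 1 + ‖v‖).rpow_const fun v => Or.inr (by linarith)

lemma up_wp (β : ℝ) (v : Vd d) : wp β v = (1 + ‖v‖) * up β v := by
  have : 0 < 1 + ‖v‖ := by positivity
  unfold wp up
  rw [show 3 + β = 1 + (2 + β) by ring, Real.rpow_add this, Real.rpow_one]

lemma colJ_up (hK : GoodKer B κ Bn) {β b : ℝ} (hβ : 0 < β) (hβ1 : β ≤ 1) (hb0 : 0 ≤ b) {g : Vd d → ℝ}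
    (hg : ∀ v, |g v| ≤ b * up β v) (v vs : Vd d) :
    |colJ Bn g v vs| ≤ b * (18 * (wp β v + wp β vs)) := by
  have hv := norm_nonneg v
  have hvs := norm_nonneg vs
  have hu : ∀ w : Vd d, 0 ≤ up β w := fun w => by unfold up; positivity
  refine (colJ_abs hK v vs (b * (9 * (up β v + up β vs))) fun σ hσ => ?_).trans ?_
  · have hpn := post_norm v vs σ hσ
    have key : ∀ w : Vd d, ‖w‖ ≤ ‖v‖ + ‖vs‖ → |g w| ≤ b * (4 * (up β v + up β vs)) := by
      intro w hw
      refine (hg w).trans ?_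
      have h1 : up β w ≤ 4 * (up β v + up β vs) := by
        unfold up
        refine le_trans ?_ (rpow_conv (by linarith) (by linarith) (by linarith) (by linarith))
        exact Real.rpow_le_rpow (by positivity) (by linarith) (by linarith)
      gcongr
    linarith [key _ hpn.1, key _ hpn.2, hg v, hg vs]
  · rw [up_wp, up_wp]
    have h1 : ‖v - vs‖ ≤ (1 + ‖v‖) + (1 + ‖vs‖) := (norm_sub_le v vs).trans (by linarith)
    have h2 : 0 ≤ ((1 + ‖v‖) - (1 + ‖vs‖)) * (up β v - up β vs) := by
      rcases le_total ‖v‖ ‖vs‖ with h | h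
      · apply mul_nonneg_of_nonpos_of_nonpos (by linarith)
        have : up β v ≤ up β vs := Real.rpow_le_rpow (by positivity) (by linarith) (by linarith)
        linarith
      · apply mul_nonneg (by linarith)
        have : up β vs ≤ up β v := Real.rpow_le_rpow (by positivity) (by linarith) (by linarith)
        linarith
    have h3 : ‖v - vs‖ * (9 * (up β v + up β vs)) ≤
        ((1 + ‖v‖) + (1 + ‖vs‖)) * (9 * (up β v + up β vs)) := by
      have := hu v; have := hu vs
      gcongr
    have h4 : ‖v - vs‖ * (9 * (up β v + up β vs)) ≤ 18 * ((1 + ‖v‖) * up β v + (1 + ‖vs‖) * up β vs) := by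
      linarith
    have := mul_le_mul_of_nonneg_left h4 hb0
    linarith

lemma nz_up (hK : GoodKer B κ Bn) (hμ : GoodPath Rad μ) {β b U K T : ℝ} (hβ : 0 < β) (hβ1 : β ≤ 1)
    (hb0 : 0 ≤ b) {g : Vd d → ℝ} (hgc : Continuous g) (hg : ∀ v, |g v| ≤ b * up β v)
    (hU : ∀ t, 0 ≤ t → t ≤ T → ∫ v, up β v ∂(μ t) ≤ U) (hKi : ∫ r in Set.Ioc 0 T, Sp β μ r ≤ K)
    {t : ℝ} (ht : 0 ≤ t) (htT : t ≤ T) : |nz B μ g 0 t| ≤ b * (2 * U + 36 * K) := by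
  have h1 : ∀ t, 0 ≤ t → t ≤ T → |∫ v, g v ∂(μ t)| ≤ b * U := by
    intro t ht htT
    calc _ ≤ ∫ v, |g v| ∂(μ t) := abs_integral_le_integral_abs
      _ ≤ ∫ v, b * up β v ∂(μ t) := integral_mono (hμ.integrable_cont t hgc.abs)
          ((hμ.integrable_cont t (continuous_up hβ)).const_mul _) hg
      _ ≤ _ := by rw [integral_const_mul]; exact mul_le_mul_of_nonneg_left (hU t ht htT) hb0
  have h2 : ∀ r, |QInt B g (μ r) (μ r)| ≤ b * 36 * Sp β μ r := by
    intro r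
    have := hμ.prob r
    have iw := hμ.integrable_cont r (continuous_wp (d := d) β (by linarith))
    rw [QInt_eq hK]
    have hin : ∀ v, ‖v‖ ≤ Rad → |∫ vs, colJ Bn g v vs ∂(μ r)| ≤ b * (18 * (wp β v + Sp β μ r)) := by
      intro v hv
      calc _ ≤ ∫ vs, |colJ Bn g v vs| ∂(μ r) := abs_integral_le_integral_abs
        _ ≤ ∫ vs, b * (18 * (wp β v + wp β vs)) ∂(μ r) :=
            integral_mono (ccolJ_int hK hμ hgc r hv).abs
              ((((integrable_const _).add iw).const_mul _).const_mul _) (colJ_up hK hβ hβ1 hb0 hg v)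
        _ = _ := by
            rw [integral_const_mul, integral_const_mul, integral_add (integrable_const _) iw]
            simp [Sp]
    calc _ ≤ ∫ v, |∫ vs, colJ Bn g v vs ∂(μ r)| ∂(μ r) := abs_integral_le_integral_abs
      _ ≤ ∫ v, b * (18 * (wp β v + Sp β μ r)) ∂(μ r) := by
          refine integral_mono_ae (cinner_int hK hμ hgc r).abs
            (((iw.add (integrable_const _)).const_mul _).const_mul _) ?_
          filter_upwards [hμ.bdd r] with v hv using hin v hv
      _ = _ := by
          rw [integral_const_mul, integral_const_mul, integral_add iw (integrable_const _)]
          simp only [integral_const, probReal_univ, smul_eq_mul, one_mul]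
          change b * (18 * (Sp β μ r + Sp β μ r)) = _
          ring
  have h3 : |∫ r in Set.Ioc 0 t, QInt B g (μ r) (μ r)| ≤ b * 36 * K := by
    calc _ ≤ ∫ r in Set.Ioc 0 t, |QInt B g (μ r) (μ r)| := abs_integral_le_integral_abs
      _ ≤ ∫ r in Set.Ioc 0 t, b * 36 * Sp β μ r := integral_mono (cQInt_intOn hK hμ hgc 0 t).abs
          ((Sp_intOn hμ hβ 0 t).const_mul _) h2
      _ ≤ _ := by
          rw [integral_const_mul]
          refine mul_le_mul_of_nonneg_left (le_trans ?_ hKi) (by positivity)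
          exact setIntegral_mono_set (Sp_intOn hμ hβ 0 T) (Eventually.of_forall fun r => Sp_nonneg β r)
            (Set.Ioc_subset_Ioc le_rfl htT).eventuallyLE
  have e1 := h1 t ht htT
  have e2 := h1 0 le_rfl (ht.trans htT)
  unfold nz
  rw [abs_le] at *
  constructor <;> linarith

end lin
end KacAux

namespace KacAux
variable {d : ℕ}

lemma norm_le_card {v : Vd d} {c : ℝ} (hc : 0 ≤ c) (h : ∀ i, |v i| ≤ c) : ‖v‖ ≤ d * c := by
  rw [EuclideanSpace.norm_eq]
  apply Real.sqrt_le_iff.2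
  refine ⟨by positivity, ?_⟩
  have h1 : ∑ i, ‖v i‖ ^ 2 ≤ ∑ _i : Fin d, c ^ 2 :=
    Finset.sum_le_sum fun i _ => pow_le_pow_left₀ (norm_nonneg _) (h i) 2
  refine h1.trans ?_
  simp only [Finset.sum_const, Finset.card_univ, Fintype.card_fin, nsmul_eq_mul]
  rcases Nat.eq_zero_or_pos d with h0 | h0
  · simp [h0]
  · have : (1:ℝ) ≤ d := by exact_mod_cast h0
    have h3 := sq_nonneg c
    rw [mul_pow]
    exact mul_le_mul_of_nonneg_right (by nlinarith) h3

/-- grid point -/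
def gp (k m : ℕ) (j : Fin d → Fin (2 * m + 1)) : Vd d :=
  WithLp.toLp 2 fun i => (((j i : ℕ) : ℝ) - m) / k

lemma gp_norm {k m : ℕ} (j : Fin d → Fin (2 * m + 1)) : ‖gp k m j‖ ≤ d * (m / k) := by
  refine norm_le_card (by positivity) fun i => ?_
  change |(((j i : ℕ) : ℝ) - m) / k| ≤ _
  rw [abs_div, Nat.abs_cast]
  gcongr
  have := (j i).2
  have h2 : ((j i : ℕ) : ℝ) ≤ 2 * m := by exact_mod_cast (by omega : (j i : ℕ) ≤ 2 * m)
  have h3 : (0:ℝ) ≤ ((j i : ℕ) : ℝ) := by positivity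
  rw [abs_le]; constructor <;> linarith

lemma gp_net {k m : ℕ} (hk : 0 < k) (v : Vd d) (hv : ‖v‖ * k ≤ m) :
    ∃ j : Fin d → Fin (2 * m + 1), ‖v - gp k m j‖ ≤ d * (1 / k) := by
  have hk0 : (0:ℝ) < k := by exact_mod_cast hk
  have hb : ∀ i, |v i * k| ≤ m := fun i => by
    rw [abs_mul, Nat.abs_cast]
    refine le_trans ?_ hv
    gcongr
    exact PiLp.norm_apply_le v i
  have hnn : ∀ i, 0 ≤ v i * k + m := fun i => by have := (abs_le.1 (hb i)).1; linarith
  have hlt : ∀ i, ⌊v i * k + m⌋₊ < 2 * m + 1 := fun i => by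
    rw [Nat.floor_lt (hnn i)]; push_cast
    have := (abs_le.1 (hb i)).2; linarith
  refine ⟨fun i => ⟨⌊v i * k + m⌋₊, hlt i⟩, norm_le_card (by positivity) fun i => ?_⟩
  change |v i - ((⌊v i * k + m⌋₊ : ℝ) - m) / k| ≤ _
  have h1 := Nat.floor_le (hnn i)
  have h2 := (Nat.lt_floor_add_one (v i * k + m)).le
  have e : v i - ((⌊v i * k + m⌋₊ : ℝ) - m) / k = (v i * k + m - ⌊v i * k + m⌋₊) / k := by
    field_simp; ring
  rw [e, abs_of_nonneg (div_nonneg (by linarith) hk0.le)]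
  gcongr
  linarith

section bump
variable {ι : Type} [Fintype ι]

/-- bump -/
def gb (δ : ℝ) (x : ι → Vd d) (j : ι) (v : Vd d) : ℝ := max 0 (2 * δ - ‖v - x j‖)
/-- normalized bump -/
def ph (δ : ℝ) (x : ι → Vd d) (j : ι) (v : Vd d) : ℝ := gb δ x j v / max (∑ i, gb δ x i v) δ

lemma gb_nonneg (δ : ℝ) (x : ι → Vd d) (j : ι) (v : Vd d) : 0 ≤ gb δ x j v := le_max_left _ _

lemma continuous_ph {δ : ℝ} (hδ : 0 < δ) (x : ι → Vd d) (j : ι) : Continuous (ph δ x j) := by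
  have h : ∀ j, Continuous (gb δ x j) := fun j => by unfold gb; fun_prop
  unfold ph
  refine (h j).div ((continuous_finsetSum _ fun i _ => h i).max continuous_const) fun v => ?_
  exact (lt_of_lt_of_le hδ (le_max_right _ _)).ne'

lemma ph_nonneg {δ : ℝ} (hδ : 0 < δ) (x : ι → Vd d) (j : ι) (v : Vd d) : 0 ≤ ph δ x j v :=
  div_nonneg (gb_nonneg _ _ _ _) (hδ.le.trans (le_max_right _ _))

lemma ph_sum_le {δ : ℝ} (hδ : 0 < δ) (x : ι → Vd d) (v : Vd d) : ∑ j, ph δ x j v ≤ 1 := by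
  unfold ph
  rw [← Finset.sum_div]
  exact div_le_one_of_le₀ (le_max_left _ _) (hδ.le.trans (le_max_right _ _))

lemma ph_le_one {δ : ℝ} (hδ : 0 < δ) (x : ι → Vd d) (j : ι) (v : Vd d) : ph δ x j v ≤ 1 :=
  (Finset.single_le_sum (fun i _ => ph_nonneg hδ x i v) (Finset.mem_univ j)).trans (ph_sum_le hδ x v)

lemma ph_sum_eq {δ : ℝ} (hδ : 0 < δ) (x : ι → Vd d) (v : Vd d) (h : ∃ j, ‖v - x j‖ ≤ δ) :
    ∑ j, ph δ x j v = 1 := by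
  obtain ⟨j, hj⟩ := h
  have h1 : δ ≤ ∑ i, gb δ x i v := by
    calc δ ≤ gb δ x j v := by unfold gb; exact le_max_of_le_right (by linarith)
      _ ≤ _ := Finset.single_le_sum (fun i _ => gb_nonneg δ x i v) (Finset.mem_univ j)
  unfold ph
  rw [← Finset.sum_div, max_eq_left h1]
  exact div_self (by linarith)

lemma ph_supp {δ : ℝ} (x : ι → Vd d) (j : ι) (v : Vd d) (h : ph δ x j v ≠ 0) :
    ‖v - x j‖ ≤ 2 * δ := by
  by_contra hc
  push Not at hc
  apply h
  unfold ph gb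
  rw [max_eq_left (by linarith)]; simp

lemma cell_approx {β δ Rc Z : ℝ} (hβ : 0 < β) (hδ : 0 < δ) (hδ1 : 2 * δ ≤ 1) (hRc : 1 ≤ Rc)
    (x : ι → Vd d) (hx : ∀ v : Vd d, ‖v‖ ≤ Rc → ∃ j, ‖v - x j‖ ≤ δ) {f : Vd d → ℝ} (hf : Cls Z f)
    (v : Vd d) : |f v - ∑ j, f (x j) * ph δ x j v| ≤ Z * (6 * δ + 3 * Rc ^ (-β)) * up β v := by
  have hZ := hf.nonneg
  have hv := norm_nonneg v
  have hRc0 : 0 < Rc := by linarith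
  have hb : 0 ≤ Rc ^ (-β) := by positivity
  have hu : up β v = (1 + ‖v‖) ^ 2 * (1 + ‖v‖) ^ β := by
    unfold up; rw [Real.rpow_add (by positivity)]; norm_cast
  have hub : 1 ≤ (1 + ‖v‖) ^ β := Real.one_le_rpow (by linarith) hβ.le
  have hu0 : 0 ≤ up β v := by rw [hu]; positivity
  have hwv : wt v ≤ (1 + ‖v‖) ^ 2 := by unfold wt; nlinarith
  have hwx : ∀ j, ph δ x j v ≠ 0 → wt (x j) ≤ 2 * (1 + ‖v‖) ^ 2 := by
    intro j hj
    have h1 := ph_supp x j v hj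
    have h2 : ‖x j‖ ≤ 1 + ‖v‖ := by
      have := norm_sub_norm_le (x j) v
      rw [norm_sub_rev] at this
      linarith
    have h3 : ‖x j‖ ^ 2 ≤ (1 + ‖v‖) ^ 2 := pow_le_pow_left₀ (norm_nonneg _) h2 2
    have h4 : 1 ≤ (1 + ‖v‖) ^ 2 := one_le_pow₀ (by linarith)
    unfold wt; linarith
  rcases le_or_gt ‖v‖ Rc with hle | hgt
  · have hs := ph_sum_eq hδ x v (hx v hle)
    have e : f v - ∑ j, f (x j) * ph δ x j v = ∑ j, (f v - f (x j)) * ph δ x j v := by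
      simp only [sub_mul, Finset.sum_sub_distrib, ← Finset.mul_sum, hs, mul_one]
    rw [e]
    calc _ ≤ ∑ j, |(f v - f (x j)) * ph δ x j v| := Finset.abs_sum_le_sum_abs _ _
      _ ≤ ∑ j, (Z * (6 * δ) * (1 + ‖v‖) ^ 2) * ph δ x j v := by
          refine Finset.sum_le_sum fun j _ => ?_
          rw [abs_mul, abs_of_nonneg (ph_nonneg hδ x j v)]
          by_cases h0 : ph δ x j v = 0
          · simp [h0]
          · refine mul_le_mul_of_nonneg_right ?_ (ph_nonneg hδ x j v)
            refine (hf.2 v (x j)).trans ?_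
            have h1 := ph_supp x j v h0
            have h2 := hwx j h0
            have := wt_pos v; have := wt_pos (x j)
            calc Z * (wt v + wt (x j)) * ‖v - x j‖ ≤ Z * ((1 + ‖v‖) ^ 2 + 2 * (1 + ‖v‖) ^ 2) * (2 * δ) := by
                  gcongr
              _ = _ := by ring
      _ = Z * (6 * δ) * (1 + ‖v‖) ^ 2 := by rw [← Finset.mul_sum, hs, mul_one]
      _ ≤ Z * (6 * δ + 3 * Rc ^ (-β)) * up β v := by
          have : (1 + ‖v‖) ^ 2 ≤ up β v := by rw [hu]; exact le_mul_of_one_le_right (by positivity) hub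
          gcongr
          linarith
  · have h1 : |∑ j, f (x j) * ph δ x j v| ≤ Z * (2 * (1 + ‖v‖) ^ 2) := by
      calc _ ≤ ∑ j, |f (x j) * ph δ x j v| := Finset.abs_sum_le_sum_abs _ _
        _ ≤ ∑ j, Z * (2 * (1 + ‖v‖) ^ 2) * ph δ x j v := by
            refine Finset.sum_le_sum fun j _ => ?_
            rw [abs_mul, abs_of_nonneg (ph_nonneg hδ x j v)]
            by_cases h0 : ph δ x j v = 0
            · simp [h0]
            · refine mul_le_mul_of_nonneg_right ?_ (ph_nonneg hδ x j v)
              exact (hf.1 _).trans (mul_le_mul_of_nonneg_left (hwx j h0) hZ)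
        _ ≤ _ := by
            rw [← Finset.mul_sum]
            exact mul_le_of_le_one_right (by positivity) (ph_sum_le hδ x v)
    have h2 : |f v| ≤ Z * (1 + ‖v‖) ^ 2 := (hf.1 v).trans (mul_le_mul_of_nonneg_left hwv hZ)
    have h3 : (1 + ‖v‖) ^ 2 ≤ Rc ^ (-β) * up β v := by
      rw [hu, mul_left_comm]
      apply le_mul_of_one_le_right (by positivity)
      rw [Real.rpow_neg hRc0.le, ← div_eq_inv_mul, one_le_div (by positivity)]
      exact Real.rpow_le_rpow hRc0.le (by linarith) hβ.le
    have h4 := abs_sub (f v) (∑ j, f (x j) * ph δ x j v)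
    calc _ ≤ Z * (3 * (1 + ‖v‖) ^ 2) := by linarith
      _ ≤ Z * (3 * (Rc ^ (-β) * up β v)) := by gcongr
      _ ≤ Z * (6 * δ + 3 * Rc ^ (-β)) * up β v := by
          have : 0 ≤ Z * (6 * δ) * up β v := by positivity
          linarith

end bump

lemma noise_red (hd : 0 < d) {B : Vd d → Measure (Vd d)} {κ : ℝ} {Bn : Kernel (Vd d) (Vd d)}
    (hK : GoodKer B κ Bn) {β T K : ℝ} (hβ : 0 < β) (hβ1 : β ≤ 1) (hK0 : 0 ≤ K) :
    ∃ Ce : ℝ, 0 ≤ Ce ∧ ∃ (C1 : ℝ) (q A : ℕ), 0 ≤ C1 ∧ ∀ n : ℕ, 1 ≤ n →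
      ∃ (ι : Type) (_ : Fintype ι) (φ : ι → Vd d → ℝ), (Fintype.card ι : ℝ) ≤ C1 * (n:ℝ) ^ q ∧
        (∀ j, Continuous (φ j) ∧ ∀ v, |φ j v| ≤ 1) ∧
        ∀ (Rad : ℝ) (μ : ℝ → Measure (Vd d)), GoodPath Rad μ →
          (∀ t, 0 ≤ t → t ≤ T → ∫ v, up β v ∂(μ t) ≤ K) → ∫ r in Set.Ioc 0 T, Sp β μ r ≤ K →
          (∀ j, ∀ t, 0 ≤ t → t ≤ T → |nz B μ (φ j) 0 t| ≤ ((n:ℝ) ^ A)⁻¹) →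
          ∀ Z f, Cls Z f → ∀ s t, 0 ≤ s → s ≤ t → t ≤ T →
            |nz B μ f s t| ≤ Z * (Ce * ((n:ℝ) ^ 2)⁻¹) := by
  obtain ⟨e, he⟩ := exists_nat_ge (2 / β)
  have hd1 : (1:ℝ) ≤ d := by exact_mod_cast hd
  set C1 : ℝ := (5 * d) ^ d with hC1
  refine ⟨2 * (C1 * (1 + d ^ 2) + (6 + 3) * (38 * K)), by positivity, C1, (2 + e) * d,
    (2 + e) * d + 2 * e + 2, by positivity, ?_⟩
  intro n hn
  have hn1 : (1:ℝ) ≤ n := by exact_mod_cast hn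
  have hn0 : (0:ℝ) < n := by linarith
  set k : ℕ := 2 * d * n ^ 2 with hk
  set m : ℕ := 2 * d * n ^ (2 + e) with hm
  have hk0 : 0 < k := by positivity
  have hkr : (k:ℝ) = 2 * d * n ^ 2 := by rw [hk]; push_cast; ring
  have hmr : (m:ℝ) = 2 * d * n ^ (2 + e) := by rw [hm]; push_cast; ring
  set δ : ℝ := d * (1 / k) with hδ
  have hδe : δ = (2 * n ^ 2 : ℝ)⁻¹ := by rw [hδ, hkr]; field_simp
  have hδ0 : 0 < δ := by rw [hδe]; positivity
  have hnsq : (1:ℝ) ≤ n ^ 2 := one_le_pow₀ hn1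
  have hδ1 : 2 * δ ≤ 1 := by
    rw [hδe, mul_inv, ← mul_assoc]; norm_num
    exact inv_le_one_of_one_le₀ hnsq
  set Rc : ℝ := (n:ℝ) ^ e with hRc
  have hRc1 : 1 ≤ Rc := one_le_pow₀ hn1
  have hmk : (m:ℝ) = Rc * k := by rw [hmr, hkr, hRc]; ring
  have hRcb : Rc ^ (-β) ≤ ((n:ℝ) ^ 2)⁻¹ := by
    rw [hRc, ← Real.rpow_natCast, ← Real.rpow_mul hn0.le, ← Real.rpow_natCast, ← Real.rpow_neg hn0.le]
    apply Real.rpow_le_rpow_of_exponent_le hn1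
    have : 2 ≤ e * β := (div_le_iff₀ hβ).1 he
    push_cast; linarith
  set x : (Fin d → Fin (2 * m + 1)) → Vd d := gp k m with hx
  have hnet : ∀ v : Vd d, ‖v‖ ≤ Rc → ∃ j, ‖v - x j‖ ≤ δ := fun v hv =>
    gp_net hk0 v (by rw [hmk]; gcongr)
  have hxn : ∀ j, wt (x j) ≤ (1 + d ^ 2) * Rc ^ 2 := by
    intro j
    have h1 : ‖x j‖ ≤ d * Rc := by
      refine (gp_norm j).trans ?_
      rw [hmk, mul_div_assoc, div_self (by positivity), mul_one]
    have h2 : ‖x j‖ ^ 2 ≤ (d * Rc) ^ 2 := pow_le_pow_left₀ (norm_nonneg _) h1 2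
    have h3 : 1 ≤ Rc ^ 2 := one_le_pow₀ hRc1
    unfold wt; linarith
  have hcard : (Fintype.card (Fin d → Fin (2 * m + 1)) : ℝ) ≤ C1 * (n:ℝ) ^ ((2 + e) * d) := by
    simp only [Fintype.card_pi, Fintype.card_fin, Finset.prod_const, Finset.card_univ]
    push_cast
    rw [hmr, hC1, pow_mul, ← mul_pow]
    gcongr
    have : (1:ℝ) ≤ d * n ^ (2 + e) := one_le_mul_of_one_le_of_one_le hd1 (one_le_pow₀ hn1)
    linarith
  refine ⟨Fin d → Fin (2 * m + 1), inferInstance, fun j => ph δ x j, hcard,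
    fun j => ⟨continuous_ph hδ0 x j, fun v => ?_⟩, ?_⟩
  · rw [abs_of_nonneg (ph_nonneg hδ0 x j v)]; exact ph_le_one hδ0 x j v
  intro Rad μ hμ hU hKi hφ Z f hf s t hs hst htT
  have hZ := hf.nonneg
  have hcont : ∀ j, Continuous (ph δ x j) := fun j => continuous_ph hδ0 x j
  have hsc : Continuous (fun w => ∑ j, f (x j) * ph δ x j w) := by fun_prop
  have hgc : Continuous (fun w => f w + (-1) * ∑ j, f (x j) * ph δ x j w) :=
    hf.continuous.add (continuous_const.mul hsc)
  have main : ∀ t, 0 ≤ t → t ≤ T → |nz B μ f 0 t| ≤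
      Z * ((C1 * (1 + d ^ 2) + (6 + 3) * (38 * K)) * ((n:ℝ) ^ 2)⁻¹) := by
    intro t ht htT
    have h1 := nz_up hK hμ hβ hβ1 (b := Z * (6 * δ + 3 * Rc ^ (-β))) (by positivity) hgc (fun v => by
      have := cell_approx hβ hδ0 hδ1 hRc1 x hnet hf v
      rwa [neg_one_mul, ← sub_eq_add_neg]) hU hKi ht htT
    rw [nz_lin hK hμ hf.continuous hsc, nz_sum hK hμ _ _ _ hcont] at h1
    have h2 : |∑ j, f (x j) * nz B μ (ph δ x j) 0 t| ≤ Z * (C1 * (1 + d ^ 2) * ((n:ℝ) ^ 2)⁻¹) := by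
      calc _ ≤ ∑ j, |f (x j) * nz B μ (ph δ x j) 0 t| := Finset.abs_sum_le_sum_abs _ _
        _ ≤ ∑ _j : Fin d → Fin (2 * m + 1), Z * ((1 + d ^ 2) * Rc ^ 2) * ((n:ℝ) ^ ((2 + e) * d + 2 * e + 2))⁻¹ := by
            refine Finset.sum_le_sum fun j _ => ?_
            rw [abs_mul]
            exact mul_le_mul ((hf.1 _).trans (mul_le_mul_of_nonneg_left (hxn j) hZ)) (hφ j t ht htT)
              (abs_nonneg _) (by positivity)
        _ = (Fintype.card (Fin d → Fin (2 * m + 1)) : ℝ) *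
            (Z * ((1 + d ^ 2) * Rc ^ 2) * ((n:ℝ) ^ ((2 + e) * d + 2 * e + 2))⁻¹) := by
            rw [Finset.sum_const, nsmul_eq_mul, Finset.card_univ]
        _ ≤ C1 * (n:ℝ) ^ ((2 + e) * d) *
            (Z * ((1 + d ^ 2) * Rc ^ 2) * ((n:ℝ) ^ ((2 + e) * d + 2 * e + 2))⁻¹) := by gcongr
        _ = _ := by
            rw [hRc, pow_add, pow_add, mul_comm 2 e, pow_mul (n:ℝ) e 2]
            field_simp
    have h3 : Z * (6 * δ + 3 * Rc ^ (-β)) * (2 * K + 36 * K) ≤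
        Z * ((6 + 3) * (38 * K) * ((n:ℝ) ^ 2)⁻¹) := by
      have hδ2 : δ ≤ ((n:ℝ) ^ 2)⁻¹ := by rw [hδe]; apply inv_anti₀ (by positivity); linarith
      calc _ ≤ Z * (6 * ((n:ℝ) ^ 2)⁻¹ + 3 * ((n:ℝ) ^ 2)⁻¹) * (2 * K + 36 * K) := by gcongr
        _ = _ := by ring
    rw [abs_le] at *
    constructor <;> linarith
  rw [nz_split hK hμ hf.continuous hs hst]
  have m1 := main t (hs.trans hst) htT
  have m2 := main s hs (hst.trans htT)
  rw [abs_le] at *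
  constructor <;> linarith

end KacAux

namespace KacAux
variable {d : ℕ}

section emp
variable {N : ℕ} {μ : Measure (Vd d)}

lemma emp_facts (hμ : μ ∈ empiricalSphere d N) : 1 ≤ N ∧ IsProbabilityMeasure μ ∧
    (∫ v, ‖v‖ ^ 2 ∂μ = 1) ∧ ∃ x : Fin N → Vd d, μ = (N : ℝ≥0∞)⁻¹ • ∑ i, Measure.dirac (x i) ∧
      (∀ᵐ v ∂μ, ∃ i, v = x i) ∧ (∀ i, ‖x i‖ ≤ √N) := by
  obtain ⟨⟨hp, -, he⟩, x, hx⟩ := hμ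
  have hN : 1 ≤ N := by
    rcases Nat.eq_zero_or_pos N with h | h
    · subst h
      exfalso
      have h1 := hp.measure_univ
      rw [hx] at h1; simp at h1
    · exact h
  have hN0 : (0:ℝ) < N := by exact_mod_cast hN
  refine ⟨hN, hp, he, x, hx, ?_, ?_⟩
  · rw [hx]
    apply Measure.ae_smul_measure
    rw [ae_iff]
    rw [Measure.finsetSum_apply]
    refine Finset.sum_eq_zero fun i _ => ?_
    have hs : MeasurableSet {v : Vd d | ¬ ∃ i, v = x i} := by
      have : {v : Vd d | ¬ ∃ i, v = x i} = (Set.range x)ᶜ := by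
        ext v; simp [eq_comm]
      rw [this]
      exact (Set.finite_range x).measurableSet.compl
    rw [Measure.dirac_apply' _ hs]
    simp
  · intro i
    have h2 : ∫ v, ‖v‖ ^ 2 ∂μ = (N:ℝ)⁻¹ * ∑ i, ‖x i‖ ^ 2 := by
      rw [hx, integral_smul_measure, integral_finsetSum_measure]
      · simp
      · intro i _; exact integrable_dirac (by simp)
    rw [he] at h2
    have h3 : ‖x i‖ ^ 2 ≤ N := by
      have : ∑ i, ‖x i‖ ^ 2 = (N:ℝ) := by field_simp at h2; linarith
      rw [← this]
      exact Finset.single_le_sum (f := fun i => ‖x i‖ ^ 2) (fun i _ => by positivity) (Finset.mem_univ i)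
    exact Real.le_sqrt_of_sq_le h3

lemma coll_int (hμ : μ ∈ empiricalSphere d N) {x : Fin N → Vd d}
    (hx : μ = (N : ℝ≥0∞)⁻¹ • ∑ i, Measure.dirac (x i)) {φ : Vd d → ℝ} {b : ℝ} (hφ : Measurable φ)
    (hb : ∀ v, |φ v| ≤ b) {i j : Fin N} (hij : x i ≠ x j) (σ : Vd d) :
    IsProbabilityMeasure (collUpdate N μ (x i) (x j) σ) ∧
    ∫ v, φ v ∂(collUpdate N μ (x i) (x j) σ) = ∫ v, φ v ∂μ + (N:ℝ)⁻¹ *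
      (φ (postV (x i) (x j) σ) + φ (postVs (x i) (x j) σ) - φ (x i) - φ (x j)) := by
  obtain ⟨hN, hp, -⟩ := emp_facts hμ
  have hN0 : (N:ℝ≥0∞) ≠ 0 := by exact_mod_cast (by omega : N ≠ 0)
  have hNi : (N:ℝ≥0∞)⁻¹ ≠ ⊤ := by simpa using (by omega : N ≠ 0)
  set ρ : Measure (Vd d) := (N : ℝ≥0∞)⁻¹ • (Measure.dirac (x i) + Measure.dirac (x j)) with hρ
  set τ : Measure (Vd d) := (N : ℝ≥0∞)⁻¹ •
    (Measure.dirac (postV (x i) (x j) σ) + Measure.dirac (postVs (x i) (x j) σ)) with hτ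
  have hij' : i ≠ j := fun h => hij (by rw [h])
  have hle : ρ ≤ μ + τ := by
    refine le_trans ?_ (Measure.le_add_right le_rfl)
    rw [hx, hρ]
    refine Measure.le_iff.2 fun s hs => ?_
    simp only [Measure.smul_apply, Measure.add_apply, Measure.finsetSum_apply]
    gcongr
    rw [← Finset.sum_pair (f := fun k => (Measure.dirac (x k)) s) hij']
    exact Finset.sum_le_sum_of_subset (Finset.subset_univ _)
  have fρ : IsFiniteMeasure ρ := by
    rw [hρ]; exact Measure.smul_finite _ hNi
  have fτ : IsFiniteMeasure τ := by
    rw [hτ]; exact Measure.smul_finite _ hNi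
  have key : collUpdate N μ (x i) (x j) σ + ρ = μ + τ := by
    unfold collUpdate
    exact Measure.sub_add_cancel_of_le hle
  set ν := collUpdate N μ (x i) (x j) σ with hν
  have fν : IsFiniteMeasure ν := isFiniteMeasure_of_le (μ + τ) (by rw [← key]; exact Measure.le_add_right le_rfl)
  have hint : ∀ (m : Measure (Vd d)) [IsFiniteMeasure m], Integrable φ m := fun m _ =>
    Integrable.of_bound (C := b) hφ.aestronglyMeasurable (Eventually.of_forall hb)
  have hd : ∀ y : Vd d, ∫ v, φ v ∂(Measure.dirac y) = φ y := fun y => integral_dirac _ _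
  have iρ : ∫ v, φ v ∂ρ = (N:ℝ)⁻¹ * (φ (x i) + φ (x j)) := by
    rw [hρ, integral_smul_measure, integral_add_measure (hint _) (hint _), hd, hd]; simp
  have iτ : ∫ v, φ v ∂τ = (N:ℝ)⁻¹ * (φ (postV (x i) (x j) σ) + φ (postVs (x i) (x j) σ)) := by
    rw [hτ, integral_smul_measure, integral_add_measure (hint _) (hint _), hd, hd]; simp
  constructor
  · constructor
    have h1 : ν Set.univ + ρ Set.univ = μ Set.univ + τ Set.univ := by
      rw [← Measure.add_apply, key, Measure.add_apply]
    have h2 : ρ Set.univ = τ Set.univ := by simp [hρ, hτ]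
    rw [h2, hp.measure_univ] at h1
    exact (ENNReal.add_left_inj (measure_ne_top τ _)).1 h1
  · have h1 : ∫ v, φ v ∂(ν + ρ) = ∫ v, φ v ∂(μ + τ) := by rw [key]
    rw [integral_add_measure (hint _) (hint _), integral_add_measure (hint _) (hint _), iρ, iτ] at h1
    linarith

variable {B : Vd d → Measure (Vd d)} {κ : ℝ} {Bn : Kernel (Vd d) (Vd d)}

/-- collision increment -/
def dlt (φ : Vd d → ℝ) (v vs σ : Vd d) : ℝ := φ (postV v vs σ) + φ (postVs v vs σ) - φ v - φ vs

lemma kacGen_eq (hK : GoodKer B κ Bn) (hμ : μ ∈ empiricalSphere d N) {φ : Vd d → ℝ} {b : ℝ}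
    (hφ : Measurable φ) (hb : ∀ v, |φ v| ≤ b) (G : Measure (Vd d) → ℝ) (H : ℝ → ℝ)
    (hG : ∀ ν, IsProbabilityMeasure ν → G ν = H (∫ v, φ v ∂ν)) :
    kacGen B N G μ = ∫ v, ∫ vs, ‖v - vs‖ * ∫ σ, N * (H (∫ v, φ v ∂μ + (N:ℝ)⁻¹ * dlt φ v vs σ)
      - H (∫ v, φ v ∂μ)) ∂(Bn (v - vs)) ∂μ ∂μ := by
  obtain ⟨hN, hp, -, x, hx, hae, -⟩ := emp_facts hμ
  unfold kacGen
  rw [← integral_const_mul]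
  refine integral_congr_ae ?_
  filter_upwards [hae] with v hv
  rw [← integral_const_mul]
  refine integral_congr_ae ?_
  filter_upwards [hae] with vs hvs
  obtain ⟨i, rfl⟩ := hv
  obtain ⟨j, rfl⟩ := hvs
  rw [hK.integral, mul_left_comm]
  by_cases h : x i = x j
  · simp [h]
  · congr 1
    rw [← integral_const_mul]
    congr 1
    ext σ
    obtain ⟨h1, h2⟩ := coll_int hμ hx hφ hb h σ
    rw [hG _ h1, hG _ hp, h2]; rfl

/-- truncation to `[-b,b]` -/
def clp (b y : ℝ) : ℝ := max (-b) (min b y)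

lemma clp_eq {b y : ℝ} (h : |y| ≤ b) : clp b y = y := by
  unfold clp
  rw [abs_le] at h
  rw [min_eq_right h.2, max_eq_right h.1]

lemma clp_abs {b : ℝ} (hb : 0 ≤ b) (y : ℝ) : |clp b y| ≤ b := by
  unfold clp
  rw [abs_le]
  exact ⟨le_max_left _ _, max_le (by linarith) (min_le_left _ _)⟩

lemma int_abs_le {ν : Measure (Vd d)} (hp : IsProbabilityMeasure ν) {φ : Vd d → ℝ} {b : ℝ}
    (hb : ∀ v, |φ v| ≤ b) : |∫ v, φ v ∂ν| ≤ b := by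
  have := norm_integral_le_of_norm_le_const (μ := ν) (f := φ) (C := b) (Eventually.of_forall hb)
  simpa using this

lemma exists_G {φ : Vd d → ℝ} {b : ℝ} (hφ : Measurable φ) (hb : ∀ v, |φ v| ≤ b) :
    ∃ G : Measure (Vd d) → ℝ, Measurable G ∧ (∀ ν, |G ν| ≤ b) ∧
      ∀ ν, IsProbabilityMeasure ν → G ν = ∫ v, φ v ∂ν := by
  refine ⟨fun ν => clp b ((∫⁻ v, ENNReal.ofReal (φ v) ∂ν).toReal
    - (∫⁻ v, ENNReal.ofReal (- φ v) ∂ν).toReal), ?_, fun ν => clp_abs ((abs_nonneg _).trans (hb 0)) _,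
    fun ν hν => ?_⟩
  · unfold clp
    have h1 : Measurable fun ν : Measure (Vd d) => (∫⁻ v, ENNReal.ofReal (φ v) ∂ν).toReal :=
      (Measure.measurable_lintegral hφ.ennreal_ofReal).ennreal_toReal
    have h2 : Measurable fun ν : Measure (Vd d) => (∫⁻ v, ENNReal.ofReal (- φ v) ∂ν).toReal :=
      (Measure.measurable_lintegral hφ.neg.ennreal_ofReal).ennreal_toReal
    exact measurable_const.max (measurable_const.min (h1.sub h2))
  · rw [← clp_eq (int_abs_le hν hb), integral_eq_lintegral_pos_part_sub_lintegral_neg_part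
      (Integrable.of_bound (C := b) hφ.aestronglyMeasurable (Eventually.of_forall hb))]

/-- carré du champ -/
def gam (Bn : Kernel (Vd d) (Vd d)) (N : ℕ) (φ : Vd d → ℝ) (μ : Measure (Vd d)) : ℝ :=
  (N:ℝ)⁻¹ * ∫ v, ∫ vs, ‖v - vs‖ * ∫ σ, (dlt φ v vs σ) ^ 2 ∂(Bn (v - vs)) ∂μ ∂μ

lemma fin_integrable (hμ : μ ∈ empiricalSphere d N) (f : Vd d → ℝ) : Integrable f μ := by
  obtain ⟨hN, hp, -, x, hx, hae, -⟩ := emp_facts hμ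
  rw [hx]
  refine Integrable.smul_measure ?_ (by simpa using (by omega : N ≠ 0))
  rw [integrable_finsetSum_measure]
  intro i _
  exact integrable_dirac (by simp)

lemma dlt_meas {φ : Vd d → ℝ} (hφ : Measurable φ) (v vs : Vd d) : Measurable (dlt φ v vs) := by
  have h1 := hφ.comp (continuous_postV' v vs).measurable
  have h2 := hφ.comp (continuous_postVs' v vs).measurable
  exact ((h1.add h2).sub_const _).sub_const _

lemma dlt_abs {φ : Vd d → ℝ} {b : ℝ} (hb : ∀ v, |φ v| ≤ b) (v vs σ : Vd d) : |dlt φ v vs σ| ≤ 4 * b := by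
  unfold dlt
  have h1 := abs_le.1 (hb v); have h2 := abs_le.1 (hb vs)
  have h3 := abs_le.1 (hb (postV v vs σ)); have h4 := abs_le.1 (hb (postVs v vs σ))
  rw [abs_le]; constructor <;> linarith

lemma gen1 (hK : GoodKer B κ Bn) (hμ : μ ∈ empiricalSphere d N) {φ : Vd d → ℝ} {b : ℝ}
    (hφ : Measurable φ) (hb : ∀ v, |φ v| ≤ b) {G : Measure (Vd d) → ℝ}
    (hG : ∀ ν, IsProbabilityMeasure ν → G ν = ∫ v, φ v ∂ν) :
    kacGen B N G μ = QInt B φ μ μ := by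
  obtain ⟨hN, hp, -, -⟩ := emp_facts hμ
  have hN0 : (N:ℝ) ≠ 0 := by exact_mod_cast (by omega : N ≠ 0)
  rw [kacGen_eq hK hμ hφ hb _ (fun y => y) hG, QInt_eq hK]
  unfold colJ
  congr! 6 with v vs
  ext σ
  unfold dlt
  field_simp
  ring

lemma gen2 (hK : GoodKer B κ Bn) (hμ : μ ∈ empiricalSphere d N) {φ : Vd d → ℝ} {b : ℝ}
    (hφ : Measurable φ) (hb : ∀ v, |φ v| ≤ b) {G : Measure (Vd d) → ℝ}
    (hG : ∀ ν, IsProbabilityMeasure ν → G ν = ∫ v, φ v ∂ν) :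
    kacGen B N (fun ν => (G ν) ^ 2) μ
      = 2 * (∫ v, φ v ∂μ) * QInt B φ μ μ + gam Bn N φ μ := by
  obtain ⟨hN, hp, -, -⟩ := emp_facts hμ
  have := hK.markov
  have hN0 : (N:ℝ) ≠ 0 := by exact_mod_cast (by omega : N ≠ 0)
  rw [kacGen_eq hK hμ hφ hb _ (fun y => y ^ 2) (fun ν hν => by simp only [hG ν hν]),
    QInt_eq hK]
  unfold colJ gam
  generalize ∫ v, φ v ∂μ = X
  rw [← integral_const_mul, ← integral_const_mul, ← integral_add (fin_integrable hμ _) (fin_integrable hμ _)]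
  congr 1; ext v
  rw [← integral_const_mul, ← integral_const_mul, ← integral_add (fin_integrable hμ _) (fin_integrable hμ _)]
  congr 1; ext vs
  have i1 : Integrable (fun σ => dlt φ v vs σ) (Bn (v - vs)) :=
    hK.integrable _ _ (dlt_meas hφ v vs) _ fun σ _ => dlt_abs hb v vs σ
  have i2 : Integrable (fun σ => dlt φ v vs σ ^ 2) (Bn (v - vs)) :=
    hK.integrable _ _ ((dlt_meas hφ v vs).pow_const 2) ((4 * b) ^ 2) fun σ _ => by
      rw [abs_pow]; exact pow_le_pow_left₀ (abs_nonneg _) (dlt_abs hb v vs σ) 2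
  have e : ∀ σ, N * ((X + (N:ℝ)⁻¹ * dlt φ v vs σ) ^ 2 - X ^ 2)
      = 2 * X * dlt φ v vs σ + (N:ℝ)⁻¹ * dlt φ v vs σ ^ 2 := fun σ => by field_simp; ring
  simp only [e]
  rw [integral_add (i1.const_mul _) (i2.const_mul _), integral_const_mul, integral_const_mul]
  unfold dlt
  ring

lemma norm_mean (hμ : μ ∈ empiricalSphere d N) : ∫ v, ‖v‖ ∂μ ≤ 1 := by
  obtain ⟨hN, hp, he, -⟩ := emp_facts hμ
  calc ∫ v, ‖v‖ ∂μ ≤ ∫ v, (1 + ‖v‖ ^ 2) / 2 ∂μ :=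
        integral_mono (fin_integrable hμ _) (fin_integrable hμ _) fun v => by
          change ‖v‖ ≤ _
          nlinarith [sq_nonneg (‖v‖ - 1)]
    _ = 1 := by
        rw [integral_div, integral_add (fin_integrable hμ _) (fin_integrable hμ _), he]; simp

lemma dist_mean (hμ : μ ∈ empiricalSphere d N) : ∫ v, ∫ vs, ‖v - vs‖ ∂μ ∂μ ≤ 2 := by
  obtain ⟨hN, hp, he, -⟩ := emp_facts hμ
  have h := norm_mean hμ
  have hf := fin_integrable hμ
  calc _ ≤ ∫ v, ∫ vs, (‖v‖ + ‖vs‖) ∂μ ∂μ := integral_mono (hf _) (hf _) fun v =>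
        integral_mono (hf _) (hf _) fun vs => norm_sub_le v vs
    _ = ∫ v, (‖v‖ + ∫ vs, ‖vs‖ ∂μ) ∂μ := by
        congr 1; ext v; rw [integral_add (hf _) (hf _)]; simp
    _ ≤ 2 := by rw [integral_add (hf _) (hf _)]; simp; linarith

lemma bil_bound (hμ : μ ∈ empiricalSphere d N) {g : Vd d → Vd d → ℝ} {c : ℝ} (hc : 0 ≤ c)
    (hg : ∀ v vs, |g v vs| ≤ c) : |∫ v, ∫ vs, ‖v - vs‖ * g v vs ∂μ ∂μ| ≤ 2 * c := by
  have hf := fin_integrable hμ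
  have h1 : ∀ v vs, |‖v - vs‖ * g v vs| ≤ ‖v - vs‖ * c := fun v vs => by
    rw [abs_mul, abs_norm]; exact mul_le_mul_of_nonneg_left (hg v vs) (norm_nonneg _)
  calc _ ≤ ∫ v, |∫ vs, ‖v - vs‖ * g v vs ∂μ| ∂μ := abs_integral_le_integral_abs
    _ ≤ ∫ v, ∫ vs, |‖v - vs‖ * g v vs| ∂μ ∂μ := integral_mono (hf _) (hf _) fun v =>
        abs_integral_le_integral_abs
    _ ≤ ∫ v, ∫ vs, ‖v - vs‖ * c ∂μ ∂μ := integral_mono (hf _) (hf _) fun v =>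
        integral_mono (hf _) (hf _) fun vs => h1 v vs
    _ = (∫ v, ∫ vs, ‖v - vs‖ ∂μ ∂μ) * c := by simp only [integral_mul_const]
    _ ≤ 2 * c := mul_le_mul_of_nonneg_right (dist_mean hμ) hc

lemma QInt_abs (hK : GoodKer B κ Bn) (hμ : μ ∈ empiricalSphere d N) {φ : Vd d → ℝ} {b : ℝ}
    (hb : ∀ v, |φ v| ≤ b) : |QInt B φ μ μ| ≤ 8 * b := by
  have hb0 : 0 ≤ b := (abs_nonneg _).trans (hb 0)
  rw [QInt_eq hK]
  have := bil_bound hμ (g := fun v vs => ∫ σ, dlt φ v vs σ ∂(Bn (v - vs))) (c := 4 * b) (by positivity)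
    fun v vs => hK.bound _ _ _ fun σ _ => dlt_abs hb v vs σ
  calc _ ≤ _ := this
    _ = _ := by ring

lemma gam_abs (hK : GoodKer B κ Bn) (hμ : μ ∈ empiricalSphere d N) {φ : Vd d → ℝ} {b : ℝ}
    (hb : ∀ v, |φ v| ≤ b) : |gam Bn N φ μ| ≤ 32 * b ^ 2 / N := by
  have hb0 : 0 ≤ b := (abs_nonneg _).trans (hb 0)
  have := bil_bound hμ (g := fun v vs => ∫ σ, dlt φ v vs σ ^ 2 ∂(Bn (v - vs))) (c := (4 * b) ^ 2)
    (by positivity) fun v vs => hK.bound _ _ _ fun σ _ => by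
      rw [abs_pow]; exact pow_le_pow_left₀ (abs_nonneg _) (dlt_abs hb v vs σ) 2
  unfold gam
  rw [abs_mul, abs_of_nonneg (by positivity : (0:ℝ) ≤ (N:ℝ)⁻¹), inv_mul_eq_div]
  gcongr
  linarith

end emp
end KacAux

namespace KacAux
variable {d : ℕ}

lemma wt_inv_lip (v v' : Vd d) : |(1 + ‖v‖ ^ 2)⁻¹ - (1 + ‖v'‖ ^ 2)⁻¹| ≤ ‖v - v'‖ := by
  set a := ‖v‖
  set b := ‖v'‖
  have ha : 0 ≤ a := norm_nonneg _
  have hb : 0 ≤ b := norm_nonneg _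
  have h1 : |b - a| ≤ ‖v - v'‖ := by
    rw [abs_sub_comm]; exact abs_norm_sub_norm_le v v'
  have e : (1 + a ^ 2)⁻¹ - (1 + b ^ 2)⁻¹ = (b - a) * ((a + b) / ((1 + a ^ 2) * (1 + b ^ 2))) := by
    field_simp; ring
  rw [e, abs_mul]
  have h2 : |(a + b) / ((1 + a ^ 2) * (1 + b ^ 2))| ≤ 1 := by
    rw [abs_of_nonneg (by positivity), div_le_one (by positivity)]
    nlinarith [sq_nonneg (a - 1), sq_nonneg (b - 1), mul_nonneg (sq_nonneg a) (sq_nonneg b), sq_nonneg (a-1/2), sq_nonneg (b-1/2)]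
  calc _ ≤ |b - a| * 1 := by gcongr
    _ ≤ _ := by linarith

lemma lip_testF {g : Vd d → ℝ} {b L : ℝ} (hb : ∀ v, |g v| ≤ b) (hL0 : 0 ≤ L)
    (hL : ∀ v v', |g v - g v'| ≤ L * ‖v - v'‖) :
    (fun v => (b + L + 1)⁻¹ * g v) ∈ testF d := by
  have hb0 : 0 ≤ b := (abs_nonneg _).trans (hb 0)
  have hw : ∀ v : Vd d, (1 + ‖v‖ ^ 2)⁻¹ ≤ 1 := fun v => by
    apply inv_le_one_of_one_le₀; nlinarith [sq_nonneg ‖v‖]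
  have hw0 : ∀ v : Vd d, 0 ≤ (1 + ‖v‖ ^ 2)⁻¹ := fun v => by positivity
  have hc : (0:ℝ) < b + L + 1 := by linarith
  constructor
  · intro v
    rw [abs_div, abs_mul, abs_of_pos (inv_pos.2 hc), abs_of_nonneg (by positivity : 0 ≤ 1 + ‖v‖ ^ 2)]
    rw [div_le_one (by positivity), inv_mul_le_iff₀ hc]
    nlinarith [hb v, sq_nonneg ‖v‖]
  · intro v v'
    have e : (b + L + 1)⁻¹ * g v / (1 + ‖v‖ ^ 2) - (b + L + 1)⁻¹ * g v' / (1 + ‖v'‖ ^ 2)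
        = (b + L + 1)⁻¹ * ((g v - g v') * (1 + ‖v‖ ^ 2)⁻¹
          + g v' * ((1 + ‖v‖ ^ 2)⁻¹ - (1 + ‖v'‖ ^ 2)⁻¹)) := by
      field_simp; ring
    rw [e, abs_mul, abs_of_pos (inv_pos.2 hc), inv_mul_le_iff₀ hc]
    have hn := norm_nonneg (v - v')
    calc _ ≤ |(g v - g v') * (1 + ‖v‖ ^ 2)⁻¹| + |g v' * ((1 + ‖v‖ ^ 2)⁻¹ - (1 + ‖v'‖ ^ 2)⁻¹)| :=
          abs_add_le _ _
      _ ≤ L * ‖v - v'‖ * 1 + b * ‖v - v'‖ := by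
          rw [abs_mul, abs_mul, abs_of_nonneg (hw0 v)]
          gcongr
          · exact hL v v'
          · exact hw v
          · exact hb v'
          · exact wt_inv_lip v v'
      _ ≤ _ := by nlinarith

lemma meas_of_testF {E : Type*} {mE : MeasurableSpace E} {k : E → Measure (Vd d)}
    (hp : ∀ x, IsProbabilityMeasure (k x))
    (h : ∀ f ∈ testF d, Measurable fun x => ∫ v, f v ∂(k x)) : Measurable k := by
  have hl : ∀ g : Vd d → ℝ, ∀ L : ℝ≥0, (∀ v, |g v| ≤ 1) → LipschitzWith L g →
      Measurable fun x => ∫ v, g v ∂(k x) := by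
    intro g L hg hL
    have h1 := (h _ (lip_testF (L := (L:ℝ)) hg L.coe_nonneg fun v v' => by
      have := hL.dist_le_mul v v'
      rwa [Real.dist_eq, dist_eq_norm] at this)).const_mul (1 + (L:ℝ) + 1)
    convert h1 using 2 with x
    rw [integral_const_mul, ← mul_assoc, mul_inv_cancel₀ (by positivity), one_mul]
  refine Measurable.measure_of_isPiSystem_of_isProbabilityMeasure (S := {s | IsClosed s})
    (by rw [← borel_eq_generateFrom_isClosed]; exact BorelSpace.measurable_eq)
    isPiSystem_isClosed ?_
  intro s hs
  have hδ : ∀ n : ℕ, (0:ℝ) < 1 / ((n:ℝ) + 1) := fun n => by positivity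
  refine measurable_of_tendsto_metrizable (f := fun (n : ℕ) x =>
    ENNReal.ofReal (∫ v, (thickenedIndicator (hδ n) s v : ℝ) ∂(k x))) (fun n => ?_) ?_
  · refine ENNReal.measurable_ofReal.comp (hl _ _ (fun v => ?_)
      (lipschitzWith_thickenedIndicator (hδ n) s))
    rw [abs_of_nonneg (NNReal.coe_nonneg _)]
    exact_mod_cast thickenedIndicator_le_one (hδ n) s v
  · rw [tendsto_pi_nhds]
    intro x
    have := tendsto_lintegral_thickenedIndicator_of_isClosed (k x) hs hδ
      tendsto_one_div_add_atTop_nhds_zero_nat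
    refine this.congr fun n => ?_
    rw [lintegral_coe_eq_integral]
    exact integrable_thickenedIndicator s (hδ n)

lemma meas_int_k {E : Type*} {mE : MeasurableSpace E} {k : E → Measure (Vd d)}
    (hk : Measurable k) (hp : ∀ x, IsProbabilityMeasure (k x)) {φ : Vd d → ℝ} (hφ : Measurable φ) :
    Measurable fun x => ∫ v, φ v ∂(k x) := by
  let K : Kernel E (Vd d) := ⟨k, hk⟩
  have hK : IsMarkovKernel K := ⟨hp⟩
  exact ((hφ.comp measurable_snd).stronglyMeasurable.integral_kernel_prod_right' (κ := K)
    (f := fun x : E × Vd d => φ x.2)).measurable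

lemma meas_bil_k {E : Type*} {mE : MeasurableSpace E} {k : E → Measure (Vd d)}
    (hk : Measurable k) (hp : ∀ x, IsProbabilityMeasure (k x)) {J : Vd d → Vd d → ℝ}
    (hJ : Measurable fun x : Vd d × Vd d => J x.1 x.2) :
    Measurable fun x => ∫ v, ∫ vs, J v vs ∂(k x) ∂(k x) := by
  let K : Kernel E (Vd d) := ⟨k, hk⟩
  have hK : IsMarkovKernel K := ⟨hp⟩
  let K2 : Kernel (E × Vd d) (Vd d) := ⟨fun x => k x.1, hk.comp measurable_fst⟩
  have hK2 : IsMarkovKernel K2 := ⟨fun x => hp x.1⟩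
  have h1 : Measurable fun y : (E × Vd d) × Vd d => J y.1.2 y.2 :=
    hJ.comp (g := fun x : Vd d × Vd d => J x.1 x.2)
    ((measurable_snd.comp measurable_fst).prodMk measurable_snd)
  have h2 := (h1.stronglyMeasurable.integral_kernel_prod_right' (κ := K2))
  exact (h2.integral_kernel_prod_right' (κ := K)).measurable

section proc
variable {Ω : Type*} {m : MeasurableSpace Ω} {B : Vd d → Measure (Vd d)} {N : ℕ} {P : Measure Ω}
  {𝓕 : Filtration ℝ m} {μp : ℝ → Ω → Measure (Vd d)}

lemma kp_prob (h : IsKacProcess B N P 𝓕 μp) (t : ℝ) (ω : Ω) : IsProbabilityMeasure (μp t ω) :=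
  (emp_facts (h.mem t ω)).2.1

lemma kp_adapted (h : IsKacProcess B N P 𝓕 μp) (t : ℝ) : Measurable[𝓕 t] (μp t) :=
  meas_of_testF (kp_prob h t) fun f hf => h.adapted f hf t

lemma kp_joint (h : IsKacProcess B N P 𝓕 μp) : Measurable fun x : ℝ × Ω => μp x.1 x.2 := by
  refine meas_of_testF (fun x => kp_prob h x.1 x.2) fun f hf => ?_
  set X : ℝ → Ω → ℝ := fun t ω => ∫ v, f v ∂(μp t ω) with hX
  have hm : ∀ t, Measurable (X t) := fun t => (h.adapted f hf t).mono (𝓕.le t) le_rfl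
  let τ : ℕ → ℝ → ℝ := fun n t => ((⌊t * (n+1)⌋ : ℝ) + 1) / (n + 1)
  have hτ1 : ∀ n t, t ≤ τ n t := fun n t => by
    change t ≤ _ / _
    rw [le_div_iff₀ (by positivity)]
    exact (Int.lt_floor_add_one _).le
  have hτ2 : ∀ n t, τ n t ≤ t + 1 / ((n:ℝ) + 1) := fun n t => by
    change _ / _ ≤ _
    rw [div_le_iff₀ (by positivity), add_mul, div_mul_cancel₀ _ (by positivity)]
    linarith [Int.floor_le (t * (n+1))]
  have hτ : ∀ t, Tendsto (fun n => τ n t) atTop (nhds t) := fun t => by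
    refine tendsto_of_tendsto_of_tendsto_of_le_of_le tendsto_const_nhds ?_ (fun n => hτ1 n t)
      (fun n => hτ2 n t)
    simpa using tendsto_one_div_add_atTop_nhds_zero_nat.const_add t
  refine measurable_of_tendsto_metrizable (f := fun (n : ℕ) (x : ℝ × Ω) => X (τ n x.1) x.2)
    (fun n => ?_) ?_
  · have h1 : Measurable fun y : ℤ × Ω => X (((y.1 : ℝ) + 1) / (n + 1)) y.2 :=
      measurable_from_prod_countable_right fun z => hm (((z:ℝ) + 1) / (n + 1))
    have h2 : Measurable fun x : ℝ × Ω => ((⌊x.1 * (n+1)⌋ : ℤ), x.2) :=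
      (Int.measurable_floor.comp (measurable_fst.mul_const _)).prodMk measurable_snd
    exact h1.comp h2
  · rw [tendsto_pi_nhds]
    rintro ⟨t, ω⟩
    have hc := h.rightCont ω f hf t
    exact hc.tendsto.comp (tendsto_nhdsWithin_iff.2 ⟨hτ t, Eventually.of_forall fun n => hτ1 n t⟩)

lemma kp_path (h : IsKacProcess B N P 𝓕 μp) {Rad : ℝ} (hR : √N ≤ Rad) (ω : Ω) :
    GoodPath Rad (fun t => μp t ω) where
  meas := (kp_joint h).comp (measurable_id.prodMk measurable_const)
  prob := fun t => kp_prob h t ω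
  en := fun t => (emp_facts (h.mem t ω)).2.2.1
  bdd := fun t => by
    obtain ⟨hN, hp, -, x, hx, hae, hxn⟩ := emp_facts (h.mem t ω)
    filter_upwards [hae] with v hv
    obtain ⟨i, rfl⟩ := hv
    exact (hxn i).trans hR

lemma kp_rc (h : IsKacProcess B N P 𝓕 μp) {φ : Vd d → ℝ} (hφ : Continuous φ) {b : ℝ}
    (hb : ∀ v, |φ v| ≤ b) (ω : Ω) (t : ℝ) :
    ContinuousWithinAt (fun s => ∫ v, φ v ∂(μp s ω)) (Set.Ici t) t := by
  let ρ : ℝ → ProbabilityMeasure (Vd d) := fun s => ⟨μp s ω, kp_prob h s ω⟩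
  have h1 : Tendsto ρ (nhdsWithin t (Set.Ici t)) (nhds (ρ t)) := by
    rw [tendsto_iff_forall_lipschitz_integral_tendsto]
    rintro f ⟨C, hC⟩ ⟨L, hL⟩
    have hh := h.rightCont ω _ (lip_testF (g := fun v => f v - f 0) (b := C) (L := L)
      (fun v => by have := hC v 0; rwa [Real.dist_eq] at this) L.coe_nonneg (fun v v' => by
      have := hL.dist_le_mul v v'
      rw [Real.dist_eq, dist_eq_norm] at this; simpa using this)) t
    have hC0 : 0 ≤ C := dist_nonneg.trans (hC 0 0)
    have h3 := (hh.tendsto.const_mul (C + (L:ℝ) + 1)).add_const (f 0)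
    have e : ∀ s, (C + (L:ℝ) + 1) * (∫ v, (C + (L:ℝ) + 1)⁻¹ * (f v - f 0) ∂(μp s ω)) + f 0
        = ∫ v, f v ∂(ρ s : Measure (Vd d)) := fun s => by
      have := kp_prob h s ω
      rw [integral_const_mul, ← mul_assoc, mul_inv_cancel₀ (by positivity), one_mul,
        integral_sub (fin_integrable (h.mem s ω) _) (fin_integrable (h.mem s ω) _)]
      simp [ρ]
    simpa only [e] using h3
  rw [ProbabilityMeasure.tendsto_iff_forall_integral_tendsto] at h1
  let g : BoundedContinuousFunction (Vd d) ℝ := BoundedContinuousFunction.ofNormedAddCommGroup φ hφ b hb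
  exact h1 g

end proc
end KacAux

namespace KacAux
variable {d : ℕ}

lemma sym_sq {A : ℝ → ℝ} (hA : Measurable A) {a : ℝ} (ha : ∀ s, |A s| ≤ a) (T : ℝ) :
    ∫ u in Set.Ioc 0 T, (∫ s in Set.Ioc 0 T, if s ≤ u then A s else 0) * A u
      = (∫ s in Set.Ioc 0 T, A s) ^ 2 / 2 := by
  set ρ := (volume : Measure ℝ).restrict (Set.Ioc 0 T) with hρ
  have fρ : IsFiniteMeasure ρ := ⟨by simp [hρ]⟩
  have ha0 : 0 ≤ a := (abs_nonneg _).trans (ha 0)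
  have hAA : ∀ u s, |A s * A u| ≤ a * a := fun u s => by
    rw [abs_mul]; exact mul_le_mul (ha s) (ha u) (abs_nonneg _) ha0
  have m0 : Measurable fun x : ℝ × ℝ => A x.2 * A x.1 := (hA.comp measurable_snd).mul (hA.comp measurable_fst)
  let F1 : ℝ × ℝ → ℝ := fun x => if x.2 ≤ x.1 then A x.2 * A x.1 else 0
  let F2 : ℝ × ℝ → ℝ := fun x => if x.2 ≤ x.1 then 0 else A x.2 * A x.1
  have ms : MeasurableSet {x : ℝ × ℝ | x.2 ≤ x.1} := measurableSet_le measurable_snd measurable_fst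
  have m1 : Measurable F1 := Measurable.ite ms m0 measurable_const
  have m2 : Measurable F2 := Measurable.ite ms measurable_const m0
  have b1 : ∀ x, |F1 x| ≤ a * a := fun x => by
    simp only [F1]; split_ifs
    · exact hAA _ _
    · simp; positivity
  have b2 : ∀ x, |F2 x| ≤ a * a := fun x => by
    simp only [F2]; split_ifs
    · simp; positivity
    · exact hAA _ _
  have i1 : Integrable F1 (ρ.prod ρ) := Integrable.of_bound (C := a * a) m1.aestronglyMeasurable (Eventually.of_forall b1)
  have i2 : Integrable F2 (ρ.prod ρ) := Integrable.of_bound (C := a * a) m2.aestronglyMeasurable (Eventually.of_forall b2)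
  have e1 : ∫ u, (∫ s, (if s ≤ u then A s else 0) ∂ρ) * A u ∂ρ = ∫ u, ∫ s, F1 (u, s) ∂ρ ∂ρ := by
    congr 1; ext u
    rw [← integral_mul_const]
    congr 1; ext s
    simp only [F1]; split_ifs <;> simp
  have e2 : ∫ u, ∫ s, F2 (u, s) ∂ρ ∂ρ = ∫ u, ∫ s, F1 (u, s) ∂ρ ∂ρ := by
    rw [integral_integral_swap (f := fun u s => F2 (u, s)) i2]
    congr 1; ext u
    refine integral_congr_ae ?_
    have : ∀ᵐ s ∂ρ, s ≠ u := by
      refine ae_restrict_of_ae ?_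
      simp [ae_iff]
    filter_upwards [this] with s hs
    simp only [F1, F2]
    rcases lt_or_gt_of_ne hs with h | h
    · rw [if_neg (not_le.2 h), if_pos h.le]; ring
    · rw [if_pos h.le, if_neg (not_le.2 h)]
  have e3 : ∫ u, ∫ s, F1 (u, s) ∂ρ ∂ρ + ∫ u, ∫ s, F2 (u, s) ∂ρ ∂ρ = (∫ s, A s ∂ρ) ^ 2 := by
    rw [← integral_prod _ i1, ← integral_prod _ i2, ← integral_add i1 i2, sq, ← integral_prod_mul]
    congr 1; ext x
    simp only [F1, F2]; split_ifs <;> ring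
  rw [e1]; linarith

section mart
variable {Ω : Type*} {m : MeasurableSpace Ω} {P : Measure Ω} [IsProbabilityMeasure P]
  {𝓕 : Filtration ℝ m}

lemma mart_pull {M : ℝ → Ω → ℝ} (hM : Martingale M 𝓕 P) {u t : ℝ} (hut : u ≤ t) {Y : Ω → ℝ}
    (hY : Measurable[𝓕 u] Y) {c : ℝ} (hc : ∀ ω, |Y ω| ≤ c) :
    ∫ ω, M t ω * Y ω ∂P = ∫ ω, M u ω * Y ω ∂P := by
  have hYm : Measurable Y := hY.mono (𝓕.le u) le_rfl
  have hi : Integrable (fun ω => M t ω * Y ω) P :=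
    (hM.integrable t).mul_bdd (c := c) hYm.aestronglyMeasurable (Eventually.of_forall hc)
  rw [← integral_condExp (𝓕.le u)]
  refine integral_congr_ae ?_
  have h1 := condExp_mul_of_stronglyMeasurable_right (μ := P) (m := 𝓕 u) (f := M t) (g := Y)
    hY.stronglyMeasurable hi (hM.integrable t)
  have h2 := hM.2 u t hut
  filter_upwards [h1, h2] with ω h1 h2
  change (P[M t * Y|𝓕 u]) ω = _
  rw [h1, Pi.mul_apply, h2]

lemma sq_bound {X A Γ : ℝ → Ω → ℝ} {b a g T : ℝ} (hT : 0 ≤ T)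
    (mX : Measurable fun x : ℝ × Ω => X x.1 x.2) (mA : Measurable fun x : ℝ × Ω => A x.1 x.2)
    (mG : Measurable fun x : ℝ × Ω => Γ x.1 x.2)
    (hX : ∀ t ω, |X t ω| ≤ b) (hA : ∀ t ω, |A t ω| ≤ a) (hG : ∀ t ω, |Γ t ω| ≤ g)
    (adX : Measurable[𝓕 0] (X 0)) (adA : ∀ t, Measurable[𝓕 t] (A t))
    (hM : Martingale (fun t ω => X t ω - ∫ s in Set.Ioc 0 t, A s ω) 𝓕 P)
    (hL : Martingale (fun t ω => X t ω ^ 2 - ∫ s in Set.Ioc 0 t, (2 * X s ω * A s ω + Γ s ω)) 𝓕 P) :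
    ∫ ω, (X T ω - (∫ s in Set.Ioc 0 T, A s ω) - X 0 ω) ^ 2 ∂P ≤ g * T := by
  set ρ := (volume : Measure ℝ).restrict (Set.Ioc 0 T) with hρ
  have fρ : IsFiniteMeasure ρ := ⟨by simp [hρ]⟩
  have hb0 : 0 ≤ b := by
    obtain ⟨ω⟩ := P.nonempty_of_neZero
    exact (abs_nonneg _).trans (hX 0 ω)
  have ha0 : 0 ≤ a := by
    obtain ⟨ω⟩ := P.nonempty_of_neZero
    exact (abs_nonneg _).trans (hA 0 ω)
  have rT : ρ.real Set.univ = T := by simp [hρ, hT]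
  have sec : ∀ {Z : ℝ → Ω → ℝ}, (Measurable fun x : ℝ × Ω => Z x.1 x.2) → ∀ ω, Measurable fun t => Z t ω :=
    fun h ω => h.comp (measurable_id.prodMk measurable_const)
  have sec' : ∀ {Z : ℝ → Ω → ℝ}, (Measurable fun x : ℝ × Ω => Z x.1 x.2) → ∀ t, Measurable (Z t) :=
    fun h ω => h.comp (measurable_const.prodMk measurable_id)
  -- the running integral
  set I : Ω → ℝ := fun ω => ∫ s, A s ω ∂ρ with hI
  have mI : Measurable I := by
    have := (mA.comp measurable_swap).stronglyMeasurable.integral_prod_right' (ν := ρ)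
    exact this.measurable
  have bI : ∀ ω, |I ω| ≤ a * T := fun ω => by
    have := norm_integral_le_of_norm_le_const (μ := ρ) (f := fun s => A s ω) (C := a) (Eventually.of_forall fun s => hA s ω)
    rwa [rT] at this
  set J : ℝ → Ω → ℝ := fun u ω => ∫ s, (if s ≤ u then A s ω else 0) ∂ρ with hJ
  have mJ : Measurable fun x : ℝ × Ω => J x.1 x.2 := by
    have h1 : Measurable fun y : (ℝ × Ω) × ℝ => if y.2 ≤ y.1.1 then A y.2 y.1.2 else 0 :=
      Measurable.ite (measurableSet_le measurable_snd (measurable_fst.comp measurable_fst))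
        (mA.comp (measurable_snd.prodMk (measurable_snd.comp measurable_fst))) measurable_const
    exact (h1.stronglyMeasurable.integral_prod_right' (ν := ρ)).measurable
  have bJ : ∀ u ω, |J u ω| ≤ a * T := fun u ω => by
    have := norm_integral_le_of_norm_le_const (μ := ρ) (f := fun s => if s ≤ u then A s ω else 0) (C := a)
      (Eventually.of_forall fun s => by
        split_ifs
        · exact hA s ω
        · simpa using ha0)
    rwa [rT] at this
  have hJI : ∀ u ∈ Set.Ioc 0 T, ∀ ω, ∫ s in Set.Ioc 0 u, A s ω = J u ω := by
    intro u hu ω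
    simp only [hJ, hρ]
    have : (fun s => if s ≤ u then A s ω else 0) = Set.indicator (Set.Iic u) (fun s => A s ω) := by
      ext s; simp [Set.indicator]
    rw [this, integral_indicator measurableSet_Iic, Measure.restrict_restrict measurableSet_Iic]
    congr 2
    ext s; simp only [Set.mem_inter_iff, Set.mem_Iic, Set.mem_Ioc]
    exact ⟨fun h => ⟨h.2, h.1, h.2.trans hu.2⟩, fun h => ⟨h.2.1, h.1⟩⟩
  have bdI : ∀ {f : Ω → ℝ} {c : ℝ}, Measurable f → (∀ ω, |f ω| ≤ c) → Integrable f P := fun h hc =>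
    Integrable.of_bound (C := _) h.aestronglyMeasurable (Eventually.of_forall hc)
  set M : Ω → ℝ := fun ω => X T ω - I ω with hMd
  have mM : Measurable M := (sec' mX T).sub mI
  have bM : ∀ ω, |M ω| ≤ b + a * T := fun ω => (abs_sub _ _).trans (add_le_add (hX T ω) (bI ω))
  have bmul : ∀ {x y c e : ℝ}, |x| ≤ c → |y| ≤ e → |x * y| ≤ c * e := fun h h' => by
    rw [abs_mul]; exact mul_le_mul h h' (abs_nonneg _) ((abs_nonneg _).trans h)
  -- E[M I]
  have eMI : ∫ ω, M ω * I ω ∂P = ∫ ω, ((∫ u, X u ω * A u ω ∂ρ) - I ω ^ 2 / 2) ∂P := by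
    have s1 : ∫ ω, M ω * I ω ∂P = ∫ ω, ∫ u, M ω * A u ω ∂ρ ∂P := by
      congr 1; ext ω; rw [integral_const_mul]
    have p1 : Integrable (Function.uncurry fun ω u => M ω * A u ω) (P.prod ρ) :=
      Integrable.of_bound (C := (b + a * T) * a)
        ((mM.comp measurable_fst).mul (mA.comp measurable_swap)).aestronglyMeasurable
        (Eventually.of_forall fun x => bmul (bM _) (hA _ _))
    have s2 : ∫ u, ∫ ω, M ω * A u ω ∂P ∂ρ = ∫ u, ∫ ω, (X u ω - J u ω) * A u ω ∂P ∂ρ := by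
      refine setIntegral_congr_fun measurableSet_Ioc fun u hu => ?_
      have := mart_pull hM (u := u) (t := T) hu.2 (adA u) (hA u)
      refine Eq.trans this ?_
      congr 1; ext ω; rw [hJI u hu ω]
    have p2 : Integrable (Function.uncurry fun u ω => (X u ω - J u ω) * A u ω) (ρ.prod P) :=
      Integrable.of_bound (C := (b + a * T) * a)
        ((mX.sub mJ).mul mA).aestronglyMeasurable
        (Eventually.of_forall fun x => bmul ((abs_sub _ _).trans (add_le_add (hX _ _) (bJ _ _))) (hA _ _))
    rw [s1, integral_integral_swap p1, s2, integral_integral_swap p2]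
    congr 1; ext ω
    have := sym_sq (sec mA ω) (fun s => hA s ω) T
    rw [← this]
    simp only [sub_mul]
    refine integral_sub ?_ ?_
    · exact Integrable.of_bound (C := b * a) ((sec mX ω).mul (sec mA ω)).aestronglyMeasurable
        (Eventually.of_forall fun x => bmul (hX _ _) (hA _ _))
    · exact Integrable.of_bound (C := (a * T) * a) ((sec mJ ω).mul (sec mA ω)).aestronglyMeasurable
        (Eventually.of_forall fun x => bmul (bJ _ _) (hA _ _))
  -- E[M X0]
  have eMX : ∫ ω, M ω * X 0 ω ∂P = ∫ ω, X 0 ω * X 0 ω ∂P := by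
    have := mart_pull hM hT adX (hX 0)
    simpa using this
  -- E[X_T^2]
  set W : Ω → ℝ := fun ω => ∫ u, (2 * X u ω * A u ω + Γ u ω) ∂ρ with hW
  have mW : Measurable W := by
    have h1 : Measurable fun x : ℝ × Ω => 2 * X x.1 x.2 * A x.1 x.2 + Γ x.1 x.2 :=
      ((mX.const_mul 2).mul mA).add mG
    exact ((h1.comp measurable_swap).stronglyMeasurable.integral_prod_right' (ν := ρ)).measurable
  have bW : ∀ ω, |W ω| ≤ (2 * b * a + g) * T := fun ω => by
    have := norm_integral_le_of_norm_le_const (μ := ρ) (f := fun u => 2 * X u ω * A u ω + Γ u ω)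
      (C := 2 * b * a + g) (Eventually.of_forall fun s => by
        refine (abs_add_le _ _).trans (add_le_add (bmul ?_ (hA _ _)) (hG _ _))
        rw [abs_mul, abs_two]; linarith [hX s ω])
    rwa [rT] at this
  have eX : ∫ ω, X T ω ^ 2 ∂P = ∫ ω, (X 0 ω ^ 2 + W ω) ∂P := by
    have := mart_pull hL hT (Y := fun _ => 1) measurable_const (c := 1) (by simp)
    simp only [mul_one, Set.Ioc_self, Measure.restrict_empty, integral_zero_measure, sub_zero] at this
    rw [integral_sub (bdI (c := b ^ 2) ((sec' mX T).pow_const 2) fun ω => by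
      rw [abs_pow]; exact pow_le_pow_left₀ (abs_nonneg _) (hX T ω) 2) (bdI mW bW)] at this
    rw [integral_add (bdI (c := b ^ 2) ((sec' mX 0).pow_const 2) fun ω => by
      rw [abs_pow]; exact pow_le_pow_left₀ (abs_nonneg _) (hX 0 ω) 2) (bdI mW bW), ← this]
    ring
  have iXX : ∀ t, Integrable (fun ω => X t ω ^ 2) P := fun t => bdI (c := b ^ 2) ((sec' mX t).pow_const 2) fun ω => by
      rw [abs_pow]; exact pow_le_pow_left₀ (abs_nonneg _) (hX t ω) 2
  have iMI : Integrable (fun ω => M ω * I ω) P := bdI (mM.mul mI) fun ω => bmul (bM ω) (bI ω)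
  have iII : Integrable (fun ω => I ω ^ 2) P := bdI (c := (a * T) ^ 2) (mI.pow_const 2) fun ω => by
      rw [abs_pow]; exact pow_le_pow_left₀ (abs_nonneg _) (bI ω) 2
  have iMX : Integrable (fun ω => M ω * X 0 ω) P := bdI (mM.mul (sec' mX 0)) fun ω => bmul (bM ω) (hX 0 ω)
  have mXA : Measurable fun ω => ∫ u, X u ω * A u ω ∂ρ :=
    (((mX.mul mA).comp measurable_swap).stronglyMeasurable.integral_prod_right' (ν := ρ)).measurable
  have iXA : Integrable (fun ω => ∫ u, X u ω * A u ω ∂ρ) P := bdI (c := b * a * T) mXA fun ω => by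
    have := norm_integral_le_of_norm_le_const (μ := ρ) (f := fun u => X u ω * A u ω)
      (C := b * a) (Eventually.of_forall fun s => bmul (hX _ _) (hA _ _))
    rwa [rT] at this
  have iG : Integrable (fun ω => ∫ u, Γ u ω ∂ρ) P := bdI (c := g * T)
    ((mG.comp measurable_swap).stronglyMeasurable.integral_prod_right' (ν := ρ)).measurable fun ω => by
    have := norm_integral_le_of_norm_le_const (μ := ρ) (f := fun u => Γ u ω)
      (C := g) (Eventually.of_forall fun s => hG _ _)
    rwa [rT] at this
  have e0 : ∀ ω, (X T ω - I ω - X 0 ω) ^ 2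
      = X T ω ^ 2 - 2 * (M ω * I ω) - I ω ^ 2 - 2 * (M ω * X 0 ω) + X 0 ω ^ 2 := fun ω => by
    simp only [hMd]; ring
  have hWs : ∀ ω, W ω = 2 * (∫ u, X u ω * A u ω ∂ρ) + ∫ u, Γ u ω ∂ρ := fun ω => by
    simp only [hW]
    rw [← integral_const_mul, ← integral_add]
    · simp only [mul_assoc]
    · exact Integrable.of_bound (C := 2 * (b * a)) (((sec mX ω).mul (sec mA ω)).const_mul 2).aestronglyMeasurable
        (Eventually.of_forall fun x => bmul (by simp) (bmul (hX _ _) (hA _ _)))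
    · exact Integrable.of_bound (C := g) (sec mG ω).aestronglyMeasurable
        (Eventually.of_forall fun x => hG _ _)
  change ∫ ω, (X T ω - I ω - X 0 ω) ^ 2 ∂P ≤ g * T
  simp only [e0]
  have q1 : Integrable (fun ω => X T ω ^ 2 - 2 * (M ω * I ω)) P := (iXX T).sub (iMI.const_mul 2)
  have q2 : Integrable (fun ω => X T ω ^ 2 - 2 * (M ω * I ω) - I ω ^ 2) P := q1.sub iII
  have q3 : Integrable (fun ω => X T ω ^ 2 - 2 * (M ω * I ω) - I ω ^ 2 - 2 * (M ω * X 0 ω)) P :=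
    q2.sub (iMX.const_mul 2)
  have q4 : Integrable (fun ω => 2 * (∫ u, X u ω * A u ω ∂ρ) + ∫ u, Γ u ω ∂ρ) P := (iXA.const_mul 2).add iG
  rw [integral_add q3 (iXX 0), integral_sub q2 (iMX.const_mul 2), integral_sub q1 iII,
    integral_sub (iXX T) (iMI.const_mul 2), integral_const_mul, integral_const_mul, eMI, eMX, eX]
  simp only [hWs]
  rw [integral_add (iXX 0) q4, integral_add (iXA.const_mul 2) iG,
    integral_const_mul, integral_sub iXA (iII.div_const 2), integral_div]
  have hGb : ∫ ω, ∫ u, Γ u ω ∂ρ ∂P ≤ g * T := by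
    calc _ ≤ ∫ ω, g * T ∂P := integral_mono iG (integrable_const _) fun ω => by
          have := norm_integral_le_of_norm_le_const (μ := ρ) (f := fun u => Γ u ω)
            (C := g) (Eventually.of_forall fun s => hG _ _)
          rw [rT] at this
          exact (le_abs_self _).trans this
      _ = g * T := by simp
  simp only [← sq]
  linarith

end mart
end KacAux

namespace KacAux
variable {d : ℕ}

section doob
variable {Ω : Type*} {m : MeasurableSpace Ω} {P : Measure Ω} [IsProbabilityMeasure P]
  {𝓕 : Filtration ℝ m}

lemma doob {Y : ℝ → Ω → ℝ} {T a c : ℝ} (hT : 0 ≤ T) (ha : 0 < a)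
    (h1 : ∀ t, 0 ≤ t → StronglyMeasurable[𝓕 t] (Y t))
    (h2 : ∀ s t, 0 ≤ s → s ≤ t → Y s ≤ᵐ[P] P[Y t | 𝓕 s])
    (h3 : ∀ t, 0 ≤ t → Integrable (Y t) P) (h0 : ∀ t, 0 ≤ t → ∀ ω, 0 ≤ Y t ω)
    (hrc : ∀ ω t, 0 ≤ t → ContinuousWithinAt (fun s => Y s ω) (Set.Ici t) t)
    (hc : ∫ ω, Y T ω ∂P ≤ c) :
    P {ω | ∃ t, 0 ≤ t ∧ t ≤ T ∧ a < Y t ω} ≤ ENNReal.ofReal (c / a) := by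
  let τ : ℕ → ℕ → ℝ := fun n k => k * T / 2 ^ n
  have hτ0 : ∀ n k, 0 ≤ τ n k := fun n k => by simp only [τ]; positivity
  have hτm : ∀ n, Monotone (τ n) := fun n i j hij => by
    simp only [τ]
    gcongr
  let S : ℕ → Set Ω := fun n => {ω | ∃ k ≤ 2 ^ n, a < Y (τ n k) ω}
  have hS : Monotone S := by
    refine monotone_nat_of_le_succ fun n ω => ?_
    rintro ⟨k, hk, h⟩
    refine ⟨2 * k, by rw [pow_succ]; omega, ?_⟩
    have : τ (n + 1) (2 * k) = τ n k := by
      simp only [τ]; push_cast; rw [pow_succ]; field_simp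
    rwa [this]
  have hsub : {ω | ∃ t, 0 ≤ t ∧ t ≤ T ∧ a < Y t ω} ⊆ ⋃ n, S n := by
    rintro ω ⟨t, ht0, htT, hat⟩
    rw [Set.mem_iUnion]
    rcases hT.eq_or_lt with hT0 | hT0
    · have : t = 0 := by linarith
      subst this
      exact ⟨0, 0, by simp, by simpa [τ] using hat⟩
    let k : ℕ → ℕ := fun n => ⌈t * 2 ^ n / T⌉₊
    have hk1 : ∀ n, t ≤ τ n (k n) := fun n => by
      have := Nat.le_ceil (t * 2 ^ n / T)
      simp only [τ, k]
      rw [le_div_iff₀ (by positivity)]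
      rwa [div_le_iff₀ hT0] at this
    have hk2 : ∀ n, τ n (k n) ≤ t + T * (1 / 2) ^ n := fun n => by
      have := (Nat.ceil_lt_add_one (a := t * 2 ^ n / T) (by positivity)).le
      simp only [τ, k]
      rw [div_le_iff₀ (by positivity)]
      calc _ ≤ (t * 2 ^ n / T + 1) * T := by gcongr
        _ = _ := by
          have : ((1:ℝ) / 2) ^ n * 2 ^ n = 1 := by rw [← mul_pow]; norm_num
          rw [add_mul (t), mul_assoc T, this]
          field_simp
    have hk3 : ∀ n, k n ≤ 2 ^ n := fun n => by
      refine Nat.ceil_le.2 ?_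
      rw [div_le_iff₀ hT0]
      push_cast
      nlinarith [pow_pos (two_pos (α := ℝ)) n]
    have hlim : Tendsto (fun n => τ n (k n)) atTop (nhds t) := by
      refine tendsto_of_tendsto_of_tendsto_of_le_of_le tendsto_const_nhds ?_ hk1 hk2
      simpa using ((tendsto_pow_atTop_nhds_zero_of_lt_one (by norm_num : (0:ℝ) ≤ 1 / 2)
        (by norm_num)).const_mul T).const_add t
    have h := (hrc ω t ht0).tendsto.comp
      (tendsto_nhdsWithin_iff.2 ⟨hlim, Eventually.of_forall hk1⟩)
    obtain ⟨n, hn⟩ := (h.eventually (lt_mem_nhds hat)).exists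
    exact ⟨n, k n, hk3 n, hn⟩
  have hSn : ∀ n, P (S n) ≤ ENNReal.ofReal (c / a) := by
    intro n
    let 𝒢 : Filtration ℕ m := ⟨fun k => 𝓕 (τ n k), fun i j hij => 𝓕.mono (hτm n hij), fun k => 𝓕.le _⟩
    have hs : Submartingale (fun k => Y (τ n k)) 𝒢 P :=
      ⟨fun k => h1 _ (hτ0 n k), fun i j hij => h2 _ _ (hτ0 n i) (hτm n hij), fun k => h3 _ (hτ0 n k)⟩
    have hm := maximal_ineq hs (fun k ω => h0 _ (hτ0 n k) ω) (ε := a.toNNReal) (2 ^ n)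
    rw [Real.coe_toNNReal a ha.le] at hm
    have hTn : τ n (2 ^ n) = T := by simp only [τ]; push_cast; field_simp
    rw [ENNReal.ofReal_div_of_pos ha, ENNReal.le_div_iff_mul_le (Or.inl (by simpa using ha)) (Or.inl (by simp)), mul_comm]
    have hle : P (S n) ≤ P {ω | a ≤ (Finset.range (2 ^ n + 1)).sup' Finset.nonempty_range_add_one fun k => Y (τ n k) ω} := by
      refine measure_mono ?_
      rintro ω ⟨k, hk, h⟩
      exact h.le.trans (Finset.le_sup' (fun k => Y (τ n k) ω) (Finset.mem_range.2 (by omega)))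
    calc ENNReal.ofReal a * P (S n) ≤ ENNReal.ofReal a * P _ := by gcongr
      _ ≤ _ := hm
      _ ≤ ENNReal.ofReal c := by
        refine ENNReal.ofReal_le_ofReal (le_trans ?_ hc)
        rw [hTn]
        exact setIntegral_le_integral (h3 T hT) (Eventually.of_forall (h0 T hT))
  calc _ ≤ P (⋃ n, S n) := measure_mono hsub
    _ = ⨆ n, P (S n) := hS.measure_iUnion
    _ ≤ _ := iSup_le hSn

lemma doob_abs {M : ℝ → Ω → ℝ} (hM : Martingale M 𝓕 P) {T a c : ℝ} (hT : 0 ≤ T) (ha : 0 < a)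
    (hrc : ∀ ω t, 0 ≤ t → ContinuousWithinAt (fun s => M s ω) (Set.Ici t) t)
    (hc : ∫ ω, |M T ω - M 0 ω| ∂P ≤ c) :
    P {ω | ∃ t, 0 ≤ t ∧ t ≤ T ∧ a < |M t ω - M 0 ω|} ≤ ENNReal.ofReal (c / a) := by
  have hi : ∀ t, Integrable (fun ω => M t ω - M 0 ω) P := fun t => (hM.integrable t).sub (hM.integrable 0)
  have hsm : ∀ t, 0 ≤ t → StronglyMeasurable[𝓕 t] fun ω => M t ω - M 0 ω := fun t ht =>
    (hM.1 t).sub ((hM.1 0).mono (𝓕.mono ht))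
  refine doob (𝓕 := 𝓕) (Y := fun t ω => |M t ω - M 0 ω|) hT ha (fun t ht => ?_) (fun s t hs hst => ?_) (fun t _ => (hi t).abs)
    (fun _ _ _ => abs_nonneg _) (fun ω t ht => ((hrc ω t ht).sub continuousWithinAt_const).abs) hc
  · exact (hsm t ht).norm
  · have e1 : P[fun ω => M t ω - M 0 ω | 𝓕 s] =ᵐ[P] fun ω => M s ω - M 0 ω := by
      have a1 := condExp_sub (hM.integrable t) (hM.integrable 0) (𝓕 s)
      have a2 := hM.2 s t hst
      have a3 := condExp_of_stronglyMeasurable (𝓕.le s) ((hM.1 0).mono (𝓕.mono hs)) (hM.integrable 0)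
      filter_upwards [a1, a2] with ω a1 a2
      change (P[M t - M 0 | 𝓕 s]) ω = _
      rw [a1, Pi.sub_apply, a2, a3]
    have e2 := condExp_mono (m := 𝓕 s) (hi t) (hi t).abs (Eventually.of_forall fun ω => le_abs_self _)
    have e3 := condExp_mono (m := 𝓕 s) (hi t).neg (hi t).abs (Eventually.of_forall fun ω => neg_le_abs _)
    have e4 := condExp_neg (μ := P) (fun ω => M t ω - M 0 ω) (𝓕 s)
    filter_upwards [e1, e2, e3, e4] with ω e1 e2 e3 e4
    rw [e1] at e2
    rw [e4, Pi.neg_apply, e1] at e3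
    exact abs_le'.2 ⟨e2, e3⟩

end doob

section proc
variable {Ω : Type*} {m : MeasurableSpace Ω} {B : Vd d → Measure (Vd d)} {N : ℕ} {P : Measure Ω}
  {𝓕 : Filtration ℝ m} {μp : ℝ → Ω → Measure (Vd d)} {κ : ℝ} {Bn : Kernel (Vd d) (Vd d)}

lemma kp_M (hK : GoodKer B κ Bn) (h : IsKacProcess B N P 𝓕 μp) {φ : Vd d → ℝ} (hφ : Measurable φ) {b : ℝ}
    (hb : ∀ v, |φ v| ≤ b) :
    Martingale (fun t ω => (∫ v, φ v ∂(μp t ω)) - ∫ s in Set.Ioc 0 t, QInt B φ (μp s ω) (μp s ω)) 𝓕 P := by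
  obtain ⟨G, g1, g2, g3⟩ := exists_G hφ hb
  have := h.martingale G g1 ⟨b, g2⟩
  have e1 := fun s ω => gen1 hK (h.mem s ω) hφ hb g3
  have e2 : ∀ t ω, G (μp t ω) = ∫ v, φ v ∂(μp t ω) := fun t ω => g3 _ (kp_prob h t ω)
  simp only [e1] at this
  simpa only [e2] using this

lemma kp_L (hK : GoodKer B κ Bn) (h : IsKacProcess B N P 𝓕 μp) {φ : Vd d → ℝ} (hφ : Measurable φ) {b : ℝ}
    (hb : ∀ v, |φ v| ≤ b) :
    Martingale (fun t ω => (∫ v, φ v ∂(μp t ω)) ^ 2 - ∫ s in Set.Ioc 0 t,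
      (2 * (∫ v, φ v ∂(μp s ω)) * QInt B φ (μp s ω) (μp s ω) + gam Bn N φ (μp s ω))) 𝓕 P := by
  obtain ⟨G, g1, g2, g3⟩ := exists_G hφ hb
  have := h.martingale (fun ν => G ν ^ 2) (g1.pow_const 2) ⟨b ^ 2, fun ν => by
    rw [abs_pow]; exact pow_le_pow_left₀ (abs_nonneg _) (g2 ν) 2⟩
  have e1 := fun s ω => gen2 hK (h.mem s ω) hφ hb g3
  have e2 : ∀ t ω, G (μp t ω) = ∫ v, φ v ∂(μp t ω) := fun t ω => g3 _ (kp_prob h t ω)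
  simp only [e1] at this
  simpa only [e2] using this

lemma meas_gam (hK : GoodKer B κ Bn) {f : Vd d → ℝ} (hf : Measurable f) :
    Measurable (fun x : Vd d × Vd d => ‖x.1 - x.2‖ * ∫ σ, (dlt f x.1 x.2 σ) ^ 2 ∂(Bn (x.1 - x.2))) := by
  have := hK.markov
  refine Measurable.mul (by fun_prop) ?_
  let η : Kernel (Vd d × Vd d) (Vd d) := Bn.comap (fun x => x.1 - x.2) (by fun_prop)
  have hm : StronglyMeasurable (fun y : (Vd d × Vd d) × Vd d => (dlt f y.1.1 y.1.2 y.2) ^ 2) := by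
    have h1 := (continuous_postV (d := d)).measurable
    have h2 := (continuous_postVs (d := d)).measurable
    refine Measurable.stronglyMeasurable ?_
    unfold dlt
    fun_prop
  have := (hm.integral_kernel_prod_right' (κ := η)).measurable
  exact this

lemma kp_rcM (hK : GoodKer B κ Bn) (h : IsKacProcess B N P 𝓕 μp) {φ : Vd d → ℝ} (hφ : Continuous φ) {b : ℝ}
    (hb : ∀ v, |φ v| ≤ b) (ω : Ω) (t : ℝ) (ht : 0 ≤ t) :
    ContinuousWithinAt (fun t => (∫ v, φ v ∂(μp t ω)) - ∫ s in Set.Ioc 0 t, QInt B φ (μp s ω) (μp s ω))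
      (Set.Ici t) t := by
  refine (kp_rc h hφ hb ω t).sub ?_
  have hg := kp_path h le_rfl ω
  have hc := intervalIntegral.continuous_primitive (μ := volume) (f := fun s => QInt B φ (μp s ω) (μp s ω))
    (fun a b => ⟨cQInt_intOn hK hg hφ _ _, cQInt_intOn hK hg hφ _ _⟩) 0
  refine (hc.continuousWithinAt (s := Set.Ici t) (x := t)).congr (fun s hs => ?_) ?_
  · rw [intervalIntegral.integral_of_le (ht.trans hs)]
  · rw [intervalIntegral.integral_of_le ht]

lemma kp_noise (hK : GoodKer B κ Bn) [IsProbabilityMeasure P] (h : IsKacProcess B N P 𝓕 μp)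
    {φ : Vd d → ℝ} (hφ : Continuous φ) (hb : ∀ v, |φ v| ≤ 1) {T δ : ℝ} (hT : 0 ≤ T) (hδ : 0 < δ) :
    P {ω | ∃ t, 0 ≤ t ∧ t ≤ T ∧ δ < |nz B (fun t => μp t ω) φ 0 t|}
      ≤ ENNReal.ofReal ((1 + 32 * T) / √N / δ) := by
  have hne : Nonempty Ω := P.nonempty_of_neZero
  obtain ⟨ω0⟩ := hne
  have hN := (emp_facts (h.mem 0 ω0)).1
  have hN0 : (0:ℝ) < N := by exact_mod_cast hN
  have hs0 : 0 < √(N:ℝ) := Real.sqrt_pos.2 hN0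
  have hm := hφ.measurable
  have hjm := kp_joint h
  have hjp : ∀ x : ℝ × Ω, IsProbabilityMeasure (μp x.1 x.2) := fun x => kp_prob h _ _
  have mX := meas_int_k hjm hjp hm
  have mA : Measurable fun x : ℝ × Ω => QInt B φ (μp x.1 x.2) (μp x.1 x.2) := by
    simp only [QInt_eq hK]; exact meas_bil_k hjm hjp (measurable_colJ hK hm)
  have mG : Measurable fun x : ℝ × Ω => gam Bn N φ (μp x.1 x.2) :=
    (meas_bil_k hjm hjp (meas_gam hK hm)).const_mul _
  have adX : Measurable[𝓕 0] fun ω => ∫ v, φ v ∂(μp 0 ω) :=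
    meas_int_k (kp_adapted h 0) (kp_prob h 0) hm
  have adA : ∀ t, Measurable[𝓕 t] fun ω => QInt B φ (μp t ω) (μp t ω) := fun t => by
    simp only [QInt_eq hK]; exact meas_bil_k (kp_adapted h t) (kp_prob h t) (measurable_colJ hK hm)
  have hM := kp_M hK h hm hb
  have hsq := sq_bound (𝓕 := 𝓕) (P := P) (X := fun t ω => ∫ v, φ v ∂(μp t ω)) (A := fun t ω => QInt B φ (μp t ω) (μp t ω))
    (Γ := fun t ω => gam Bn N φ (μp t ω)) hT mX mA mG (fun t ω => int_abs_le (kp_prob h t ω) hb)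
    (fun t ω => QInt_abs hK (h.mem t ω) hb) (fun t ω => gam_abs hK (h.mem t ω) hb) adX adA hM (kp_L hK h hm hb)
  set M : ℝ → Ω → ℝ := fun t ω => (∫ v, φ v ∂(μp t ω)) - ∫ s in Set.Ioc 0 t, QInt B φ (μp s ω) (μp s ω) with hMd
  have hM0 : ∀ ω, M 0 ω = ∫ v, φ v ∂(μp 0 ω) := fun ω => by simp [hMd]
  have hsq' : ∫ ω, (M T ω - M 0 ω) ^ 2 ∂P ≤ 32 * 1 ^ 2 / N * T := by
    simp only [hM0]; exact hsq
  have bMT : ∀ ω, |M T ω - M 0 ω| ≤ 1 + 8 * T + 1 := fun ω => by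
    refine (abs_sub _ _).trans (add_le_add ((abs_sub _ _).trans (add_le_add (int_abs_le (kp_prob h T ω) hb) ?_)) ?_)
    · have := norm_integral_le_of_norm_le_const (μ := (volume : Measure ℝ).restrict (Set.Ioc 0 T)) (C := 8 * 1)
        (f := fun s => QInt B φ (μp s ω) (μp s ω))
        (Eventually.of_forall fun s => QInt_abs hK (h.mem s ω) hb)
      simpa [hT] using this
    · rw [hM0]; exact int_abs_le (kp_prob h 0 ω) hb
  have hi : Integrable (fun ω => M T ω - M 0 ω) P := (hM.integrable T).sub (hM.integrable 0)
  have hi2 : Integrable (fun ω => (M T ω - M 0 ω) ^ 2) P := by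
    have := hi.mul_bdd (c := 1 + 8 * T + 1) hi.aestronglyMeasurable (Eventually.of_forall bMT)
    simpa only [← sq] using this
  have hE : ∫ ω, |M T ω - M 0 ω| ∂P ≤ (1 + 32 * T) / √N := by
    have hp : ∀ ω, |M T ω - M 0 ω| ≤ (√N)⁻¹ / 2 + √N / 2 * (M T ω - M 0 ω) ^ 2 := fun ω => by
      generalize M T ω - M 0 ω = y
      have h1 : (√(N:ℝ))⁻¹ / 2 + √N / 2 * y ^ 2 - |y| = ((√(N:ℝ))⁻¹ / 2) * (√N * |y| - 1) ^ 2 := by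
        rw [← sq_abs y]; field_simp; ring
      have : 0 ≤ ((√(N:ℝ))⁻¹ / 2) * (√N * |y| - 1) ^ 2 := by positivity
      linarith
    calc _ ≤ ∫ ω, ((√N)⁻¹ / 2 + √N / 2 * (M T ω - M 0 ω) ^ 2) ∂P :=
          integral_mono hi.abs ((integrable_const _).add (hi2.const_mul _)) hp
      _ = (√N)⁻¹ / 2 + √N / 2 * ∫ ω, (M T ω - M 0 ω) ^ 2 ∂P := by
          rw [integral_add (integrable_const _) (hi2.const_mul _), integral_const_mul]; simp
      _ ≤ (√N)⁻¹ / 2 + √N / 2 * (32 * 1 ^ 2 / N * T) := by gcongr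
      _ = (1 / 2 + 16 * T) / √N := by
          have : (N:ℝ) = √N * √N := (Real.mul_self_sqrt hN0.le).symm
          rw [this, Real.sqrt_mul_self hs0.le]; field_simp; ring
      _ ≤ _ := by gcongr <;> linarith
  have := doob_abs hM hT hδ (fun ω t ht => kp_rcM hK h hφ hb ω t ht) hE
  convert this using 8 with ω t
  rw [hM0]
  simp only [nz, hMd]
  ring_nf

end proc
end KacAux

namespace KacAux
variable {d : ℕ} {B : Vd d → Measure (Vd d)} {κ : ℝ} {Bn : Kernel (Vd d) (Vd d)}

lemma conv_eta {p θ x y : ℝ} (hp : 2 < p) (hp3 : p ≤ 3) (hθ : 0 < θ) (hθ1 : θ < 1) (hx : 0 ≤ x) (hy : 0 ≤ y) :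
    (x + y) ^ p ≤ ((1 - θ) ^ 2)⁻¹ * x ^ p + (θ ^ 2)⁻¹ * y ^ p := by
  have h1 : 0 < 1 - θ := by linarith
  have key : ∀ a z : ℝ, 0 < a → a < 1 → 0 ≤ z → a * (z / a) ^ p ≤ (a ^ 2)⁻¹ * z ^ p := by
    intro a z ha ha1 hz
    rw [Real.div_rpow hz ha.le]
    have : a ^ 3 ≤ a ^ p := by
      rw [← Real.rpow_natCast]
      exact Real.rpow_le_rpow_of_exponent_ge ha ha1.le (by push_cast; exact hp3)
    have hz' : 0 ≤ z ^ p := by positivity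
    calc a * (z ^ p / a ^ p) ≤ a * (z ^ p / a ^ 3) := by gcongr
      _ = _ := by field_simp
  have h := (convexOn_rpow (by linarith : (1:ℝ) ≤ p)).2 (x := x / (1 - θ)) (y := y / θ)
    (Set.mem_Ici.2 (by positivity)) (Set.mem_Ici.2 (by positivity)) h1.le hθ.le (by ring)
  simp only [smul_eq_mul] at h
  rw [mul_div_cancel₀ _ h1.ne', mul_div_cancel₀ _ hθ.ne'] at h
  exact h.trans (add_le_add (key _ _ h1 (by linarith) hx) (key _ _ hθ hθ1 hy))

lemma continuous_npow {p : ℝ} (hp : 0 ≤ p) : Continuous (fun v : Vd d => ‖v‖ ^ p) :=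
  continuous_norm.rpow_const fun _ => Or.inr hp

lemma pov_one (hK : GoodKer B κ Bn) {p : ℝ} (hp : 2 < p) (hp3 : p ≤ 3) :
    ∃ c > 0, ∃ C ≥ 0, ∀ v vs : Vd d,
      ∫ σ, (‖postV v vs σ‖ ^ p + ‖postVs v vs σ‖ ^ p - ‖v‖ ^ p - ‖vs‖ ^ p) ∂(Bn (v - vs))
        ≤ - c * ‖v‖ ^ p + C * ‖vs‖ ^ p := by
  have := hK.markov
  obtain ⟨c0, hc1, hc0, hc⟩ := hK.pov p hp
  obtain ⟨θ, hθ⟩ : ∃ θ : ℝ, θ = (1 - c0) / 8 := ⟨_, rfl⟩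
  have hθ0 : 0 < θ := by linarith
  have hθ1 : θ < 1 := by linarith
  have h4 : c0 < (1 - θ) ^ 2 * (1 - θ) ^ 2 := by
    have : 1 - 2 * θ ≤ (1 - θ) ^ 2 := by nlinarith
    nlinarith
  set s := ((1 - θ) ^ 2)⁻¹ with hs
  set t := (θ ^ 2)⁻¹ with ht
  have hs0 : 0 < s := by rw [hs]; have : 0 < 1 - θ := by linarith
                         positivity
  have ht0 : 0 < t := by rw [ht]; positivity
  have hss : s * s * c0 < 1 := by
    have : 0 < 1 - θ := by linarith
    rw [hs, ← mul_inv, inv_mul_lt_iff₀ (by positivity)]; linarith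
  have hcv : ∀ x y : ℝ, 0 ≤ x → 0 ≤ y → (x + y) ^ p ≤ s * x ^ p + t * y ^ p :=
    fun x y hx hy => conv_eta hp hp3 hθ0 hθ1 hx hy
  clear_value s t
  refine ⟨1 - s * s * c0, by linarith, s * c0 * t + 2 * t, by positivity, fun v vs => ?_⟩
  set w := v - vs with hw
  have hcp := continuous_npow (d := d) (p := p) (by linarith)
  have e1 : ∀ σ, postV v vs σ = (2:ℝ)⁻¹ • (w + ‖w‖ • σ) + vs := by
    intro σ; simp only [postV, hw, smul_add, smul_sub, smul_smul]; module
  have e2 : ∀ σ, postVs v vs σ = (2:ℝ)⁻¹ • (w - ‖w‖ • σ) + vs := by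
    intro σ; simp only [postVs, hw, smul_add, smul_sub, smul_smul]; module
  have hb : ∀ σ : Vd d, ‖σ‖ = 1 → ‖(2:ℝ)⁻¹ • (w + ‖w‖ • σ)‖ ≤ ‖w‖ ∧ ‖(2:ℝ)⁻¹ • (w - ‖w‖ • σ)‖ ≤ ‖w‖ := by
    intro σ hσ
    have a1 := norm_add_le w (‖w‖ • σ)
    have a2 := norm_sub_le w (‖w‖ • σ)
    have a3 : ‖‖w‖ • σ‖ = ‖w‖ := by rw [norm_smul, hσ]; simp
    constructor <;> rw [norm_smul] <;> norm_num <;> linarith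
  have i0 : Integrable (fun σ => ‖(2:ℝ)⁻¹ • (w + ‖w‖ • σ)‖ ^ p + ‖(2:ℝ)⁻¹ • (w - ‖w‖ • σ)‖ ^ p) (Bn w) := by
    refine hK.integrable w _ ?_ (‖w‖ ^ p + ‖w‖ ^ p) fun σ hσ => ?_
    · exact ((hcp.comp (by fun_prop : Continuous fun σ : Vd d => (2:ℝ)⁻¹ • (w + ‖w‖ • σ))).add
        (hcp.comp (by fun_prop : Continuous fun σ : Vd d => (2:ℝ)⁻¹ • (w - ‖w‖ • σ)))).measurable
    · rw [abs_of_nonneg (by positivity)]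
      have := hb σ hσ
      exact add_le_add (Real.rpow_le_rpow (norm_nonneg _) this.1 (by linarith))
        (Real.rpow_le_rpow (norm_nonneg _) this.2 (by linarith))
  have i1 : Integrable (fun σ => ‖postV v vs σ‖ ^ p + ‖postVs v vs σ‖ ^ p - ‖v‖ ^ p - ‖vs‖ ^ p) (Bn w) := by
    have : Integrable (fun σ => ‖postV v vs σ‖ ^ p + ‖postVs v vs σ‖ ^ p) (Bn w) := by
      refine hK.integrable w _ ?_ ((‖v‖ + ‖vs‖) ^ p + (‖v‖ + ‖vs‖) ^ p) fun σ hσ => ?_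
      · exact ((hcp.comp (continuous_postV' v vs)).add (hcp.comp (continuous_postVs' v vs))).measurable
      · rw [abs_of_nonneg (by positivity)]
        have := post_norm v vs σ hσ
        exact add_le_add (Real.rpow_le_rpow (norm_nonneg _) this.1 (by linarith))
          (Real.rpow_le_rpow (norm_nonneg _) this.2 (by linarith))
    exact (this.sub (integrable_const _)).sub (integrable_const _)
  have hI : ∫ σ, (‖postV v vs σ‖ ^ p + ‖postVs v vs σ‖ ^ p - ‖v‖ ^ p - ‖vs‖ ^ p) ∂(Bn w)
      ≤ ∫ σ, (s * (‖(2:ℝ)⁻¹ • (w + ‖w‖ • σ)‖ ^ p + ‖(2:ℝ)⁻¹ • (w - ‖w‖ • σ)‖ ^ p)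
        + (2 * t * ‖vs‖ ^ p - ‖v‖ ^ p)) ∂(Bn w) := by
    refine integral_mono i1 ((i0.const_mul s).add (integrable_const _)) fun σ => ?_
    have b1 := (Real.rpow_le_rpow (norm_nonneg _) (norm_add_le ((2:ℝ)⁻¹ • (w + ‖w‖ • σ)) vs) (by linarith : 0 ≤ p)).trans
      (hcv _ _ (norm_nonneg _) (norm_nonneg _))
    have b2 := (Real.rpow_le_rpow (norm_nonneg _) (norm_add_le ((2:ℝ)⁻¹ • (w - ‖w‖ • σ)) vs) (by linarith : 0 ≤ p)).trans
      (hcv _ _ (norm_nonneg _) (norm_nonneg _))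
    have b3 : 0 ≤ ‖vs‖ ^ p := by positivity
    simp only [e1, e2]
    linarith
  rw [integral_add (i0.const_mul s) (integrable_const _), integral_const_mul, integral_const] at hI
  simp only [probReal_univ, one_smul] at hI
  have h5 := hc w
  have h6 : ‖w‖ ^ p ≤ s * ‖v‖ ^ p + t * ‖vs‖ ^ p :=
    (Real.rpow_le_rpow (norm_nonneg _) (norm_sub_le v vs) (by linarith : 0 ≤ p)).trans
      (hcv _ _ (norm_nonneg _) (norm_nonneg _))
  calc _ ≤ s * (c0 * (s * ‖v‖ ^ p + t * ‖vs‖ ^ p)) + (2 * t * ‖vs‖ ^ p - ‖v‖ ^ p) := by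
        refine hI.trans ?_
        gcongr
        exact h5.trans (by gcongr)
    _ = _ := by ring

lemma pov_J (hK : GoodKer B κ Bn) {p : ℝ} (hp : 2 < p) (hp3 : p ≤ 3) :
    ∃ c > 0, ∃ C ≥ 0, ∀ v vs : Vd d, colJ Bn (fun v => ‖v‖ ^ p) v vs
        ≤ - c * (‖v‖ ^ (p + 1) + ‖vs‖ ^ (p + 1)) + C * (‖vs‖ * ‖v‖ ^ p + ‖v‖ * ‖vs‖ ^ p) := by
  obtain ⟨c, hc, C, hC, h⟩ := pov_one hK hp hp3
  have key : ∀ v vs : Vd d, ‖vs‖ ≤ ‖v‖ → colJ Bn (fun v => ‖v‖ ^ p) v vs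
      ≤ - (c / 2) * (‖v‖ ^ (p + 1) + ‖vs‖ ^ (p + 1)) + (c + 2 * C) * (‖vs‖ * ‖v‖ ^ p + ‖v‖ * ‖vs‖ ^ p) := by
    intro v vs hle
    have h1 := h v vs
    have hw1 : ‖v‖ - ‖vs‖ ≤ ‖v - vs‖ := norm_sub_norm_le v vs
    have hw2 : ‖v - vs‖ ≤ ‖v‖ + ‖vs‖ := norm_sub_le v vs
    have q1 : ‖v‖ ^ (p + 1) = ‖v‖ ^ p * ‖v‖ := by
      rw [Real.rpow_add_one' (norm_nonneg _) (by linarith)]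
    have q2 : ‖vs‖ ^ (p + 1) = ‖vs‖ ^ p * ‖vs‖ := by
      rw [Real.rpow_add_one' (norm_nonneg _) (by linarith)]
    have q3 : ‖vs‖ ^ p ≤ ‖v‖ ^ p := Real.rpow_le_rpow (norm_nonneg _) hle (by linarith)
    have q4 : 0 ≤ ‖vs‖ ^ p := by positivity
    rw [q1, q2]
    unfold colJ
    have h2 := mul_le_mul_of_nonneg_left h1 (norm_nonneg (v - vs))
    refine h2.trans ?_
    generalize ‖vs‖ ^ p = y at *
    generalize ‖v‖ ^ p = x at *
    have n1 := norm_nonneg v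
    have n2 := norm_nonneg vs
    generalize ‖vs‖ = m at *
    generalize ‖v‖ = M at *
    generalize ‖v - vs‖ = w at *
    have a1 : c * x * (M - m) ≤ c * x * w := by gcongr; nlinarith
    have a2 : C * y * w ≤ C * y * (2 * M) := by gcongr; linarith
    have hx : 0 ≤ x := q4.trans q3
    have a3 : c * (y * m) ≤ c * (x * M) := by gcongr
    have a4 : 0 ≤ C * (m * x) := by positivity
    have a5 : 0 ≤ c * (M * y) := by positivity
    nlinarith
  refine ⟨c / 2, by positivity, c + 2 * C, by positivity, fun v vs => ?_⟩
  rcases le_total ‖vs‖ ‖v‖ with hle | hle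
  · exact key v vs hle
  · rw [colJ_symm hK (continuous_npow (by linarith)).measurable]
    have := key vs v hle
    linarith

end KacAux

namespace KacAux
variable {d : ℕ} {B : Vd d → Measure (Vd d)} {κ : ℝ} {Bn : Kernel (Vd d) (Vd d)}

lemma pow_absorb {p c C : ℝ} (hp : 2 < p) (hc : 0 < c) (hC : 0 ≤ C) :
    ∃ K ≥ 0, ∀ x : ℝ, 0 ≤ x → C * x ^ p ≤ c * x ^ (p + 1) + K := by
  refine ⟨C * (C / c) ^ p, by positivity, fun x hx => ?_⟩
  rw [Real.rpow_add_one' hx (by linarith)]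
  rcases le_total x (C / c) with h | h
  · have : x ^ p ≤ (C / c) ^ p := Real.rpow_le_rpow hx h (by linarith)
    have h2 : C * x ^ p ≤ C * (C / c) ^ p := by gcongr
    have : 0 ≤ c * (x ^ p * x) := by positivity
    linarith
  · rw [div_le_iff₀ hc] at h
    have h2 : x ^ p * C ≤ x ^ p * (x * c) := by gcongr
    have : 0 ≤ C * (C / c) ^ p := by positivity
    linarith

/-- Truncated power. -/
def tp (p : ℝ) (N : ℕ) (v : Vd d) : ℝ := min (‖v‖ ^ p) (√N ^ p)

lemma tp_cont {p : ℝ} (hp : 0 ≤ p) (N : ℕ) : Continuous (tp (d := d) p N) :=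
  (continuous_npow hp).min continuous_const

lemma tp_bd (p : ℝ) (N : ℕ) (v : Vd d) : |tp p N v| ≤ √N ^ p := by
  unfold tp
  rw [abs_of_nonneg (by positivity)]
  exact min_le_right _ _

lemma tp_eq {p : ℝ} (hp : 0 ≤ p) {N : ℕ} {v : Vd d} (hv : ‖v‖ ≤ √N) : tp p N v = ‖v‖ ^ p :=
  min_eq_left (Real.rpow_le_rpow (norm_nonneg _) hv hp)

lemma QInt_pov (hK : GoodKer B κ Bn) {p : ℝ} (hp : 2 < p) (hp3 : p ≤ 3) :
    ∃ c > 0, ∃ C ≥ 0, ∀ (N : ℕ) (μ : Measure (Vd d)), μ ∈ empiricalSphere d N →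
      QInt B (tp p N) μ μ ≤ C - c * ∫ v, ‖v‖ ^ (p + 1) ∂μ := by
  have := hK.markov
  obtain ⟨c, hc, C, hC, h⟩ := pov_J hK hp hp3
  obtain ⟨K, hK0, hab⟩ := pow_absorb hp hc (by positivity : 0 ≤ 2 * C)
  refine ⟨c, hc, K, hK0, fun N μ hμ => ?_⟩
  obtain ⟨hN, hpm, -, x, hx, hae, hxn⟩ := emp_facts hμ
  have fi := fin_integrable hμ
  have hcp := continuous_npow (d := d) (p := p) (by linarith)
  have hct := tp_cont (d := d) (p := p) (by linarith) N
  have hJ : ∀ v vs : Vd d, ‖v‖ ≤ √N → ‖vs‖ ≤ √N → colJ Bn (tp p N) v vs ≤ colJ Bn (fun v => ‖v‖ ^ p) v vs := by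
    intro v vs hv hvs
    unfold colJ
    refine mul_le_mul_of_nonneg_left ?_ (norm_nonneg _)
    refine integral_mono ?_ ?_ fun σ => ?_
    · refine Integrable.of_bound (C := 4 * √N ^ p) ?_ (Eventually.of_forall fun σ => ?_)
      · exact (((((hct.comp (continuous_postV' v vs)).add (hct.comp (continuous_postVs' v vs))).sub continuous_const).sub
          continuous_const).measurable).aestronglyMeasurable
      · have a1 := abs_le.1 (tp_bd p N (postV v vs σ))
        have a2 := abs_le.1 (tp_bd p N (postVs v vs σ))
        have a3 := abs_le.1 (tp_bd p N v)
        have a4 := abs_le.1 (tp_bd p N vs)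
        rw [Real.norm_eq_abs, abs_le]
        constructor <;> linarith
    · have : Integrable (fun σ => ‖postV v vs σ‖ ^ p + ‖postVs v vs σ‖ ^ p) (Bn (v - vs)) := by
        refine hK.integrable _ _ ?_ ((‖v‖ + ‖vs‖) ^ p + (‖v‖ + ‖vs‖) ^ p) fun σ hσ => ?_
        · exact ((hcp.comp (continuous_postV' v vs)).add (hcp.comp (continuous_postVs' v vs))).measurable
        · rw [abs_of_nonneg (by positivity)]
          have := post_norm v vs σ hσ
          exact add_le_add (Real.rpow_le_rpow (norm_nonneg _) this.1 (by linarith))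
            (Real.rpow_le_rpow (norm_nonneg _) this.2 (by linarith))
      exact (this.sub (integrable_const _)).sub (integrable_const _)
    · simp only [tp_eq (by linarith : 0 ≤ p) hv, tp_eq (by linarith : 0 ≤ p) hvs]
      have a1 : tp p N (postV v vs σ) ≤ ‖postV v vs σ‖ ^ p := min_le_left _ _
      have a2 : tp p N (postVs v vs σ) ≤ ‖postVs v vs σ‖ ^ p := min_le_left _ _
      linarith
  rw [QInt_eq hK]
  have hn : ∀ᵐ v ∂μ, ‖v‖ ≤ √N := by
    filter_upwards [hae] with v hv
    obtain ⟨i, rfl⟩ := hv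
    exact hxn i
  have s1 : ∫ v, (∫ vs, colJ Bn (tp p N) v vs ∂μ) ∂μ ≤
      ∫ v, (∫ vs, (- c * (‖v‖ ^ (p + 1) + ‖vs‖ ^ (p + 1)) + C * (‖vs‖ * ‖v‖ ^ p + ‖v‖ * ‖vs‖ ^ p)) ∂μ) ∂μ := by
    refine integral_mono_ae (fi _) (fi _) ?_
    filter_upwards [hn] with v hv
    refine integral_mono_ae (fi _) (fi _) ?_
    filter_upwards [hn] with vs hvs
    exact (hJ v vs hv hvs).trans (h v vs)
  have s2 : ∀ v : Vd d, ∫ vs, (- c * (‖v‖ ^ (p + 1) + ‖vs‖ ^ (p + 1)) + C * (‖vs‖ * ‖v‖ ^ p + ‖v‖ * ‖vs‖ ^ p)) ∂μ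
      = - c * (‖v‖ ^ (p + 1) + ∫ vs, ‖vs‖ ^ (p + 1) ∂μ) + C * ((∫ vs, ‖vs‖ ∂μ) * ‖v‖ ^ p + ‖v‖ * ∫ vs, ‖vs‖ ^ p ∂μ) := by
    intro v
    rw [integral_add (fi _) (fi _), integral_const_mul, integral_const_mul, integral_add (fi _) (fi _),
      integral_add (fi _) (fi _), integral_const_mul, integral_mul_const, integral_const]
    simp
  simp only [s2] at s1
  rw [integral_add (fi _) (fi _), integral_const_mul, integral_const_mul, integral_add (fi _) (fi _),
      integral_add (fi _) (fi _), integral_const_mul, integral_mul_const, integral_const] at s1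
  simp only [probReal_univ, one_smul] at s1
  have s3 : ∫ v, 2 * C * ‖v‖ ^ p ∂μ ≤ ∫ v, (c * ‖v‖ ^ (p + 1) + K) ∂μ :=
    integral_mono (fi _) (fi _) fun v => hab _ (norm_nonneg _)
  rw [integral_add (fi _) (fi _), integral_const_mul, integral_const_mul, integral_const] at s3
  simp only [probReal_univ, one_smul] at s3
  have s4 := norm_mean hμ
  have s5 : 0 ≤ ∫ v, ‖v‖ ^ p ∂μ := integral_nonneg fun v => by positivity
  have s6 : C * ((∫ v, ‖v‖ ∂μ) * ∫ v, ‖v‖ ^ p ∂μ) ≤ C * (1 * ∫ v, ‖v‖ ^ p ∂μ) := by gcongr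
  linarith

section proc
variable {Ω : Type*} {m : MeasurableSpace Ω} {N : ℕ} {P : Measure Ω} [IsProbabilityMeasure P]
  {𝓕 : Filtration ℝ m} {μp : ℝ → Ω → Measure (Vd d)}

lemma kp_moment (hK : GoodKer B κ Bn) {p : ℝ} (hp : 2 < p) (hp3 : p ≤ 3) {T lam : ℝ} (hT : 0 ≤ T) (hl : 0 ≤ lam) :
    ∃ Cm ≥ 0, ∀ (Ω : Type) (m : MeasurableSpace Ω) (P : Measure Ω), IsProbabilityMeasure P →
      ∀ (𝓕 : Filtration ℝ m) (N : ℕ) (μp : ℝ → Ω → Measure (Vd d)), IsKacProcess B N P 𝓕 μp →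
      (∀ ω, ∫ v, ‖v‖ ^ p ∂(μp 0 ω) ≤ lam) → ∀ a > 0,
      P {ω | ∃ t, 0 ≤ t ∧ t ≤ T ∧ a < (∫ v, ‖v‖ ^ p ∂(μp t ω)) +
        ∫ r in Set.Ioc 0 t, (∫ v, ‖v‖ ^ (p + 1) ∂(μp r ω))} ≤ ENNReal.ofReal (Cm / a) := by
  obtain ⟨c, hc, C, hC, hQ⟩ := QInt_pov hK hp hp3
  have hcm : 0 < min 1 c := by positivity
  refine ⟨(lam + C * T) / min 1 c, by positivity, fun Ω m P hP 𝓕 N μp h h0 a ha => ?_⟩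
  have hφ := tp_cont (d := d) (p := p) (by linarith) N
  have hM := kp_M hK h hφ.measurable (tp_bd p N)
  have hrc := kp_rcM hK h hφ (tp_bd p N)
  set M : ℝ → Ω → ℝ := fun t ω => (∫ v, tp p N v ∂(μp t ω)) - ∫ s in Set.Ioc 0 t, QInt B (tp p N) (μp s ω) (μp s ω) with hMd
  have heq : ∀ t ω, ∫ v, tp p N v ∂(μp t ω) = ∫ v, ‖v‖ ^ p ∂(μp t ω) := by
    intro t ω
    refine integral_congr_ae ?_
    filter_upwards [(kp_path h le_rfl ω).bdd t] with v hv
    exact tp_eq (by linarith) hv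
  have hmp : ∀ t ω, 0 ≤ ∫ v, ‖v‖ ^ p ∂(μp t ω) := fun t ω => integral_nonneg fun v => by positivity
  have hmi : ∀ t ω, 0 ≤ ∫ r in Set.Ioc 0 t, (∫ v, ‖v‖ ^ (p + 1) ∂(μp r ω)) :=
    fun t ω => integral_nonneg fun r => integral_nonneg fun v => by positivity
  have hlow : ∀ t, 0 ≤ t → ∀ ω, (∫ v, ‖v‖ ^ p ∂(μp t ω)) +
        c * (∫ r in Set.Ioc 0 t, (∫ v, ‖v‖ ^ (p + 1) ∂(μp r ω))) ≤ M t ω + C * t := by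
    intro t ht ω
    have hg := kp_path h le_rfl ω
    have i1 := cQInt_intOn hK hg hφ 0 t
    have i2 := hg.intOn_cont (continuous_npow (d := d) (p := p + 1) (by linarith)) 0 t
    have hle : ∫ s in Set.Ioc 0 t, QInt B (tp p N) (μp s ω) (μp s ω) ≤
        ∫ s in Set.Ioc 0 t, (C - c * ∫ v, ‖v‖ ^ (p + 1) ∂(μp s ω)) :=
      integral_mono i1 ((integrable_const _).sub (i2.const_mul c)) fun s => hQ N _ (h.mem s ω)
    rw [integral_sub (integrable_const _) (i2.const_mul c), integral_const_mul, integral_const] at hle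
    simp only [measureReal_restrict_apply_univ, Real.volume_real_Ioc, sub_zero, max_eq_left ht, smul_eq_mul] at hle
    simp only [hMd, heq]
    linarith
  have hsub : {ω | ∃ t, 0 ≤ t ∧ t ≤ T ∧ a < (∫ v, ‖v‖ ^ p ∂(μp t ω)) +
        ∫ r in Set.Ioc 0 t, (∫ v, ‖v‖ ^ (p + 1) ∂(μp r ω))} ⊆
      {ω | ∃ t, 0 ≤ t ∧ t ≤ T ∧ min 1 c * a < M t ω + C * t} := by
    rintro ω ⟨t, ht, htT, hat⟩
    refine ⟨t, ht, htT, lt_of_lt_of_le ?_ (hlow t ht ω)⟩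
    have b1 := mul_le_mul_of_nonneg_right (min_le_left 1 c) (hmp t ω)
    have b2 := mul_le_mul_of_nonneg_right (min_le_right 1 c) (hmi t ω)
    have b3 := mul_lt_mul_of_pos_left hat hcm
    linarith
  refine (measure_mono hsub).trans ?_
  have := doob (𝓕 := 𝓕) (P := P) (Y := fun t ω => M t ω + C * t) (c := lam + C * T) hT (by positivity : 0 < min 1 c * a)
    (fun t ht => (hM.1 t).add stronglyMeasurable_const) (fun s t hs hst => ?_)
    (fun t ht => (hM.integrable t).add (integrable_const _)) (fun t ht ω => ?_) (fun ω t ht => ?_) ?_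
  · rwa [div_div]
  · have a1 := condExp_add (hM.integrable t) (integrable_const (μ := P) (C * t)) (𝓕 s)
    have a2 := hM.2 s t hst
    have a3 := condExp_const (μ := P) (𝓕.le s) (C * t)
    filter_upwards [a1, a2] with ω a1 a2
    change _ ≤ (P[M t + (fun _ => C * t) | 𝓕 s]) ω
    rw [a1, Pi.add_apply, a2, a3]
    change M s ω + C * s ≤ M s ω + C * t
    gcongr
  · refine le_trans ?_ (hlow t ht ω)
    have := hmp t ω
    have := hmi t ω
    positivity
  · exact (hrc ω t ht).add (by fun_prop)
  · have e1 : ∫ ω, M T ω ∂P = ∫ ω, M 0 ω ∂P := by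
      have := hM.setIntegral_eq hT (s := Set.univ) MeasurableSet.univ
      simpa using this.symm
    rw [integral_add (hM.integrable T) (integrable_const _), integral_const, e1]
    have e2 : ∫ ω, M 0 ω ∂P ≤ ∫ ω, lam ∂P := by
      refine integral_mono (hM.integrable 0) (integrable_const _) fun ω => ?_
      simp only [hMd, heq, Set.Ioc_self, Measure.restrict_empty, integral_zero_measure, sub_zero]
      exact h0 ω
    simp only [integral_const, probReal_univ, one_smul] at e2 ⊢
    linarith

end proc
end KacAux

namespace KacAux
variable {d : ℕ} {B : Vd d → Measure (Vd d)} {κ : ℝ} {Bn : Kernel (Vd d) (Vd d)}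

lemma wt_diff (v v' : Vd d) : |wt v - wt v'| ≤ (‖v‖ + ‖v'‖) * ‖v - v'‖ := by
  have h1 : wt v - wt v' = (‖v‖ + ‖v'‖) * (‖v‖ - ‖v'‖) := by unfold wt; ring
  rw [h1, abs_mul, abs_of_nonneg (by positivity)]
  gcongr
  exact abs_norm_sub_norm_le v v'

lemma norm_le_wt (v : Vd d) : 2 * ‖v‖ ≤ wt v := by unfold wt; nlinarith [sq_nonneg (‖v‖ - 1)]

lemma testF_cls {f : Vd d → ℝ} (hf : f ∈ testF d) : Cls 2 f := by
  obtain ⟨h1, h2⟩ := hf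
  change ∀ v, |f v / wt v| ≤ 1 at h1
  change ∀ v v', |f v / wt v - f v' / wt v'| ≤ ‖v - v'‖ at h2
  have hw : ∀ v : Vd d, 0 < wt v := fun v => by linarith [wt_pos v]
  constructor
  · intro v
    have := h1 v
    rw [abs_div, abs_of_pos (hw v), div_le_one (hw v)] at this
    linarith [hw v]
  · intro v v'
    have e : f v - f v' = (f v / wt v - f v' / wt v') * wt v + f v' / wt v' * (wt v - wt v') := by
      have := (hw v).ne'
      have := (hw v').ne'
      field_simp; ring
    rw [e]
    refine (abs_add_le _ _).trans ?_
    rw [abs_mul, abs_mul, abs_of_pos (hw v)]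
    have a1 : |f v / wt v - f v' / wt v'| * wt v ≤ ‖v - v'‖ * wt v :=
      mul_le_mul_of_nonneg_right (h2 v v') (hw v).le
    have a2 : |f v' / wt v'| * |wt v - wt v'| ≤ 1 * ((‖v‖ + ‖v'‖) * ‖v - v'‖) :=
      mul_le_mul (h1 v') (wt_diff v v') (abs_nonneg _) zero_le_one
    have a3 : (‖v‖ + ‖v'‖) * ‖v - v'‖ ≤ (wt v + wt v') * ‖v - v'‖ := by
      refine mul_le_mul_of_nonneg_right ?_ (norm_nonneg _)
      linarith [norm_le_wt v, norm_le_wt v', hw v, hw v']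
    have a4 : 0 ≤ wt v' * ‖v - v'‖ := mul_nonneg (hw v').le (norm_nonneg _)
    nlinarith

lemma cls_testF {Z : ℝ} {f : Vd d → ℝ} (hZ : 0 < Z) (hf : Cls Z f) : (fun v => (3 * Z)⁻¹ * f v) ∈ testF d := by
  have hw : ∀ v : Vd d, 0 < wt v := fun v => by linarith [wt_pos v]
  have hq : ∀ v, |f v / wt v| ≤ Z := fun v => by
    rw [abs_div, abs_of_pos (hw v), div_le_iff₀ (hw v)]; exact hf.1 v
  have key : ∀ v v', wt v' ≤ wt v → |f v / wt v - f v' / wt v'| ≤ 3 * Z * ‖v - v'‖ := by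
    intro v v' hle
    have e : f v / wt v - f v' / wt v' = (f v - f v') / wt v - f v' / wt v' * ((wt v - wt v') / wt v) := by
      have := (hw v).ne'
      have := (hw v').ne'
      field_simp; ring
    rw [e]
    refine (abs_sub _ _).trans ?_
    have a1 : |(f v - f v') / wt v| ≤ 2 * Z * ‖v - v'‖ := by
      rw [abs_div, abs_of_pos (hw v), div_le_iff₀ (hw v)]
      refine (hf.2 v v').trans ?_
      have : Z * (wt v + wt v') ≤ Z * (2 * wt v) := by gcongr; linarith
      nlinarith [mul_le_mul_of_nonneg_right this (norm_nonneg (v - v'))]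
    have a2 : |(wt v - wt v') / wt v| ≤ ‖v - v'‖ := by
      rw [abs_div, abs_of_pos (hw v), div_le_iff₀ (hw v)]
      refine (wt_diff v v').trans ?_
      have : ‖v‖ + ‖v'‖ ≤ wt v := by linarith [norm_le_wt v, norm_le_wt v']
      nlinarith [mul_le_mul_of_nonneg_right this (norm_nonneg (v - v'))]
    rw [abs_mul]
    have a3 : |f v' / wt v'| * |(wt v - wt v') / wt v| ≤ Z * ‖v - v'‖ :=
      mul_le_mul (hq v') a2 (abs_nonneg _) hZ.le
    linarith
  refine ⟨fun v => ?_, fun v v' => ?_⟩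
  · change |(3 * Z)⁻¹ * f v / wt v| ≤ 1
    rw [mul_div_assoc, abs_mul, abs_of_pos (by positivity), inv_mul_le_iff₀ (by positivity)]
    linarith [hq v]
  · change |(3 * Z)⁻¹ * f v / wt v - (3 * Z)⁻¹ * f v' / wt v'| ≤ _
    rw [mul_div_assoc, mul_div_assoc, ← mul_sub, abs_mul, abs_of_pos (by positivity), inv_mul_le_iff₀ (by positivity)]
    rcases le_total (wt v') (wt v) with h | h
    · exact key v v' h
    · rw [abs_sub_comm, norm_sub_rev]; exact key v' v h

/-- Probability measure with unit energy. -/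
lemma int_testF {N : ℕ} {μ : Measure (Vd d)} (hμ : μ ∈ empiricalSphere d N) {f : Vd d → ℝ} (hf : f ∈ testF d) :
    |∫ v, f v ∂μ| ≤ 2 := by
  obtain ⟨hN, hp, he, -⟩ := emp_facts hμ
  have fi := fin_integrable hμ
  have h1 : ∀ v, |f v| ≤ 1 + ‖v‖ ^ 2 := fun v => by
    have := hf.1 v
    rwa [abs_div, abs_of_pos (a := 1 + ‖v‖ ^ 2) (by positivity), div_le_one (by positivity)] at this
  calc |∫ v, f v ∂μ| ≤ ∫ v, |f v| ∂μ := abs_integral_le_integral_abs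
    _ ≤ ∫ v, (1 + ‖v‖ ^ 2) ∂μ := integral_mono (fi _) (fi _) h1
    _ = 2 := by rw [integral_add (fi _) (fi _), he]; simp; norm_num

lemma zero_testF : (fun _ => 0 : Vd d → ℝ) ∈ testF d := ⟨fun v => by simp, fun v v' => by simp⟩

lemma W_le {μ ν : Measure (Vd d)} {b : ℝ} (h : ∀ f ∈ testF d, (∫ v, f v ∂μ) - ∫ v, f v ∂ν ≤ b) : Wdist μ ν ≤ b := by
  have : Nonempty (testF d) := ⟨⟨_, zero_testF⟩⟩
  exact ciSup_le fun f => h f.1 f.2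

lemma W_ge {N N' : ℕ} {μ ν : Measure (Vd d)} (hμ : μ ∈ empiricalSphere d N) (hν : ν ∈ empiricalSphere d N')
    {f : Vd d → ℝ} (hf : f ∈ testF d) : (∫ v, f v ∂μ) - ∫ v, f v ∂ν ≤ Wdist μ ν := by
  refine le_ciSup (f := fun f : testF d => (∫ v, (f : Vd d → ℝ) v ∂μ) - ∫ v, (f : Vd d → ℝ) v ∂ν) ⟨4, ?_⟩ ⟨f, hf⟩
  rintro _ ⟨g, rfl⟩
  have a1 := abs_le.1 (int_testF hμ g.2)
  have a2 := abs_le.1 (int_testF hν g.2)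
  dsimp only
  linarith

lemma W_nonneg {N N' : ℕ} {μ ν : Measure (Vd d)} (hμ : μ ∈ empiricalSphere d N) (hν : ν ∈ empiricalSphere d N') :
    0 ≤ Wdist μ ν := by
  have := W_ge hμ hν zero_testF
  simpa using this

lemma W_cls {N N' : ℕ} {μ ν : Measure (Vd d)} (hμ : μ ∈ empiricalSphere d N) (hν : ν ∈ empiricalSphere d N')
    {Z : ℝ} {f : Vd d → ℝ} (hf : Cls Z f) : |(∫ v, f v ∂μ) - ∫ v, f v ∂ν| ≤ Z * (3 * Wdist μ ν) := by
  have key : ∀ g : Vd d → ℝ, Cls Z g → (∫ v, g v ∂μ) - ∫ v, g v ∂ν ≤ Z * (3 * Wdist μ ν) := by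
    intro g hg
    rcases hg.nonneg.eq_or_lt with h | h
    · have : ∀ v, g v = 0 := fun v => by
        have := hg.1 v
        rw [← h, zero_mul] at this
        exact abs_nonpos_iff.1 this
      simp [this, ← h]
    · have := W_ge hμ hν (cls_testF h hg)
      rw [integral_const_mul, integral_const_mul, ← mul_sub, inv_mul_le_iff₀ (by positivity)] at this
      linarith
  have hneg : Cls Z (fun v => - f v) := by
    refine ⟨fun v => by rw [abs_neg]; exact hf.1 v, fun v v' => ?_⟩
    rw [show -f v - -f v' = -(f v - f v') by ring, abs_neg]
    exact hf.2 v v'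
  refine abs_le.2 ⟨?_, key f hf⟩
  have := key _ hneg
  rw [integral_neg, integral_neg] at this
  linarith

lemma mom_red {N : ℕ} {μ : Measure (Vd d)} (hμ : μ ∈ empiricalSphere d N) {p q lam : ℝ} (hq : 0 ≤ q) (hqp : q ≤ p)
    (hl : 0 ≤ lam) (h : momentL p μ ≤ ENNReal.ofReal lam) : ∫ v, ‖v‖ ^ q ∂μ ≤ lam + 1 := by
  obtain ⟨hN, hp, he, -⟩ := emp_facts hμ
  have fi := fin_integrable hμ
  have e1 : ∫ v, ‖v‖ ^ p ∂μ ≤ lam := by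
    rw [integral_eq_lintegral_of_nonneg_ae (Eventually.of_forall fun v => by positivity) (fi _).1]
    refine ENNReal.toReal_le_of_le_ofReal hl (le_trans (le_of_eq ?_) h)
    unfold momentL
    congr 1; ext v
    rw [← ENNReal.ofReal_rpow_of_nonneg (norm_nonneg _) (by linarith), ofReal_norm]
    rfl
  calc ∫ v, ‖v‖ ^ q ∂μ ≤ ∫ v, (‖v‖ ^ p + 1) ∂μ := integral_mono (fi _) (fi _) fun v => by
        rcases le_total ‖v‖ 1 with h | h
        · have := Real.rpow_le_one (norm_nonneg v) h hq
          have : 0 ≤ ‖v‖ ^ p := by positivity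
          dsimp only; linarith
        · have := Real.rpow_le_rpow_of_exponent_le h hqp
          dsimp only; linarith
    _ ≤ _ := by rw [integral_add (fi _) (fi _)]; simpa using e1

lemma pow16 {x q : ℝ} (hx : 0 ≤ x) (hq : 0 ≤ q) (hq4 : q ≤ 4) : (1 + x) ^ q ≤ 16 * (1 + x ^ q) := by
  have h2 : (2:ℝ) ^ q ≤ 16 := by
    calc (2:ℝ) ^ q ≤ 2 ^ (4:ℝ) := Real.rpow_le_rpow_of_exponent_le (by norm_num) hq4
      _ = 16 := by norm_num
  have hxq : 0 ≤ x ^ q := by positivity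
  rcases le_total x 1 with h | h
  · calc (1 + x) ^ q ≤ 2 ^ q := Real.rpow_le_rpow (by positivity) (by linarith) hq
      _ ≤ _ := by linarith
  · calc (1 + x) ^ q ≤ (2 * x) ^ q := Real.rpow_le_rpow (by positivity) (by linarith) hq
      _ = 2 ^ q * x ^ q := Real.mul_rpow (by norm_num) hx
      _ ≤ 16 * x ^ q := by gcongr
      _ ≤ _ := by linarith

lemma one_good (hd : 0 < d) (hK : GoodKer B κ Bn) {β T lam ε : ℝ} (hβ : 0 < β) (hβ1 : β ≤ 1) (hT : 0 ≤ T)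
    (hl : 0 ≤ lam) (hε : 0 < ε) :
    ∃ K ≥ 0, ∃ Ce ≥ 0, ∃ E n0 : ℕ, 1 ≤ E ∧ 1 ≤ n0 ∧ ∀ n : ℕ, n0 ≤ n →
      ∀ (Ω : Type) (m : MeasurableSpace Ω) (P : Measure Ω), IsProbabilityMeasure P →
      ∀ (𝓕 : Filtration ℝ m) (N : ℕ) (μp : ℝ → Ω → Measure (Vd d)), IsKacProcess B N P 𝓕 μp →
      (∀ ω, ∫ v, ‖v‖ ^ (2 + β) ∂(μp 0 ω) ≤ lam) → n ^ E ≤ N →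
      ∃ S : Set Ω, P S ≤ ENNReal.ofReal ε ∧ ∀ ω, ω ∉ S →
        (∀ Z f, Cls Z f → ∀ s t, 0 ≤ s → s ≤ t → t ≤ T →
          |nz B (fun t => μp t ω) f s t| ≤ Z * (Ce * ((n:ℝ) ^ 2)⁻¹)) ∧
        ∫ r in Set.Ioc 0 T, Sp β (fun t => μp t ω) r ≤ K := by
  obtain ⟨Cm, hCm, hmom⟩ := kp_moment hK (p := 2 + β) (by linarith) (by linarith) hT hl
  obtain ⟨a, ha⟩ : ∃ a, a = 2 * Cm / ε + 1 := ⟨_, rfl⟩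
  have ha0 : 0 < a := by rw [ha]; positivity
  have hae : Cm / a ≤ ε / 2 := by
    rw [div_le_iff₀ ha0, ha]; field_simp; nlinarith
  have hK0 : 0 ≤ 16 * (1 + T + a) := by positivity
  obtain ⟨Ce, hCe, C1, q, A, hC1, hred⟩ := noise_red (T := T) hd hK hβ hβ1 hK0
  obtain ⟨k, hk⟩ := exists_nat_ge (2 * (C1 * (1 + 32 * T)) / ε)
  refine ⟨16 * (1 + T + a), hK0, Ce, hCe, 2 * (q + A + 1), k + 1, by omega, by omega, ?_⟩
  intro n hn Ω m P hP 𝓕 N μp h h0 hnN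
  have hn1 : 1 ≤ n := by omega
  have hnr : (1:ℝ) ≤ n := by exact_mod_cast hn1
  have hkn : (k:ℝ) ≤ n := by exact_mod_cast (by omega : k ≤ n)
  obtain ⟨ι, hι, φ, hcard, hφ, hred⟩ := hred n hn1
  have hS1 := hmom Ω m P hP 𝓕 N μp h h0 a ha0
  set S1 := {ω | ∃ t, 0 ≤ t ∧ t ≤ T ∧ a < (∫ v, ‖v‖ ^ (2 + β) ∂(μp t ω)) +
        ∫ r in Set.Ioc 0 t, (∫ v, ‖v‖ ^ (2 + β + 1) ∂(μp r ω))} with hS1d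
  have hδ : 0 < ((n:ℝ) ^ A)⁻¹ := by positivity
  have hS2 : P (⋃ j, {ω | ∃ t, 0 ≤ t ∧ t ≤ T ∧ ((n:ℝ) ^ A)⁻¹ < |nz B (fun t => μp t ω) (φ j) 0 t|})
      ≤ ENNReal.ofReal (ε / 2) := by
    refine (measure_iUnion_fintype_le P _).trans ?_
    refine (Finset.sum_le_sum fun j _ => kp_noise hK h (hφ j).1 (hφ j).2 hT hδ).trans ?_
    rw [Finset.sum_const, nsmul_eq_mul, Finset.card_univ, ← ENNReal.ofReal_natCast,
      ← ENNReal.ofReal_mul (by positivity)]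
    refine ENNReal.ofReal_le_ofReal ?_
    have hs : (n:ℝ) ^ (q + A + 1) ≤ √N := by
      refine Real.le_sqrt_of_sq_le ?_
      rw [← pow_mul, mul_comm]
      exact_mod_cast hnN
    calc (Fintype.card ι : ℝ) * ((1 + 32 * T) / √N / ((n:ℝ) ^ A)⁻¹)
        ≤ (C1 * (n:ℝ) ^ q) * ((1 + 32 * T) / (n:ℝ) ^ (q + A + 1) / ((n:ℝ) ^ A)⁻¹) := by gcongr
      _ = C1 * (1 + 32 * T) / n := by
          rw [pow_add, pow_add]; field_simp
      _ ≤ ε / 2 := by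
          rw [div_le_iff₀ (by positivity)]
          have := hk.trans hkn
          rw [div_le_iff₀ hε] at this
          linarith
  refine ⟨S1 ∪ ⋃ j, {ω | ∃ t, 0 ≤ t ∧ t ≤ T ∧ ((n:ℝ) ^ A)⁻¹ < |nz B (fun t => μp t ω) (φ j) 0 t|}, ?_, ?_⟩
  · refine (measure_union_le _ _).trans ((add_le_add (hS1.trans (ENNReal.ofReal_le_ofReal hae)) hS2).trans ?_)
    rw [← ENNReal.ofReal_add (by positivity) (by positivity)]
    simp
  · intro ω hω
    rw [Set.mem_union, not_or] at hω
    obtain ⟨w1, w2⟩ := hω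
    simp only [hS1d, Set.mem_ofPred_eq, not_exists, not_and, not_lt] at w1
    simp only [Set.mem_iUnion, Set.mem_ofPred_eq, not_exists, not_and, not_lt] at w2
    have hg := kp_path h le_rfl ω
    have c1 := continuous_npow (d := d) (p := 2 + β) (by linarith)
    have c2 := continuous_npow (d := d) (p := 2 + β + 1) (by linarith)
    have hU : ∀ t, 0 ≤ t → t ≤ T → ∫ v, up β v ∂(μp t ω) ≤ 16 * (1 + T + a) := by
      intro t ht htT
      have fi := fin_integrable (h.mem t ω)
      have := kp_prob h t ω
      have q1 : ∫ v, up β v ∂(μp t ω) ≤ ∫ v, 16 * (1 + ‖v‖ ^ (2 + β)) ∂(μp t ω) :=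
        integral_mono (fi _) (fi _) fun v => pow16 (norm_nonneg _) (by linarith) (by linarith)
      rw [integral_const_mul, integral_add (fi _) (fi _), integral_const] at q1
      simp only [probReal_univ, one_smul] at q1
      have q2 := w1 t ht htT
      have q3 : 0 ≤ ∫ r in Set.Ioc 0 t, (∫ v, ‖v‖ ^ (2 + β + 1) ∂(μp r ω)) :=
        integral_nonneg fun r => integral_nonneg fun v => by positivity
      linarith
    have hS : ∫ r in Set.Ioc 0 T, Sp β (fun t => μp t ω) r ≤ 16 * (1 + T + a) := by
      have i1 := hg.intOn_cont (continuous_wp β hβ) 0 T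
      have i2 := hg.intOn_cont c2 0 T
      have q1 : ∫ r in Set.Ioc 0 T, Sp β (fun t => μp t ω) r ≤
          ∫ r in Set.Ioc 0 T, 16 * (1 + ∫ v, ‖v‖ ^ (2 + β + 1) ∂(μp r ω)) := by
        refine integral_mono i1 (((integrable_const _).add i2).const_mul 16) fun r => ?_
        have fi := fin_integrable (h.mem r ω)
        have := kp_prob h r ω
        have q1 : ∫ v, wp β v ∂(μp r ω) ≤ ∫ v, 16 * (1 + ‖v‖ ^ (2 + β + 1)) ∂(μp r ω) := by
          refine integral_mono (fi _) (fi _) fun v => ?_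
          have := pow16 (norm_nonneg v) (by linarith : 0 ≤ 2 + β + 1) (by linarith)
          unfold wp
          rwa [show 2 + β + 1 = 3 + β by ring] at this ⊢
        rw [integral_const_mul, integral_add (fi _) (fi _), integral_const] at q1
        simp only [probReal_univ, one_smul] at q1
        exact q1
      rw [integral_const_mul, integral_add (integrable_const _) i2, integral_const] at q1
      simp only [measureReal_restrict_apply_univ, Real.volume_real_Ioc, sub_zero, max_eq_left hT, smul_eq_mul, mul_one] at q1
      have q2 := w1 T hT le_rfl
      have q3 : 0 ≤ ∫ v, ‖v‖ ^ (2 + β) ∂(μp T ω) := integral_nonneg fun v => by positivity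
      linarith
    exact ⟨hred _ _ hg hU hS w2, hS⟩

end KacAux

open KacAux

theorem kac_consistency_estimate
    (d : ℕ) (hd : 2 ≤ d) (B : Vd d → Measure (Vd d)) (κ : ℝ)
    (hB : IsCollisionKernel B) (hBL : IsLipschitzKernel B κ)
    (ε : ℝ) (hε0 : 0 < ε) (hε1 : ε ≤ 1)
    (lam : ℝ) (hlam : 1 ≤ lam)
    (p : ℝ) (hp : 2 < p) (T : ℝ) (hT : 0 ≤ T) :
    ∃ α : ℝ, 0 < α ∧ ∃ C : ℝ, 0 ≤ C ∧
      ∀ (Ω : Type) (m : MeasurableSpace Ω) (P : Measure Ω),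
        IsProbabilityMeasure P →
      ∀ (𝓕 𝓕' : MeasureTheory.Filtration ℝ m) (N N' : ℕ), N ≤ N' →
      ∀ (μN : ℝ → Ω → Measure (Vd d)) (μN' : ℝ → Ω → Measure (Vd d)),
        IsKacProcess B N P 𝓕 μN → IsKacProcess B N' P 𝓕' μN' →
        (∀ ω, momentL p (μN 0 ω) ≤ ENNReal.ofReal lam) →
        (∀ ω, momentL p (μN' 0 ω) ≤ ENNReal.ofReal lam) →
        ENNReal.ofReal (1 - ε) <
          P {ω | ∀ t ∈ Set.Icc (0:ℝ) T,
            Wdist (μN t ω) (μN' t ω) ≤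
              C * (Wdist (μN 0 ω) (μN' 0 ω) + (N : ℝ) ^ (-α))} := by
  obtain ⟨Bn, hK⟩ := exists_goodKer hd B κ hB hBL
  obtain ⟨β, hβd⟩ : ∃ β, β = min p 3 - 2 := ⟨_, rfl⟩
  have hβ : 0 < β := by rw [hβd]; have : 2 < min p 3 := lt_min hp (by norm_num)
                        linarith
  have hβ1 : β ≤ 1 := by rw [hβd]; linarith [min_le_right p 3]
  have hβp : 2 + β ≤ p := by rw [hβd]; linarith [min_le_left p 3]
  obtain ⟨K, hK0, Ce, hCe, E, n0, hE, hn0, hone⟩ := one_good (T := T) (lam := lam + 1) (ε := ε / 4)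
    (by omega) hK hβ hβ1 hT (by linarith) (by linarith)
  obtain ⟨C, hC, hdet⟩ := det_est (T := T) hK hβ hβ1 hT hK0 hCe
  set γ : ℝ := β ^ 2 / 4 with hγ
  have hγ0 : 0 < γ := by positivity
  have hE0 : (0:ℝ) < E := by exact_mod_cast hE
  refine ⟨γ / E, by positivity, 6 * C + 2 * C * 2 ^ γ + 4 * (n0:ℝ) ^ γ, by positivity, ?_⟩
  intro Ω m P hP 𝓕 𝓕' N N' hNN μ μ' h h' hm hm'
  obtain ⟨ω0⟩ : Nonempty Ω := P.nonempty_of_neZero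
  have hN1 : (1:ℝ) ≤ N := by exact_mod_cast (emp_facts (h.mem 0 ω0)).1
  obtain ⟨x, hx⟩ : ∃ x : ℝ, x = (N:ℝ) ^ ((E:ℝ)⁻¹) := ⟨_, rfl⟩
  have hx1 : 1 ≤ x := by rw [hx]; exact Real.one_le_rpow hN1 (by positivity)
  have hxE : x ^ E = N := by
    rw [hx, ← Real.rpow_natCast, ← Real.rpow_mul (by positivity), inv_mul_cancel₀ hE0.ne', Real.rpow_one]
  have hxγ : (N:ℝ) ^ (-(γ / E)) = x ^ (-γ) := by
    rw [hx, ← Real.rpow_mul (by positivity)]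
    congr 1
    field_simp
  rw [hxγ]
  have hxp : 0 < x ^ (-γ) := by positivity
  have hW0 : ∀ t ω, 0 ≤ Wdist (μ t ω) (μ' t ω) := fun t ω => W_nonneg (h.mem t ω) (h'.mem t ω)
  have h2γ : 0 ≤ C * (2:ℝ) ^ γ := by positivity
  have hnγ : 0 ≤ (n0:ℝ) ^ γ := by positivity
  have hlt1 : ENNReal.ofReal (1 - ε) < 1 := by
    rw [ENNReal.ofReal_lt_one]; linarith
  obtain ⟨n, hn⟩ : ∃ n, n = ⌊x⌋₊ := ⟨_, rfl⟩
  have hnx : (n:ℝ) ≤ x := by rw [hn]; exact Nat.floor_le (by linarith)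
  have hxn : x < n + 1 := by rw [hn]; exact Nat.lt_floor_add_one x
  by_cases hnn : n0 ≤ n
  · have hnE : n ^ E ≤ N := by
      have : (n:ℝ) ^ E ≤ N := by rw [← hxE]; gcongr
      exact_mod_cast this
    have hn1 : 1 ≤ n := by omega
    have hn1r : (1:ℝ) ≤ n := by exact_mod_cast hn1
    obtain ⟨S, hS, hSg⟩ := hone n hnn Ω m P hP 𝓕 N μ h
      (fun ω => mom_red (h.mem 0 ω) (by linarith) hβp (by linarith) (hm ω)) hnE
    obtain ⟨S', hS', hSg'⟩ := hone n hnn Ω m P hP 𝓕' N' μ' h'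
      (fun ω => mom_red (h'.mem 0 ω) (by linarith) hβp (by linarith) (hm' ω)) (hnE.trans hNN)
    set G := {ω | ∀ t ∈ Set.Icc (0:ℝ) T, Wdist (μ t ω) (μ' t ω) ≤
      (6 * C + 2 * C * 2 ^ γ + 4 * (n0:ℝ) ^ γ) * (Wdist (μ 0 ω) (μ' 0 ω) + x ^ (-γ))} with hG
    have hsub : (Set.univ : Set Ω) ⊆ G ∪ (S ∪ S') := by
      intro ω _
      by_cases hω : ω ∈ S ∪ S'
      · exact Or.inr hω
      left
      rw [Set.mem_union, not_or] at hω
      obtain ⟨g1, g2⟩ := hSg ω hω.1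
      obtain ⟨g1', g2'⟩ := hSg' ω hω.2
      have hsq : √(N:ℝ) ≤ √(N':ℝ) := Real.sqrt_le_sqrt (by exact_mod_cast hNN)
      have hres := hdet n hn1 (√(N':ℝ)) _ _ (kp_path h hsq ω) (kp_path h' le_rfl ω) g1 g1' g2 g2'
        (3 * Wdist (μ 0 ω) (μ' 0 ω)) (by have := hW0 0 ω; positivity)
        (fun Z f hf => W_cls (h.mem 0 ω) (h'.mem 0 ω) hf)
      intro t ht
      refine W_le fun f hf => ?_
      have h1 := (le_abs_self _).trans (hres t ht.1 ht.2 2 f (testF_cls hf))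
      have h2 : (n:ℝ) ^ (-γ) ≤ 2 ^ γ * x ^ (-γ) := by
        have : (n:ℝ) ^ (-γ) ≤ (x / 2) ^ (-γ) :=
          Real.rpow_le_rpow_of_nonpos (by positivity) (by linarith) (by linarith)
        refine this.trans (le_of_eq ?_)
        rw [Real.div_rpow (by linarith) (by norm_num), Real.rpow_neg (by norm_num : (0:ℝ) ≤ 2), div_inv_eq_mul, mul_comm]
      have h3 : C * (n:ℝ) ^ (-γ) ≤ C * (2 ^ γ * x ^ (-γ)) := by gcongr
      have h4 := hW0 0 ω
      change (∫ v, f v ∂(μ t ω)) - ∫ v, f v ∂(μ' t ω) ≤ _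
      change (∫ v, f v ∂(μ t ω)) - ∫ v, f v ∂(μ' t ω) ≤ _ at h1
      have h5 : 0 ≤ C * x ^ (-γ) := by positivity
      have h6 : 0 ≤ (n0:ℝ) ^ γ * (Wdist (μ 0 ω) (μ' 0 ω) + x ^ (-γ)) := by positivity
      have h7 : 0 ≤ C * 2 ^ γ * Wdist (μ 0 ω) (μ' 0 ω) := by positivity
      linarith
    have hle : (1:ℝ≥0∞) ≤ P G + ENNReal.ofReal (ε / 2) := by
      calc (1:ℝ≥0∞) = P Set.univ := measure_univ.symm
        _ ≤ P (G ∪ (S ∪ S')) := measure_mono hsub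
        _ ≤ P G + (P S + P S') := (measure_union_le _ _).trans (by gcongr; exact measure_union_le _ _)
        _ ≤ P G + (ENNReal.ofReal (ε / 4) + ENNReal.ofReal (ε / 4)) := by gcongr
        _ = _ := by
          rw [← ENNReal.ofReal_add (by positivity) (by positivity)]
          congr 2; ring
    by_contra hcon
    rw [not_lt] at hcon
    have h8 := hle.trans (add_le_add_left hcon (ENNReal.ofReal (ε / 2)))
    rw [← ENNReal.ofReal_add (by linarith) (by positivity), ← ENNReal.ofReal_one,
      ENNReal.ofReal_le_ofReal_iff (by linarith)] at h8
    linarith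
  · have hall : {ω | ∀ t ∈ Set.Icc (0:ℝ) T, Wdist (μ t ω) (μ' t ω) ≤
      (6 * C + 2 * C * 2 ^ γ + 4 * (n0:ℝ) ^ γ) * (Wdist (μ 0 ω) (μ' 0 ω) + x ^ (-γ))} = Set.univ := by
      refine Set.eq_univ_of_forall fun ω t ht => W_le fun f hf => ?_
      have a1 := abs_le.1 (int_testF (h.mem t ω) hf)
      have a2 := abs_le.1 (int_testF (h'.mem t ω) hf)
      have hn0r : (1:ℝ) ≤ n0 := by exact_mod_cast hn0
      have hxn0 : x ≤ n0 := hxn.le.trans (by exact_mod_cast (by omega : n + 1 ≤ n0))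
      have b1 : (n0:ℝ) ^ (-γ) ≤ x ^ (-γ) := Real.rpow_le_rpow_of_nonpos (by linarith) hxn0 (by linarith)
      have b2 : (1:ℝ) ≤ (n0:ℝ) ^ γ * x ^ (-γ) := by
        calc (1:ℝ) = (n0:ℝ) ^ γ * (n0:ℝ) ^ (-γ) := by
              rw [← Real.rpow_add (by linarith)]; simp
          _ ≤ _ := by gcongr
      have h4 := hW0 0 ω
      have c1 : 0 ≤ C * (Wdist (μ 0 ω) (μ' 0 ω) + x ^ (-γ)) := by positivity
      have c2 : 0 ≤ C * 2 ^ γ * (Wdist (μ 0 ω) (μ' 0 ω) + x ^ (-γ)) := by positivity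
      have c3 : 0 ≤ (n0:ℝ) ^ γ * Wdist (μ 0 ω) (μ' 0 ω) := by positivity
      linarith
    rw [hall, measure_univ]
    exact hlt1
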